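/- arXiv:1703.06127 — 2 statements merged into one kernel-verified Lean document; each statement's English description precedes it below -/
import Mathlib

section
/- For every dimension d ≥ 1, every integer N ≥ 2, and every Borel probability measure μ on [0,1]^d, there exist points x_1, ..., x_N ∈ [0,1]^d such that D_N*(x_1, ..., x_N; μ) ≤ 63 √d (2 + log₂ N)^{(3d+1)/2} / N. -/
open MeasureTheory

section GramSchmidtWalk

open Real InnerProductSpace

/-- The normalised moment generating function `𝔼 exp (s (Z - z))` of a sign `Z = ±1` with
mean `z`. -/
noncomputable def signMGF (z s : ℝ) : ℝ := exp (-(z * s)) * (cosh s + z * sinh s)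

lemma one_le_signMGF {z : ℝ} (hz : |z| ≤ 1) (s : ℝ) : 1 ≤ signMGF z s := by
  calc (1 : ℝ) = exp (-(z * s)) * exp (z * s) := by rw [← exp_add]; simp
    _ ≤ _ := by
      unfold signMGF
      gcongr
      exact exp_mul_le_cosh_add_mul_sinh hz s

lemma signMGF_le_exp_sq {z : ℝ} (hz : |z| ≤ 1) (s : ℝ) : signMGF z s ≤ exp (s ^ 2) := by
  have h1 := exp_mul_le_cosh_add_mul_sinh hz (-s)
  have h2 := (exp_pos _).le.trans (exp_mul_le_cosh_add_mul_sinh hz s)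
  rw [mul_neg, cosh_neg, sinh_neg] at h1
  calc signMGF z s ≤ (cosh s + z * -sinh s) * (cosh s + z * sinh s) := by
        unfold signMGF; gcongr
    _ ≤ cosh s * cosh s := by nlinarith [sq_nonneg (z * sinh s)]
    _ ≤ exp (s ^ 2 / 2) * exp (s ^ 2 / 2) := by
        have := cosh_le_exp_half_sq s
        have := (cosh_pos s).le
        gcongr
    _ = exp (s ^ 2) := by rw [← exp_add]; ring_nf

lemma abs_sinh_le_abs_mul_cosh (s : ℝ) : |sinh s| ≤ |s| * cosh s := by
  wlog hs : 0 ≤ s generalizing s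
  · have := this (-s) (by linarith)
    simpa using this
  rw [abs_of_nonneg hs, abs_of_nonneg (sinh_nonneg_iff.2 hs)]
  have hm : MonotoneOn (fun x : ℝ => x * cosh x - sinh x) (Set.Ici 0) := by
    apply monotoneOn_of_deriv_nonneg (convex_Ici 0) (by fun_prop) (by fun_prop)
    intro x hx
    simp only [interior_Ici, Set.mem_Ioi] at hx
    have hd : HasDerivAt (fun x : ℝ => x * cosh x - sinh x)
        (1 * cosh x + x * sinh x - cosh x) x :=
      ((hasDerivAt_id x).mul (hasDerivAt_cosh x)).sub (hasDerivAt_sinh x)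
    rw [hd.deriv]
    have := mul_nonneg hx.le (sinh_nonneg_iff.2 hx.le)
    linarith
  have := hm (Set.mem_Ici.2 le_rfl) (Set.mem_Ici.2 hs) hs
  simp at this
  linarith

lemma signMGF_add_le {z : ℝ} (hz : |z| ≤ 1) (s t : ℝ) :
    signMGF z (s + t) ≤ signMGF z s * exp (2 * |s * t| + t ^ 2) := by
  obtain ⟨h1, h2⟩ := abs_le.1 hz
  set D := cosh s + z * sinh s with hD
  have hDpos : 0 < D := (exp_pos _).trans_le (exp_mul_le_cosh_add_mul_sinh hz s)
  set y := (sinh s + z * cosh s) / D with hy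
  have hyD : y * D = sinh s + z * cosh s := by rw [hy]; field_simp
  have hy1 : |y| ≤ 1 := by
    rw [hy, abs_div, abs_of_pos hDpos, div_le_one hDpos, abs_le]
    have e1 := exp_pos s
    have e2 := exp_pos (-s)
    constructor <;> rw [hD, cosh_eq, sinh_eq] <;> nlinarith
  have hdiff : |y - z| ≤ 2 * |s| := by
    have : (y - z) * D = (1 - z ^ 2) * sinh s := by rw [sub_mul, hyD, hD]; ring
    have h3 : |y - z| * D = (1 - z ^ 2) * |sinh s| := by
      rw [← abs_of_pos hDpos, ← abs_mul, this, abs_mul, abs_of_nonneg]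
      nlinarith
    have h4 := abs_sinh_le_abs_mul_cosh s
    have h5 : |z * sinh s| ≤ |z| * cosh s := by
      rw [abs_mul]
      gcongr
      rw [abs_le]
      have e1 := exp_pos s
      have e2 := exp_pos (-s)
      constructor <;> rw [cosh_eq, sinh_eq] <;> linarith
    have h6 : (1 - z ^ 2) * cosh s ≤ 2 * D := by
      have := (abs_le.1 h5).1
      have hc := cosh_pos s
      have : (1 - |z| ^ 2) * cosh s ≤ 2 * (1 - |z|) * cosh s := by
        gcongr; nlinarith [abs_nonneg z]
      rw [sq_abs] at this
      rw [hD]; nlinarith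
    refine le_of_mul_le_mul_right ?_ hDpos
    calc |y - z| * D = (1 - z ^ 2) * |sinh s| := h3
      _ ≤ (1 - z ^ 2) * (|s| * cosh s) := by
          apply mul_le_mul_of_nonneg_left h4; nlinarith
      _ = |s| * ((1 - z ^ 2) * cosh s) := by ring
      _ ≤ |s| * (2 * D) := by gcongr
      _ = _ := by ring
  have key : signMGF z (s + t) = signMGF z s * (signMGF y t * exp (t * (y - z))) := by
    have e : cosh (s + t) + z * sinh (s + t) = D * (cosh t + y * sinh t) := by
      rw [mul_add, ← mul_assoc, mul_comm D y, hyD, cosh_add, sinh_add, hD]; ring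
    unfold signMGF
    rw [e]
    have : exp (-(z * (s + t))) = exp (-(z * s)) * (exp (-(y * t)) * exp (t * (y - z))) := by
      rw [← exp_add, ← exp_add]; ring_nf
    rw [this]; ring
  rw [key]
  have hpos : 0 ≤ signMGF z s := zero_le_one.trans (one_le_signMGF hz s)
  apply mul_le_mul_of_nonneg_left _ hpos
  calc signMGF y t * exp (t * (y - z)) ≤ exp (t ^ 2) * exp (2 * |s * t|) := by
        refine mul_le_mul (signMGF_le_exp_sq hy1 t) (exp_le_exp.2 ?_) (exp_pos _).le (exp_pos _).le
        refine (le_abs_self _).trans ?_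
        rw [abs_mul, abs_mul]
        nlinarith [abs_nonneg t]
    _ = _ := by rw [← exp_add]; ring_nf

/-- Passing from the pivot residual of squared norm `ρ` to one of squared norm `ρ + T` does not
increase the potential. -/
lemma potential_step {z s t ρ T P P' : ℝ} (hz : |z| ≤ 1) (hρ : 0 ≤ ρ) (hT : 0 ≤ T)
    (hρT : ρ + T ≤ 1 / 16) (hP : P' ≤ P) (ht : t ^ 2 ≤ (P - P') * T) :
    exp (P' / 2) * (signMGF z (s + t) * exp (4 * (s + t) ^ 2 * (1 / 16 - (ρ + T)))) ≤
      exp (P / 2) * (signMGF z s * exp (4 * s ^ 2 * (1 / 16 - ρ))) := by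
  have h0 : 0 ≤ signMGF z s := zero_le_one.trans (one_le_signMGF hz s)
  have h1 := signMGF_add_le hz s t
  set a := |s * t| with ha
  have ha0 : 0 ≤ a := abs_nonneg _
  have hst : s * t ≤ a := le_abs_self _
  set X := P - P' with hX
  have hX0 : 0 ≤ X := by linarith
  have ha2 : a ^ 2 ≤ (s ^ 2 * T) * X := by
    rw [ha, sq_abs, mul_pow]
    nlinarith [sq_nonneg s]
  have hsT : 0 ≤ s ^ 2 * T := by positivity
  have ham : 5 / 2 * a ≤ 4 * (s ^ 2 * T) + 25 / 64 * X := by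
    apply abs_le_of_sq_le_sq' _ (by positivity) |>.2
    nlinarith [sq_nonneg (4 * (s ^ 2 * T) - 25 / 64 * X)]
  have ht2 : t ^ 2 ≤ X / 16 := by nlinarith
  have hD : 4 * (s + t) ^ 2 * (1 / 16 - (ρ + T)) ≤
      4 * s ^ 2 * (1 / 16 - (ρ + T)) + (2 * a + t ^ 2) / 4 := by
    have hd0 : 0 ≤ 1 / 16 - (ρ + T) := by linarith
    have hd1 : 1 / 16 - (ρ + T) ≤ 1 / 16 := by linarith
    have : (s + t) ^ 2 ≤ s ^ 2 + (2 * a + t ^ 2) := by nlinarith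
    have h2 : 0 ≤ 2 * a + t ^ 2 := by positivity
    nlinarith
  calc exp (P' / 2) * (signMGF z (s + t) * exp (4 * (s + t) ^ 2 * (1 / 16 - (ρ + T))))
      ≤ exp (P' / 2) * ((signMGF z s * exp (2 * a + t ^ 2)) *
          exp (4 * (s + t) ^ 2 * (1 / 16 - (ρ + T)))) := by gcongr
    _ = signMGF z s *
          exp (P' / 2 + (2 * a + t ^ 2) + 4 * (s + t) ^ 2 * (1 / 16 - (ρ + T))) := by
        rw [exp_add (P' / 2 + _), exp_add (P' / 2)]; ring
    _ ≤ signMGF z s * exp (P / 2 + 4 * s ^ 2 * (1 / 16 - ρ)) := by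
        gcongr signMGF z s * exp ?_
        nlinarith
    _ = _ := by rw [exp_add]; ring

lemma exists_sum_smul_of_mem_span_image {E ι : Type*} [AddCommGroup E] [Module ℝ E]
    [Fintype ι] (v : ι → E) (S : Set ι) {x : E} (hx : x ∈ Submodule.span ℝ (v '' S)) :
    ∃ a : ι → ℝ, (∀ i ∉ S, a i = 0) ∧ ∑ i, a i • v i = x := by
  induction hx using Submodule.span_induction with
  | mem x hx =>
    classical
    obtain ⟨i, hi, rfl⟩ := hx
    refine ⟨Pi.single i 1, fun j hj => ?_, ?_⟩
    · rw [Pi.single_eq_of_ne]; rintro rfl; exact hj hi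
    · simp [Pi.single_apply]
  | zero => exact ⟨0, by simp, by simp⟩
  | add x y _ _ hx hy =>
    obtain ⟨a, ha, rfl⟩ := hx
    obtain ⟨b, hb, rfl⟩ := hy
    exact ⟨a + b, fun i hi => by simp [ha i hi, hb i hi],
      by simp [add_smul, Finset.sum_add_distrib]⟩
  | smul c x _ hx =>
    obtain ⟨a, ha, rfl⟩ := hx
    exact ⟨c • a, fun i hi => by simp [ha i hi], by simp [Finset.smul_sum, mul_smul]⟩

variable {E : Type*} [NormedAddCommGroup E] [InnerProductSpace ℝ E] [FiniteDimensional ℝ E]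

lemma starProjection_nested {W' W : Submodule ℝ E} (hW : W' ≤ W) (x w : E) :
    ‖x - W'.starProjection x‖ ^ 2 =
        ‖x - W.starProjection x‖ ^ 2 + ‖W.starProjection x - W'.starProjection x‖ ^ 2 ∧
    ‖W'.starProjection w‖ ^ 2 ≤ ‖W.starProjection w‖ ^ 2 ∧
    ⟪w, W.starProjection x - W'.starProjection x⟫_ℝ ^ 2 ≤
      (‖W.starProjection w‖ ^ 2 - ‖W'.starProjection w‖ ^ 2) *
        ‖W.starProjection x - W'.starProjection x‖ ^ 2 := by
  have mem : ∀ x, W.starProjection x - W'.starProjection x ∈ W := fun x =>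
    W.sub_mem (Submodule.starProjection_apply_mem _ _)
      (hW (Submodule.starProjection_apply_mem _ _))
  have orth : ∀ x, ∀ y ∈ W', ⟪W.starProjection x - W'.starProjection x, y⟫_ℝ = 0 := by
    intro x y hy
    have h1 := W'.starProjection_inner_eq_zero x y hy
    have h2 := W.starProjection_inner_eq_zero x y (hW hy)
    rw [inner_sub_left] at h1 h2 ⊢
    linarith
  set e := W.starProjection x - W'.starProjection x with he
  have hx : x - W'.starProjection x = (x - W.starProjection x) + e := by rw [he]; abel
  set f := W.starProjection w - W'.starProjection w with hf
  have hw : W.starProjection w = f + W'.starProjection w := by rw [hf]; abel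
  have hnw : ‖W.starProjection w‖ ^ 2 = ‖f‖ ^ 2 + ‖W'.starProjection w‖ ^ 2 := by
    rw [hw, norm_add_sq_real, orth w _ (Submodule.starProjection_apply_mem _ _)]; ring
  refine ⟨?_, ?_, ?_⟩
  · rw [hx, norm_add_sq_real, W.starProjection_inner_eq_zero x e (mem x)]; ring
  · rw [hnw]; nlinarith [sq_nonneg ‖f‖]
  · have h1 : ⟪w, e⟫_ℝ = ⟪f, e⟫_ℝ := by
      have h2 := W.starProjection_inner_eq_zero w e (mem x)
      have h3 := orth x _ (Submodule.starProjection_apply_mem W' w)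
      rw [real_inner_comm] at h3
      rw [hf]
      rw [inner_sub_left] at h2 ⊢
      linarith
    rw [h1, hnw, add_sub_cancel_right, ← mul_pow]
    exact sq_le_sq' (neg_le_of_abs_le (abs_real_inner_le_norm _ _)) (real_inner_le_norm _ _)

/-- From a point of the cube `[-1, 1]^ι`, moving in a direction `u` supported on the open
coordinates, one can go forward until some coordinate reaches `±1`. -/
lemma exists_step_to_boundary {ι : Type*} [Fintype ι] {z u : ι → ℝ} (hz : ∀ i, |z i| ≤ 1)
    (hu : ∀ i, |z i| = 1 → u i = 0) {p : ι} (hp : u p ≠ 0) :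
    ∃ δ : ℝ, 0 < δ ∧ (∀ i, |z i + δ * u i| ≤ 1) ∧ ∃ i, |z i| < 1 ∧ |z i + δ * u i| = 1 := by
  classical
  set f : ι → ℝ := fun i => (|u i| - u i * z i) / u i ^ 2 with hf
  obtain ⟨i₀, hi₀, hmin⟩ := Finset.exists_min_image (Finset.univ.filter fun i => u i ≠ 0) f
    ⟨p, by simpa using hp⟩
  simp only [Finset.mem_filter, Finset.mem_univ, true_and] at hi₀ hmin
  have hlt : ∀ i, u i ≠ 0 → |z i| < 1 := fun i hi =>
    lt_of_le_of_ne (hz i) fun h => hi (hu i h)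
  have hfi : ∀ i, u i ≠ 0 → f i * u i ^ 2 = |u i| - u i * z i := fun i hi => by
    simp only [hf]; field_simp
  have hpos : ∀ i, u i ≠ 0 → 0 < f i := fun i hi => by
    apply div_pos _ (by positivity)
    have h1 := abs_pos.2 hi
    have h2 : |u i * z i| = |u i| * |z i| := abs_mul _ _
    have h3 := le_abs_self (u i * z i)
    nlinarith [hlt i hi]
  refine ⟨f i₀, hpos i₀ hi₀, fun i => ?_, i₀, hlt i₀ hi₀, ?_⟩
  · by_cases hi : u i = 0
    · simpa [hi] using hz i
    · have h1 := hmin i hi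
      have h2 := hfi i hi
      have h3 : f i₀ * u i ^ 2 ≤ |u i| - u i * z i := by
        rw [← h2]; gcongr
      have h4 := hpos i₀ hi₀
      obtain ⟨h5, h6⟩ := abs_le.1 (hz i)
      rw [abs_le]
      rcases lt_or_gt_of_ne hi with h | h
      · rw [abs_of_neg h] at h3
        constructor <;> nlinarith
      · rw [abs_of_pos h] at h3
        constructor <;> nlinarith
  · have h2 := hfi i₀ hi₀
    rcases lt_or_gt_of_ne hi₀ with h | h
    · rw [abs_of_neg h] at h2
      have : z i₀ + f i₀ * u i₀ = -1 := mul_right_cancel₀ hi₀ (by linarith)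
      rw [this]; simp
    · rw [abs_of_pos h] at h2
      have : z i₀ + f i₀ * u i₀ = 1 := mul_right_cancel₀ hi₀ (by linarith)
      rw [this]; simp

/-- The span of the vectors with fractional coordinate in `z`, the pivot `p` excluded. -/
def nonpivotSpan {ι : Type*} (v : ι → E) (z : ι → ℝ) (p : ι) : Submodule ℝ E :=
  Submodule.span ℝ (v '' {i | |z i| < 1 ∧ i ≠ p})

/-- The potential bounding the moment generating function at `w` of the remaining part of the
Gram–Schmidt walk at position `z` with pivot `p`. -/
noncomputable def walkPotential {ι : Type*} (v : ι → E) (z : ι → ℝ) (p : ι) (w : E) : ℝ :=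
  exp (‖(nonpivotSpan v z p).starProjection w‖ ^ 2 / 2) *
    (signMGF (z p) ⟪w, v p - (nonpivotSpan v z p).starProjection (v p)⟫_ℝ *
      exp (4 * ⟪w, v p - (nonpivotSpan v z p).starProjection (v p)⟫_ℝ ^ 2 *
        (1 / 16 - ‖v p - (nonpivotSpan v z p).starProjection (v p)‖ ^ 2)))

lemma norm_sub_starProjection_sq_le {x : E} {C : ℝ} (hx : ‖x‖ ^ 2 ≤ C) (W : Submodule ℝ E) :
    ‖x - W.starProjection x‖ ^ 2 ≤ C := by
  have h : ‖x‖ ^ 2 = ‖x - W.starProjection x‖ ^ 2 + ‖W.starProjection x‖ ^ 2 := by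
    have h1 := W.starProjection_inner_eq_zero x _ (W.starProjection_apply_mem x)
    conv_lhs => rw [← sub_add_cancel x (W.starProjection x)]
    rw [norm_add_sq_real, h1]; ring
  nlinarith [sq_nonneg ‖W.starProjection x‖]

/-- At the start of a pivot phase the potential is at most the subgaussian bound. -/
lemma walkPotential_le {ι : Type*} {v : ι → E} (hv : ∀ i, ‖v i‖ ^ 2 ≤ 1 / 16) {z : ι → ℝ} {p : ι}
    (hp : |z p| < 1) (w : E) :
    walkPotential v z p w ≤
      exp (‖(Submodule.span ℝ (v '' {i | |z i| < 1})).starProjection w‖ ^ 2 / 2) := by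
  set U := Submodule.span ℝ (v '' {i | |z i| < 1}) with hU
  have hW : nonpivotSpan v z p ≤ U :=
    Submodule.span_mono (Set.image_mono fun i hi => hi.1)
  obtain ⟨-, h2, h3⟩ := starProjection_nested hW (v p) w
  have hpU : U.starProjection (v p) = v p :=
    Submodule.starProjection_eq_self_iff.2 (Submodule.subset_span ⟨p, hp, rfl⟩)
  rw [hpU] at h3
  have hr := norm_sub_starProjection_sq_le (hv p) (nonpivotSpan v z p)
  unfold walkPotential
  set r := v p - (nonpivotSpan v z p).starProjection (v p)
  set s := ⟪w, r⟫_ℝ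
  set X := ‖U.starProjection w‖ ^ 2
  set Y := ‖(nonpivotSpan v z p).starProjection w‖ ^ 2
  calc exp (Y / 2) * (signMGF (z p) s * exp (4 * s ^ 2 * (1 / 16 - ‖r‖ ^ 2)))
      ≤ exp (Y / 2) * (exp (s ^ 2) * exp (4 * s ^ 2 * (1 / 16 - ‖r‖ ^ 2))) := by
        gcongr; exact signMGF_le_exp_sq hp.le s
    _ = exp (Y / 2 + (s ^ 2 + 4 * s ^ 2 * (1 / 16 - ‖r‖ ^ 2))) := by
        rw [exp_add, exp_add]
    _ ≤ exp (X / 2) := by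
        apply exp_le_exp.2
        nlinarith [sq_nonneg s, sq_nonneg ‖r‖, mul_nonneg (sq_nonneg s) (sq_nonneg ‖r‖)]

lemma walkPotential_mono {ι : Type*} {v : ι → E} (hv : ∀ i, ‖v i‖ ^ 2 ≤ 1 / 16) {z z' : ι → ℝ}
    {p : ι} (hzp : |z' p| ≤ 1) (hzz : ∀ i, |z' i| < 1 → |z i| < 1) (w : E) :
    walkPotential v z' p w ≤
      exp (‖(nonpivotSpan v z p).starProjection w‖ ^ 2 / 2) *
    (signMGF (z' p) ⟪w, v p - (nonpivotSpan v z p).starProjection (v p)⟫_ℝ *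
      exp (4 * ⟪w, v p - (nonpivotSpan v z p).starProjection (v p)⟫_ℝ ^ 2 *
        (1 / 16 - ‖v p - (nonpivotSpan v z p).starProjection (v p)‖ ^ 2))) := by
  have hW : nonpivotSpan v z' p ≤ nonpivotSpan v z p :=
    Submodule.span_mono (Set.image_mono fun i hi => ⟨hzz i hi.1, hi.2⟩)
  obtain ⟨h1, h2, h3⟩ := starProjection_nested hW (v p) w
  have hr := norm_sub_starProjection_sq_le (hv p) (nonpivotSpan v z' p)
  have hs : ⟪w, v p - (nonpivotSpan v z' p).starProjection (v p)⟫_ℝ =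
      ⟪w, v p - (nonpivotSpan v z p).starProjection (v p)⟫_ℝ +
      ⟪w, (nonpivotSpan v z p).starProjection (v p) -
        (nonpivotSpan v z' p).starProjection (v p)⟫_ℝ := by
    rw [← inner_add_right]; congr 1; abel
  rw [h1] at hr
  unfold walkPotential
  rw [h1, hs]
  exact potential_step hzp (by positivity) (by positivity) hr h2 h3

/-- Subgaussianity of the Gram–Schmidt walk, in derandomised form. -/
lemma exists_signs_sum_exp_le_walkPotential {ι κ : Type*} [Fintype ι] [Fintype κ] {v : ι → E}
    (hv : ∀ i, ‖v i‖ ^ 2 ≤ 1 / 16) (w : κ → E) (n : ℕ) :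
    ∀ (z : ι → ℝ) (p : ι) (c : κ → ℝ), (∀ i, |z i| ≤ 1) → |z p| < 1 → (∀ k, 0 ≤ c k) →
      (Finset.univ.filter fun i => |z i| < 1).card = n →
      ∃ y : ι → ℝ, (∀ i, |y i| = 1) ∧ (∀ i, |z i| = 1 → y i = z i) ∧
        ∑ k, c k * exp ⟪w k, ∑ i, (y i - z i) • v i⟫_ℝ ≤
          ∑ k, c k * walkPotential v z p (w k) := by
  classical
  induction n using Nat.strong_induction_on with
  | _ n ih =>
  intro z p c hz hp hc hn
  set W := nonpivotSpan v z p with hW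
  set r := v p - W.starProjection (v p) with hr
  obtain ⟨a, ha, hav⟩ := exists_sum_smul_of_mem_span_image v {i | |z i| < 1 ∧ i ≠ p}
    (W.starProjection_apply_mem (v p))
  set u : ι → ℝ := fun i => (if i = p then 1 else 0) - a i with hu
  have hup : u p = 1 := by simp [hu, ha p (by simp)]
  have hu0 : ∀ i, |z i| = 1 → u i = 0 := fun i hi => by
    have h1 : i ≠ p := by rintro rfl; exact hp.ne hi
    have h2 : a i = 0 := ha i (by simp [hi])
    simp [hu, h1, h2]
  have huv : ∑ i, u i • v i = r := by
    simp [hu, sub_smul, Finset.sum_sub_distrib, hav, hr]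
  set s : κ → ℝ := fun k => ⟪w k, r⟫_ℝ with hs
  set K : κ → ℝ := fun k => exp (‖W.starProjection (w k)‖ ^ 2 / 2) *
    exp (4 * s k ^ 2 * (1 / 16 - ‖r‖ ^ 2)) with hK
  have hK0 : ∀ k, 0 ≤ K k := fun k => by positivity
  -- Along the line the potential is affine in the step size.
  have haff : ∀ δ : ℝ, ∑ k, (c k * exp (δ * s k)) * (K k * signMGF (z p + δ) (s k)) =
      ∑ k, c k * walkPotential v z p (w k) +
        δ * ∑ k, c k * (K k * (exp (-(z p * s k)) * sinh (s k))) := by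
    intro δ
    rw [Finset.mul_sum, ← Finset.sum_add_distrib]
    refine Finset.sum_congr rfl fun k _ => ?_
    have e1 : walkPotential v z p (w k) = K k * signMGF (z p) (s k) := by
      simp only [walkPotential, hK, hs, hr, hW]; ring
    have e2 : exp (-((z p + δ) * s k)) = exp (-(z p * s k)) * exp (-(δ * s k)) := by
      rw [← exp_add]; ring_nf
    have e3 : exp (δ * s k) * exp (-(δ * s k)) = 1 := by rw [← exp_add]; simp
    rw [e1]
    unfold signMGF
    rw [e2]
    linear_combination (c k * K k * exp (-(z p * s k)) *
      (cosh (s k) + (z p + δ) * sinh (s k))) * e3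
  obtain ⟨δ, hδ1, ⟨i₀, hi₀, hi₀'⟩, hδ⟩ : ∃ δ : ℝ, (∀ i, |z i + δ * u i| ≤ 1) ∧
      (∃ i, |z i| < 1 ∧ |z i + δ * u i| = 1) ∧
      ∑ k, (c k * exp (δ * s k)) * (K k * signMGF (z p + δ) (s k)) ≤
        ∑ k, c k * walkPotential v z p (w k) := by
    rcases le_total (∑ k, c k * (K k * (exp (-(z p * s k)) * sinh (s k)))) 0 with h | h
    · obtain ⟨δ, h1, h2, h3⟩ := exists_step_to_boundary hz hu0 (p := p) (by simp [hup])
      exact ⟨δ, h2, h3, by rw [haff]; nlinarith⟩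
    · obtain ⟨δ, h1, h2, h3⟩ := exists_step_to_boundary (u := -u) hz
        (fun i hi => by simp [hu0 i hi]) (p := p) (by simp [hup])
      exact ⟨-δ, by simpa using h2, by simpa using h3, by rw [haff]; nlinarith⟩
  set z' : ι → ℝ := fun i => z i + δ * u i with hz'
  have hz'p : z' p = z p + δ := by simp [hz', hup]
  have hfix : ∀ i, |z i| = 1 → z' i = z i := fun i hi => by simp [hz', hu0 i hi]
  have hsub : ∀ i, |z' i| < 1 → |z i| < 1 := fun i hi =>
    lt_of_le_of_ne (hz i) fun h => by rw [hfix i h] at hi; exact hi.ne h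
  have hcard : (Finset.univ.filter fun i => |z' i| < 1).card < n := by
    rw [← hn]
    apply Finset.card_lt_card
    refine ⟨fun i => by simpa using hsub i, fun h => ?_⟩
    have := h (show i₀ ∈ _ by simpa using hi₀)
    simp only [Finset.mem_filter, Finset.mem_univ, true_and] at this
    exact this.ne hi₀'
  have hc' : ∀ k, 0 ≤ c k * exp (δ * s k) := fun k => mul_nonneg (hc k) (exp_pos _).le
  have hsum : ∀ (y : ι → ℝ) k, c k * exp (δ * s k) * exp ⟪w k, ∑ i, (y i - z' i) • v i⟫_ℝ =
      c k * exp ⟪w k, ∑ i, (y i - z i) • v i⟫_ℝ := by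
    intro y k
    have : ∑ i, (y i - z i) • v i = δ • r + ∑ i, (y i - z' i) • v i := by
      rw [← huv, Finset.smul_sum, ← Finset.sum_add_distrib]
      refine Finset.sum_congr rfl fun i _ => ?_
      rw [smul_smul, ← add_smul]
      congr 1; simp only [hz']; ring
    rw [this, inner_add_right, inner_smul_right, exp_add]
    ring
  -- It suffices to treat the walk from the new position.
  suffices h : ∃ y : ι → ℝ, (∀ i, |y i| = 1) ∧ (∀ i, |z' i| = 1 → y i = z' i) ∧
      ∑ k, c k * exp (δ * s k) * exp ⟪w k, ∑ i, (y i - z' i) • v i⟫_ℝ ≤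
        ∑ k, c k * exp (δ * s k) * (K k * signMGF (z' p) (s k)) by
    obtain ⟨y, h1, h2, h3⟩ := h
    refine ⟨y, h1, fun i hi => ?_, ?_⟩
    · rw [← hfix i hi]; exact h2 i (by rw [hfix i hi, hi])
    · simp only [hsum] at h3
      rw [hz'p] at h3
      exact h3.trans hδ
  by_cases hp' : |z' p| < 1
  · obtain ⟨y, h1, h2, h3⟩ := ih _ hcard z' p _ hδ1 hp' hc' rfl
    refine ⟨y, h1, h2, h3.trans ?_⟩
    gcongr with k
    · exact hc' k
    · refine (walkPotential_mono hv (hδ1 p) hsub (w k)).trans (le_of_eq ?_)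
      simp only [hK, hs, hr, hW]; ring
  · have hKone : ∀ k, exp (‖W.starProjection (w k)‖ ^ 2 / 2) ≤ K k * signMGF (z' p) (s k) := by
      intro k
      have h1 := one_le_signMGF (hδ1 p) (s k)
      have h2 : 1 ≤ exp (4 * s k ^ 2 * (1 / 16 - ‖r‖ ^ 2)) := by
        apply one_le_exp
        have := norm_sub_starProjection_sq_le (hv p) W
        have : 0 ≤ 1 / 16 - ‖r‖ ^ 2 := by linarith
        positivity
      simp only [hK]
      rw [mul_assoc]
      exact le_mul_of_one_le_right (exp_pos _).le (one_le_mul_of_one_le_of_one_le h2 h1)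
    by_cases hex : ∃ q, |z' q| < 1
    · obtain ⟨q, hq⟩ := hex
      obtain ⟨y, h1, h2, h3⟩ := ih _ hcard z' q _ hδ1 hq hc' rfl
      refine ⟨y, h1, h2, h3.trans ?_⟩
      gcongr with k
      · exact hc' k
      · refine (walkPotential_le hv hq (w k)).trans (le_trans ?_ (hKone k))
        have hle : Submodule.span ℝ (v '' {i | |z' i| < 1}) ≤ W :=
          Submodule.span_mono (Set.image_mono fun i hi =>
            ⟨hsub i hi, by rintro rfl; exact hp' hi⟩)
        have := (starProjection_nested hle 0 (w k)).2.1
        gcongr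
    · push Not at hex
      have h1 : ∀ i, |z' i| = 1 := fun i => le_antisymm (hδ1 i) (hex i)
      refine ⟨z', h1, fun _ _ => rfl, ?_⟩
      gcongr with k
      · exact hc' k
      · refine le_trans ?_ (hKone k)
        simp only [sub_self, zero_smul, Finset.sum_const_zero, inner_zero_right]
        gcongr
        positivity

lemma exists_signs_sum_exp_le {ι κ : Type*} [Fintype ι] [Fintype κ] {v : ι → E}
    (hv : ∀ i, ‖v i‖ ^ 2 ≤ 1 / 16) (w : κ → E) (z : ι → ℝ) (hz : ∀ i, |z i| ≤ 1) :
    ∃ y : ι → ℝ, (∀ i, |y i| = 1) ∧ (∀ i, |z i| = 1 → y i = z i) ∧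
      ∑ k, exp ⟪w k, ∑ i, (y i - z i) • v i⟫_ℝ ≤ ∑ k, exp (‖w k‖ ^ 2 / 2) := by
  by_cases h : ∃ p, |z p| < 1
  · obtain ⟨p, hp⟩ := h
    obtain ⟨y, h1, h2, h3⟩ := exists_signs_sum_exp_le_walkPotential hv w _ z p 1 hz hp
      (fun _ => zero_le_one) rfl
    simp only [Pi.one_apply, one_mul] at h3
    refine ⟨y, h1, h2, h3.trans ?_⟩
    gcongr with k
    refine (walkPotential_le hv hp (w k)).trans ?_
    gcongr
    exact Submodule.norm_starProjection_apply_le _ _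
  · push Not at h
    refine ⟨z, fun i => le_antisymm (hz i) (h i), fun _ _ => rfl, ?_⟩
    gcongr with k
    simp only [sub_self, zero_smul, Finset.sum_const_zero, inner_zero_right]
    positivity

/-- Rounding with small error: if the columns of the matrix `A` have squared norm at most `R²`,
then a fractional vector can be rounded to a `0`-`1` vector, keeping its integral coordinates,
so that every row changes by at most `2 R √(2 log (2 m))`, with `m` the number of rows. -/
theorem exists_rounding {ι β : Type*} [Fintype ι] [Fintype β] [Nonempty β] (A : β → ι → ℝ)
    {R : ℝ} (hR : 0 < R) (hA : ∀ i, ∑ b, A b i ^ 2 ≤ R ^ 2) (x : ι → ℝ)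
    (hx : ∀ i, x i ∈ Set.Icc (0 : ℝ) 1) :
    ∃ y : ι → ℝ, (∀ i, y i = 0 ∨ y i = 1) ∧ (∀ i, x i = 0 → y i = 0) ∧
      ∀ b, |∑ i, (y i - x i) * A b i| ≤ 2 * R * √(2 * log (2 * Fintype.card β)) := by
  classical
  set v : ι → EuclideanSpace ℝ β := fun i => WithLp.toLp 2 fun b => A b i / (4 * R) with hv
  set L := √(2 * log (2 * Fintype.card β)) with hL
  have hcard : (1 : ℝ) ≤ Fintype.card β := by exact_mod_cast Fintype.card_pos
  have hlog : 0 < log (2 * Fintype.card β) := log_pos (by linarith)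
  have hL2 : L ^ 2 = 2 * log (2 * Fintype.card β) := sq_sqrt (by positivity)
  have hLpos : 0 < L := sqrt_pos.2 (by positivity)
  have hvn : ∀ i, ‖v i‖ ^ 2 ≤ 1 / 16 := fun i => by
    rw [EuclideanSpace.real_norm_sq_eq]
    simp only [hv, div_pow]
    rw [← Finset.sum_div, div_le_iff₀ (by positivity)]
    nlinarith [hA i]
  obtain ⟨y, h1, h2, h3⟩ := exists_signs_sum_exp_le hvn
    (fun k : β × Bool => EuclideanSpace.single k.1 (if k.2 then L else -L))
    (fun i => 2 * x i - 1) (fun i => by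
      obtain ⟨h, h'⟩ := hx i
      rw [abs_le]; constructor <;> linarith)
  have hsq : ∀ b : Bool, (if b then L else -L) ^ 2 = L ^ 2 := by
    intro b; cases b <;> simp
  have hrhs : ∑ k : β × Bool, exp (‖EuclideanSpace.single k.1 (if k.2 then L else -L)‖ ^ 2 / 2) =
      exp (L ^ 2) := by
    have : ∀ k : β × Bool, exp (‖EuclideanSpace.single k.1 (if k.2 then L else -L)‖ ^ 2 / 2) =
        exp (L ^ 2 / 2) := fun k => by
      rw [PiLp.norm_single, norm_eq_abs, sq_abs, hsq]
    rw [Finset.sum_congr rfl fun k _ => this k, Finset.sum_const, Finset.card_univ,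
      Fintype.card_prod, Fintype.card_bool, nsmul_eq_mul, hL2, mul_div_cancel_left₀ _ two_ne_zero,
      exp_log (by linarith)]
    push_cast
    rw [two_mul (log _), exp_add, exp_log (by linarith)]; ring
  rw [hrhs] at h3
  refine ⟨fun i => (1 + y i) / 2, fun i => ?_, fun i hi => ?_, fun b => ?_⟩
  · rcases eq_or_eq_neg_of_abs_eq (h1 i) with h | h <;> simp [h]
  · have := h2 i (by simp [hi])
    simp [this, hi]
  · have key : ∀ b' : Bool, (if b' then L else -L) *
        ((∑ i, ((1 + y i) / 2 - x i) * A b i) / (2 * R)) ≤ L ^ 2 := by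
      intro b'
      have h4 := (Finset.single_le_sum (fun k _ => (exp_pos _).le)
        (Finset.mem_univ (b, b'))).trans h3
      have h5 := exp_le_exp.1 h4
      rw [EuclideanSpace.inner_single_left] at h5
      convert h5 using 1
      simp only [hv, conj_trivial, WithLp.ofLp_sum, WithLp.ofLp_smul, Finset.sum_apply,
        Pi.smul_apply, smul_eq_mul]
      congr 1
      rw [Finset.sum_div]
      refine Finset.sum_congr rfl fun i _ => ?_
      field_simp
      ring
    have k1 := key true
    have k2 := key false
    simp only [if_true, Bool.false_eq_true, if_false] at k1 k2
    set q := (∑ i, ((1 + y i) / 2 - x i) * A b i) / (2 * R) with hq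
    have hqs : ∑ i, ((1 + y i) / 2 - x i) * A b i = q * (2 * R) := by rw [hq]; field_simp
    have hqL : |q| ≤ L := abs_le.2 ⟨by nlinarith, by nlinarith⟩
    rw [hqs, abs_mul, abs_of_pos (by positivity : 0 < 2 * R)]
    nlinarith

end GramSchmidtWalk

section DyadicGrid

open Real

/-- Binary decomposition of the initial segment `[0, p)` into dyadic intervals. -/
lemma ite_lt_eq_sum_dyadic (n : ℕ) : ∀ c p : ℕ, p < 2 ^ n →
    (if c < p then 1 else 0 : ℝ) =
      ∑ l : Fin n, if p / 2 ^ (l : ℕ) % 2 = 1 ∧ c / 2 ^ (l : ℕ) + 1 = p / 2 ^ (l : ℕ)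
        then 1 else 0 := by
  induction n with
  | zero => intro c p hp; simp at hp; simp [hp]
  | succ n ih =>
    intro c p hp
    have h := ih (c / 2) (p / 2) (by rw [pow_succ] at hp; omega)
    simp only [Nat.div_div_eq_div_mul] at h
    rw [Fin.sum_univ_succ]
    simp only [Fin.val_zero, pow_zero, Nat.div_one, Fin.val_succ, pow_succ']
    rw [← h]
    split_ifs <;> first | omega | norm_num

/-- The indicator of the dyadic box `b` in the grid `{0, …, 2 ^ k - 1} ^ d`. -/
def dyadicBox {d k : ℕ} (b : (Fin d → Fin (k + 1)) × (Fin d → Fin (2 ^ k)))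
    (c : Fin d → Fin (2 ^ k)) : ℝ :=
  if ∀ i, (c i : ℕ) / 2 ^ (b.1 i : ℕ) = b.2 i then 1 else 0

lemma sum_dyadicBox_sq_le {d k : ℕ} (c : Fin d → Fin (2 ^ k)) :
    ∑ b, dyadicBox b c ^ 2 ≤ ((k : ℝ) + 1) ^ d := by
  have h : ∀ (l : Fin d → Fin (k + 1)) (j : Fin d → Fin (2 ^ k)), dyadicBox (l, j) c ^ 2 =
      if j = (fun i => (⟨(c i : ℕ) / 2 ^ (l i : ℕ),
        (Nat.div_le_self _ _).trans_lt (c i).2⟩ : Fin (2 ^ k))) then 1 else 0 := by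
    intro l j
    simp only [dyadicBox, ite_pow, one_pow, ne_eq, OfNat.ofNat_ne_zero, not_false_eq_true,
      zero_pow, funext_iff, Fin.ext_iff]
    congr 1
    simp only [eq_comm]
  rw [Fintype.sum_prod_type]
  simp [h]

/-- An initial box of the grid is a union of at most `(k + 1) ^ d` dyadic boxes. -/
lemma abs_sum_initial_box_le {d k : ℕ} {e : (Fin d → Fin (2 ^ k)) → ℝ} {Δ : ℝ}
    (he : ∀ b, |∑ c, e c * dyadicBox b c| ≤ Δ) {p : Fin d → ℕ} (hp : ∀ i, p i ≤ 2 ^ k) :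
    |∑ c, e c * (if ∀ i, (c i : ℕ) < p i then 1 else 0)| ≤ ((k : ℝ) + 1) ^ d * Δ := by
  have hΔ : 0 ≤ Δ := (abs_nonneg _).trans (he (0, fun _ => ⟨0, by positivity⟩))
  set g : (Fin d → Fin (k + 1)) → (Fin d → Fin (2 ^ k)) → ℝ := fun l c =>
    ∏ i, if p i / 2 ^ (l i : ℕ) % 2 = 1 ∧ (c i : ℕ) / 2 ^ (l i : ℕ) + 1 = p i / 2 ^ (l i : ℕ)
      then 1 else 0 with hg
  have hbox : ∀ c : Fin d → Fin (2 ^ k),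
      (if ∀ i, (c i : ℕ) < p i then 1 else 0 : ℝ) = ∑ l, g l c := by
    intro c
    have h1 : (if ∀ i, (c i : ℕ) < p i then 1 else 0 : ℝ) =
        ∏ i, if (c i : ℕ) < p i then 1 else 0 := by
      rw [Finset.prod_ite_zero]; simp
    rw [h1]
    have h2 : ∀ i, (if (c i : ℕ) < p i then 1 else 0 : ℝ) = _ := fun i =>
      ite_lt_eq_sum_dyadic (k + 1) (c i) (p i) ((hp i).trans_lt (by
        rw [pow_succ]; have := Nat.two_pow_pos k; omega))
    simp only [h2, hg]
    rw [Finset.prod_univ_sum]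
    simp
  have hl : ∀ l, |∑ c, e c * g l c| ≤ Δ := by
    intro l
    by_cases hodd : ∀ i, p i / 2 ^ (l i : ℕ) % 2 = 1
    · have hlt : ∀ i, p i / 2 ^ (l i : ℕ) - 1 < 2 ^ k := fun i => by
        have h1 := Nat.div_le_self (p i) (2 ^ (l i : ℕ))
        have h2 := hp i
        have h3 := hodd i
        generalize p i / 2 ^ (l i : ℕ) = m at *
        omega
      convert he (l, fun i => ⟨p i / 2 ^ (l i : ℕ) - 1, hlt i⟩) using 6 with c
      simp only [hg, dyadicBox]
      rw [Finset.prod_ite_zero]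
      simp only [Finset.mem_univ, true_implies, Finset.prod_const_one]
      congr 1
      apply propext
      refine forall_congr' fun i => ?_
      have h := hodd i
      simp only [h, true_and]
      generalize p i / 2 ^ (l i : ℕ) = m at *
      generalize (c i : ℕ) / 2 ^ (l i : ℕ) = m'
      omega
    · push Not at hodd
      obtain ⟨i, hi⟩ := hodd
      have : ∀ c, g l c = 0 := fun c =>
        Finset.prod_eq_zero (Finset.mem_univ i) (by simp [hi])
      simpa [this] using hΔ
  simp only [hbox, Finset.mul_sum]
  rw [Finset.sum_comm]
  refine (Finset.abs_sum_le_sum_abs _ _).trans ((Finset.sum_le_sum fun l _ => hl l).trans ?_)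
  simp

/-- The rounding error of the grid `{0, …, 2 ^ k - 1} ^ d` on initial boxes. -/
noncomputable def gridError (d k : ℕ) : ℝ :=
  ((k : ℝ) + 1) ^ d * (2 * √(((k : ℝ) + 1) ^ d) *
    √(2 * log (2 * (((k : ℝ) + 1) ^ d * (2 ^ k) ^ d))))

/-- Nonnegative weights on the grid can be rounded to natural numbers, keeping zeros, with small
error on all initial boxes. -/
lemma exists_grid_rounding (d k : ℕ) (w : (Fin d → Fin (2 ^ k)) → ℝ) (hw : ∀ c, 0 ≤ w c) :
    ∃ n : (Fin d → Fin (2 ^ k)) → ℕ, (∀ c, w c = 0 → n c = 0) ∧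
      ∀ p : Fin d → ℕ, (∀ i, p i ≤ 2 ^ k) →
        |∑ c, ((n c : ℝ) - w c) * (if ∀ i, (c i : ℕ) < p i then 1 else 0)| ≤
          gridError d k := by
  have : Nonempty ((Fin d → Fin (k + 1)) × (Fin d → Fin (2 ^ k))) :=
    ⟨(0, fun _ => ⟨0, by positivity⟩)⟩
  obtain ⟨y, h1, h2, h3⟩ := exists_rounding (dyadicBox (d := d) (k := k))
    (R := √(((k : ℝ) + 1) ^ d)) (by positivity)
    (fun c => by rw [sq_sqrt (by positivity)]; exact sum_dyadicBox_sq_le c)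
    (fun c => Int.fract (w c)) (fun c => ⟨Int.fract_nonneg _, (Int.fract_lt_one _).le⟩)
  have hy : ∀ c, (⌊y c⌋₊ : ℝ) = y c := fun c => by rcases h1 c with h | h <;> simp [h]
  refine ⟨fun c => ⌊w c⌋₊ + ⌊y c⌋₊, fun c hc => ?_, fun p hp => ?_⟩
  · have := h2 c (by simp [hc])
    simp [hc, this]
  · have hdiff : ∀ c, ((⌊w c⌋₊ + ⌊y c⌋₊ : ℕ) : ℝ) - w c = y c - Int.fract (w c) := fun c => by
      push_cast
      rw [hy, Int.fract, natCast_floor_eq_intCast_floor (hw c)]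
      ring
    simp only [hdiff]
    refine (abs_sum_initial_box_le h3 hp).trans (le_of_eq ?_)
    simp [gridError]

end DyadicGrid

section Quantile

/-- A monotone map to `{0, …, 2 Q}` that splits a probability measure on `ℝ` into points and
intervals of mass at most `1 / Q`. -/
noncomputable def quantileIndex (ν : Measure ℝ) (Q : ℕ) (x : ℝ) : ℕ :=
  ⌊Q * ν.real (Set.Iio x)⌋₊ + ⌊Q * ν.real (Set.Iic x)⌋₊

variable (ν : Measure ℝ) [IsProbabilityMeasure ν] (Q : ℕ)

lemma quantileIndex_mono : Monotone (quantileIndex ν Q) := by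
  intro x y h
  unfold quantileIndex
  gcongr <;> exact measure_ne_top _ _

lemma quantileIndex_le (x : ℝ) : quantileIndex ν Q x ≤ 2 * Q := by
  have h : ∀ s, ⌊Q * ν.real s⌋₊ ≤ Q := fun s => by
    apply Nat.floor_le_of_le
    exact mul_le_of_le_one_right (Nat.cast_nonneg _) measureReal_le_one
  unfold quantileIndex
  linarith [h (Set.Iio x), h (Set.Iic x)]

variable {Q}

lemma measureReal_Icc_le_of_quantileIndex_eq (hQ : 0 < Q) {x y : ℝ} (hxy : x < y)
    (h : quantileIndex ν Q x = quantileIndex ν Q y) : ν.real (Set.Icc x y) ≤ 1 / Q := by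
  have hQ' : (0 : ℝ) < Q := by exact_mod_cast hQ
  have m1 : ν.real (Set.Iio x) ≤ ν.real (Set.Iic x) := by
    apply measureReal_mono Set.Iio_subset_Iic_self
  have m2 : ν.real (Set.Iic x) ≤ ν.real (Set.Iio y) := by
    apply measureReal_mono (Set.Iic_subset_Iio.2 hxy)
  have m3 : ν.real (Set.Iio y) ≤ ν.real (Set.Iic y) := by
    apply measureReal_mono Set.Iio_subset_Iic_self
  have f1 : ⌊Q * ν.real (Set.Iio x)⌋₊ ≤ ⌊Q * ν.real (Set.Iic x)⌋₊ := by gcongr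
  have f2 : ⌊Q * ν.real (Set.Iic x)⌋₊ ≤ ⌊Q * ν.real (Set.Iio y)⌋₊ := by gcongr
  have f3 : ⌊Q * ν.real (Set.Iio y)⌋₊ ≤ ⌊Q * ν.real (Set.Iic y)⌋₊ := by gcongr
  unfold quantileIndex at h
  have heq : ⌊Q * ν.real (Set.Iio x)⌋₊ = ⌊Q * ν.real (Set.Iic y)⌋₊ := by omega
  have l1 := Nat.floor_le (by positivity : 0 ≤ Q * ν.real (Set.Iio x))
  have l2 := Nat.lt_floor_add_one (Q * ν.real (Set.Iic y))
  rw [← heq] at l2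
  have hI : ν.real (Set.Icc x y) = ν.real (Set.Iic y) - ν.real (Set.Iio x) := by
    rw [← measureReal_sdiff (Set.Iio_subset_Iic_iff.2 hxy.le) measurableSet_Iio]
    congr 1
    ext t
    simp
  rw [hI, le_div_iff₀ hQ']
  linarith

lemma measureReal_quantileIndex_fiber_le (hQ : 0 < Q) {a b : ℝ} (hab : a ≠ b)
    (h : quantileIndex ν Q a = quantileIndex ν Q b) :
    ν.real {x | quantileIndex ν Q x = quantileIndex ν Q a} ≤ 1 / Q := by
  set S := {x | quantileIndex ν Q x = quantileIndex ν Q a} with hS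
  have hSm : MeasurableSet S := (quantileIndex_mono ν Q).measurable (measurableSet_singleton _)
  have key : ν S ≤ ENNReal.ofReal (1 / Q) := by
    rw [hSm.measure_eq_iSup_isCompact]
    refine iSup₂_le fun K hK => iSup_le fun hKc => ?_
    have hIcc : ∀ x y, x ∈ S → y ∈ S → x < y → ν (Set.Icc x y) ≤ ENNReal.ofReal (1 / Q) := by
      intro x y hx hy hxy
      rw [← ofReal_measureReal]
      exact ENNReal.ofReal_le_ofReal
        (measureReal_Icc_le_of_quantileIndex_eq ν hQ hxy (hx.trans hy.symm))
    rcases K.eq_empty_or_nonempty with rfl | hne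
    · simp
    have hi := hK (hKc.sInf_mem hne)
    have hs := hK (hKc.sSup_mem hne)
    have hsub : K ⊆ Set.Icc (sInf K) (sSup K) := fun t ht =>
      ⟨csInf_le hKc.bddBelow ht, le_csSup hKc.bddAbove ht⟩
    rcases (hsub hne.some_mem).1.trans (hsub hne.some_mem).2 |>.lt_or_eq with hlt | heq
    · exact (measure_mono hsub).trans (hIcc _ _ hi hs hlt)
    · obtain ⟨t, ht, htne⟩ : ∃ t ∈ S, t ≠ sInf K := by
        by_cases hta : a = sInf K
        · exact ⟨b, h.symm, fun hb => hab (hta.trans hb.symm)⟩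
        · exact ⟨a, rfl, hta⟩
      rcases lt_or_gt_of_ne htne with h1 | h1
      · exact (measure_mono (hsub.trans (Set.Icc_subset_Icc h1.le heq.ge))).trans
          (hIcc _ _ ht hi h1)
      · refine (measure_mono (hsub.trans (Set.Icc_subset_Icc le_rfl ?_))).trans
          (hIcc _ _ hi ht h1)
        rw [← heq]; exact h1.le
  exact ENNReal.toReal_le_of_le_ofReal (by positivity) key

lemma exists_quantile_bracket (hQ : 0 < Q) (a : ℝ) :
    ∃ p q : ℕ, q ≤ 2 * Q + 1 ∧ (∀ x, quantileIndex ν Q x < p → x ≤ a) ∧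
      (∀ x, x ≤ a → quantileIndex ν Q x < q) ∧
      ν.real {x | p ≤ quantileIndex ν Q x ∧ quantileIndex ν Q x < q} ≤ 1 / Q := by
  have hm := quantileIndex_mono ν Q
  by_cases hb : ∃ b, a ≠ b ∧ quantileIndex ν Q a = quantileIndex ν Q b
  · obtain ⟨b, hab, h⟩ := hb
    refine ⟨quantileIndex ν Q a, quantileIndex ν Q a + 1, ?_, fun x hx => ?_, fun x hx => ?_, ?_⟩
    · linarith [quantileIndex_le ν Q a]
    · by_contra! hax
      exact hx.not_ge (hm hax.le)
    · exact Nat.lt_succ_of_le (hm hx)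
    · refine le_trans (le_of_eq ?_) (measureReal_quantileIndex_fiber_le ν hQ hab h)
      congr 1
      ext x
      simp only [Set.mem_ofPred_eq]
      omega
  · push Not at hb
    refine ⟨quantileIndex ν Q a + 1, quantileIndex ν Q a + 1, ?_, fun x hx => ?_,
      fun x hx => ?_, ?_⟩
    · linarith [quantileIndex_le ν Q a]
    · by_contra! hax
      exact hb x hax.ne (le_antisymm (hm hax.le) (Nat.lt_succ_iff.1 hx))
    · exact Nat.lt_succ_of_le (hm hx)
    · have : {x | quantileIndex ν Q a + 1 ≤ quantileIndex ν Q x ∧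
          quantileIndex ν Q x < quantileIndex ν Q a + 1} = ∅ := by
        ext x
        simp only [Set.mem_ofPred_eq, Set.mem_empty_iff_false, iff_false]
        omega
      rw [this]
      simp

end Quantile

section Discrepancy

open Real

/-- Prescribed multiplicities are realised by a finite sequence. -/
lemma exists_seq_sum_eq {C : Type*} [Fintype C] (n : C → ℕ) :
    ∃ M, M = ∑ c, n c ∧ ∃ g : Fin M → C, (∀ j, n (g j) ≠ 0) ∧
      ∀ F : C → ℝ, ∑ j, F (g j) = ∑ c, n c * F c := by
  let e : Fin (∑ c, n c) ≃ Σ c, Fin (n c) :=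
    (finCongr (by simp)).trans (Fintype.equivFin (Σ c, Fin (n c))).symm
  refine ⟨_, rfl, fun j => (e j).1, fun j h => ?_, fun F => ?_⟩
  · exact (h ▸ (e j).2).elim0
  · rw [e.sum_comp (fun s => F s.1), Fintype.sum_sigma]
    simp

lemma abs_sum_range_sub_sum_range_le {f : ℕ → ℝ} (hf : ∀ i, |f i| ≤ 1) (m n : ℕ) :
    |∑ i ∈ Finset.range m, f i - ∑ i ∈ Finset.range n, f i| ≤ |(m : ℝ) - n| := by
  wlog h : n ≤ m generalizing m n
  · rw [abs_sub_comm, abs_sub_comm (m : ℝ)]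
    exact this n m (by omega)
  rw [← Finset.sum_Ico_eq_sub _ h]
  refine (Finset.abs_sum_le_sum_abs _ _).trans ((Finset.sum_le_sum fun i _ => hf i).trans ?_)
  rw [abs_of_nonneg (by simpa using h)]
  simp [Nat.cast_sub h]

variable {d : ℕ} (μ : Measure (Fin d → ℝ)) [IsProbabilityMeasure μ]

/-- The quantile index of a point in each coordinate. -/
noncomputable def quantileCell (Q : ℕ) (x : Fin d → ℝ) (i : Fin d) : ℕ :=
  quantileIndex (μ.map fun y => y i) Q (x i)

lemma measurable_quantileCell (Q : ℕ) (i : Fin d) :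
    Measurable fun x => quantileCell μ Q x i :=
  have := Measure.isProbabilityMeasure_map (μ := μ) (measurable_pi_apply i).aemeasurable
  (quantileIndex_mono _ Q).measurable.comp (measurable_pi_apply i)

lemma quantileCell_le (Q : ℕ) (x : Fin d → ℝ) (i : Fin d) : quantileCell μ Q x i ≤ 2 * Q :=
  have := Measure.isProbabilityMeasure_map (μ := μ) (measurable_pi_apply i).aemeasurable
  quantileIndex_le _ Q _

lemma exists_box_bracket {Q : ℕ} (hQ : 0 < Q) (a : Fin d → ℝ) :
    ∃ p q : Fin d → ℕ, (∀ i, p i ≤ 2 * Q + 1) ∧ (∀ i, q i ≤ 2 * Q + 1) ∧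
      (∀ x, (∀ i, quantileCell μ Q x i < p i) → x ≤ a) ∧
      (∀ x, x ≤ a → ∀ i, quantileCell μ Q x i < q i) ∧
      μ.real {x | ∀ i, quantileCell μ Q x i < q i} ≤
        μ.real {x | ∀ i, quantileCell μ Q x i < p i} + d / Q := by
  have hprob : ∀ i, IsProbabilityMeasure (μ.map fun y : Fin d → ℝ => y i) := fun i =>
    Measure.isProbabilityMeasure_map (measurable_pi_apply i).aemeasurable
  choose p q hq h1 h2 h3 using fun i => exists_quantile_bracket (μ.map fun y => y i) hQ (a i)
  refine ⟨fun i => min (p i) (2 * Q + 1), q, fun i => min_le_right _ _, hq,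
    fun x hx i => h1 i _ ((hx i).trans_le (min_le_left _ _)), fun x hx i => h2 i _ (hx i), ?_⟩
  have hsub : {x | ∀ i, quantileCell μ Q x i < q i} ⊆
      {x | ∀ i, quantileCell μ Q x i < min (p i) (2 * Q + 1)} ∪
        ⋃ i, {x | p i ≤ quantileCell μ Q x i ∧ quantileCell μ Q x i < q i} := by
    intro x hx
    by_cases h : ∃ i, p i ≤ quantileCell μ Q x i
    · obtain ⟨i, hi⟩ := h
      exact Or.inr (Set.mem_iUnion.2 ⟨i, hi, hx i⟩)
    · push Not at h
      exact Or.inl fun i => lt_min (h i) (Nat.lt_succ_of_le (quantileCell_le μ Q x i))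
  refine (measureReal_mono hsub).trans ((measureReal_union_le _ _).trans ?_)
  gcongr
  refine (measureReal_iUnion_fintype_le _).trans ?_
  have : ∀ i, μ.real {x | p i ≤ quantileCell μ Q x i ∧ quantileCell μ Q x i < q i} ≤ 1 / Q := by
    intro i
    have hm : MeasurableSet {t | p i ≤ quantileIndex (μ.map fun y => y i) Q t ∧
        quantileIndex (μ.map fun y => y i) Q t < q i} :=
      (quantileIndex_mono _ Q).measurable (measurableSet_Ico (a := p i) (b := q i))
    have := h3 i
    rwa [map_measureReal_apply (measurable_pi_apply i) hm] at this
  refine (Finset.sum_le_sum fun i _ => this i).trans (le_of_eq ?_)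
  simp [div_eq_mul_inv]

/-- The general discrepancy bound, with the grid parameters free. -/
theorem exists_points_discrepancy_le (hμcube : μ (Set.Icc 0 1) = 1) (N : ℕ) {Q k : ℕ}
    (hQ : 0 < Q) (hk : 2 * Q + 1 ≤ 2 ^ k) :
    ∃ x : Fin N → (Fin d → ℝ), (∀ n, x n ∈ Set.Icc (0 : Fin d → ℝ) 1) ∧
      ∀ a : Fin d → ℝ,
        |∑ n, (Set.Icc (0 : Fin d → ℝ) a).indicator (fun _ => (1 : ℝ)) (x n) -
          N * μ.real (Set.Icc 0 a)| ≤ 2 * gridError d k + N * (d / Q) := by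
  classical
  set φ := quantileCell μ Q with hφ
  have hφlt : ∀ x i, φ x i < 2 ^ k := fun x i =>
    (quantileCell_le μ Q x i).trans_lt (by omega)
  have hae : ∀ᵐ x ∂μ, x ∈ Set.Icc (0 : Fin d → ℝ) 1 :=
    (prob_compl_eq_zero_iff measurableSet_Icc).2 hμcube
  set S : (Fin d → Fin (2 ^ k)) → Set (Fin d → ℝ) := fun c => {x | ∀ i, φ x i = c i} with hS
  have hSm : ∀ c, MeasurableSet (S c) := fun c => by
    simp only [hS, Set.ofPred_forall]
    exact MeasurableSet.iInter fun i =>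
      measurable_quantileCell μ Q i (measurableSet_singleton (c i : ℕ))
  set w : (Fin d → Fin (2 ^ k)) → ℝ := fun c => N * μ.real (S c) with hw
  obtain ⟨n, hn0, hn⟩ := exists_grid_rounding d k w fun c => by positivity
  have hrep : ∀ c, n c ≠ 0 → ∃ x ∈ Set.Icc (0 : Fin d → ℝ) 1, x ∈ S c := by
    intro c hc
    by_contra! h
    have : μ (S c) = 0 := measure_mono_null (fun x hx hx' => h x hx' hx) hae
    exact hc (hn0 c (by simp [hw, Measure.real, this]))
  choose! rep hrep1 hrep2 using hrep
  obtain ⟨M, hM, g, hg0, hg⟩ := exists_seq_sum_eq n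
  set f : ℕ → Fin d → ℝ := fun j => if h : j < M then rep (g ⟨j, h⟩) else 0 with hf
  -- The mass of an initial box of cells.
  have hbox : ∀ p : Fin d → ℕ, ∑ c, w c * (if ∀ i, (c i : ℕ) < p i then 1 else 0) =
      N * μ.real {x | ∀ i, φ x i < p i} := by
    intro p
    have hU : {x | ∀ i, φ x i < p i} =
        ⋃ c ∈ Finset.univ.filter fun c : Fin d → Fin (2 ^ k) => ∀ i, (c i : ℕ) < p i, S c := by
      ext x
      simp only [Set.mem_ofPred_eq, Finset.mem_filter, Finset.mem_univ, true_and, Set.mem_iUnion,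
        hS, exists_prop]
      constructor
      · exact fun h => ⟨fun i => ⟨φ x i, hφlt x i⟩, h, fun i => rfl⟩
      · rintro ⟨c, h1, h2⟩ i
        rw [h2 i]; exact h1 i
    rw [hU, measureReal_biUnion_finset _ fun c _ => hSm c]
    · simp only [hw, mul_ite, mul_one, mul_zero]
      rw [← Finset.sum_filter, Finset.mul_sum]
    · intro c _ c' _ hcc
      refine Set.disjoint_left.2 fun x hx hx' => hcc (funext fun i => Fin.ext ?_)
      exact (hx i).symm.trans (hx' i)
  have hdisc : ∀ p : Fin d → ℕ, (∀ i, p i ≤ 2 ^ k) →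
      |∑ c, n c * (if ∀ i, (c i : ℕ) < p i then (1 : ℝ) else 0) -
        N * μ.real {x | ∀ i, φ x i < p i}| ≤ gridError d k := by
    intro p hp
    rw [← hbox p, ← Finset.sum_sub_distrib]
    simpa only [sub_mul] using hn p hp
  have hMN : |(N : ℝ) - M| ≤ gridError d k := by
    have h := hdisc (fun _ => 2 ^ k) fun _ => le_rfl
    have h1 : {x | ∀ i, φ x i < 2 ^ k} = Set.univ := Set.eq_univ_of_forall fun x => hφlt x
    have h2 : ∀ c : Fin d → Fin (2 ^ k), ∀ i, (c i : ℕ) < 2 ^ k := fun c i => (c i).2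
    rw [abs_sub_comm, hM]
    simpa [h1, h2] using h
  refine ⟨fun j => f j, fun j => ?_, fun a => ?_⟩
  · simp only [hf]
    split_ifs with h
    · exact hrep1 _ (hg0 _)
    · exact ⟨le_rfl, zero_le_one⟩
  set G : (Fin d → ℝ) → ℝ := (Set.Icc (0 : Fin d → ℝ) a).indicator fun _ => 1 with hG
  have hG01 : ∀ x, |G x| ≤ 1 := fun x => by
    simp only [hG, Set.indicator_apply]
    split_ifs <;> simp
  have hsum : ∑ j ∈ Finset.range M, G (f j) = ∑ c, n c * G (rep c) := by
    rw [← hg fun c => G (rep c), Finset.sum_range]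
    refine Finset.sum_congr rfl fun j _ => ?_
    simp [hf]
  have hcut := abs_sum_range_sub_sum_range_le (fun j => hG01 (f j)) N M
  rw [hsum, Finset.sum_range] at hcut
  obtain ⟨p, q, hp, hq, hpa, hqa, hpq⟩ := exists_box_bracket μ hQ a
  have hlow : ∑ c, n c * (if ∀ i, (c i : ℕ) < p i then (1 : ℝ) else 0) ≤
      ∑ c, n c * G (rep c) := by
    refine Finset.sum_le_sum fun c _ => ?_
    by_cases hc : n c = 0
    · simp [hc]
    gcongr
    split_ifs with h
    · have : rep c ∈ Set.Icc 0 a :=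
        ⟨(hrep1 c hc).1, hpa _ fun i => by rw [← hφ, hrep2 c hc i]; exact h i⟩
      simp [hG, this]
    · exact Set.indicator_nonneg (fun _ _ => zero_le_one) _
  have hup : ∑ c, n c * G (rep c) ≤
      ∑ c, n c * (if ∀ i, (c i : ℕ) < q i then (1 : ℝ) else 0) := by
    refine Finset.sum_le_sum fun c _ => ?_
    by_cases hc : n c = 0
    · simp [hc]
    gcongr
    by_cases h : rep c ∈ Set.Icc 0 a
    · have : ∀ i, (c i : ℕ) < q i := fun i => by
        rw [← hrep2 c hc i]; exact hqa _ h.2 i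
      rw [if_pos this, hG, Set.indicator_of_mem h]
    · simp only [hG, Set.indicator_of_notMem h]
      split_ifs <;> norm_num
  have hμp : μ.real {x | ∀ i, φ x i < p i} ≤ μ.real (Set.Icc 0 a) :=
    ENNReal.toReal_mono (measure_ne_top _ _) (measure_mono_ae (by
      filter_upwards [hae] with x hx h using ⟨hx.1, hpa x h⟩))
  have hμq : μ.real (Set.Icc 0 a) ≤ μ.real {x | ∀ i, φ x i < q i} :=
    measureReal_mono fun x hx => hqa x hx.2
  have hN : (0 : ℝ) ≤ N := Nat.cast_nonneg N
  have dp := abs_le.1 (hdisc p fun i => (hp i).trans hk)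
  have dq := abs_le.1 (hdisc q fun i => (hq i).trans hk)
  have m1 := mul_le_mul_of_nonneg_left hμp hN
  have m2 := mul_le_mul_of_nonneg_left hμq hN
  have m3 := mul_le_mul_of_nonneg_left hpq hN
  rw [mul_add] at m3
  have hcut' := abs_le.1 (hcut.trans hMN)
  rw [abs_le]
  constructor <;> linarith

lemma gridError_le {d k : ℕ} (hd : 1 ≤ d) {L : ℝ} (hL : (k : ℝ) + 1 ≤ L) :
    gridError d k ≤ 4 * √d * L ^ ((3 * (d : ℝ) + 1) / 2) := by
  have hd' : (1 : ℝ) ≤ d := by exact_mod_cast hd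
  have hk0 : (0 : ℝ) ≤ k := Nat.cast_nonneg k
  have hL0 : 0 < L := by linarith
  have hpow : L ^ ((3 * (d : ℝ) + 1) / 2) = L ^ d * √(L ^ d) * √L := by
    rw [sqrt_eq_rpow, sqrt_eq_rpow, ← rpow_natCast, ← rpow_mul hL0.le, ← rpow_add hL0,
      ← rpow_add hL0]
    congr 1; ring
  have hlog : 2 * log (2 * (((k : ℝ) + 1) ^ d * (2 ^ k) ^ d)) ≤ 2 ^ 2 * (d * L) := by
    have h2 : log 2 ≤ 1 := by linarith [log_two_lt_d9]
    have h20 : 0 ≤ log 2 := log_nonneg (by norm_num)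
    have hk2 : log ((k : ℝ) + 1) ≤ k * log 2 := by
      rw [← log_pow]
      apply log_le_log (by positivity)
      exact_mod_cast k.lt_two_pow_self
    rw [log_mul (by norm_num) (by positivity), log_mul (by positivity) (by positivity), log_pow,
      log_pow, log_pow]
    have h3 : (d : ℝ) * log ((k : ℝ) + 1) ≤ d * (k * log 2) := by gcongr
    have h4 : (d : ℝ) * (k * log 2) ≤ d * k := by
      gcongr; exact mul_le_of_le_one_right hk0 h2
    nlinarith
  have hsq : √(2 * log (2 * (((k : ℝ) + 1) ^ d * (2 ^ k) ^ d))) ≤ 2 * (√d * √L) := by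
    rw [← sqrt_mul (by positivity)]
    refine (sqrt_le_sqrt hlog).trans (le_of_eq ?_)
    rw [sqrt_mul (by norm_num), sqrt_sq (by norm_num)]
  rw [hpow]
  calc gridError d k ≤ L ^ d * (2 * √(L ^ d) * (2 * (√d * √L))) := by
        unfold gridError; gcongr
    _ = _ := by ring

end Discrepancy

/-- The Aistleitner–Dick bound: for every `d ≥ 1`, every `N ≥ 2` and every Borel
probability measure `μ` on `[0,1]^d` there exist points `x_1, …, x_N ∈ [0,1]^d` with
`D_N*(x_1, …, x_N; μ) ≤ 63 √d (2 + log₂ N)^((3d+1)/2) / N`. -/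
theorem aistleitner_dick_bound (d : ℕ) (hd : 1 ≤ d) (N : ℕ) (hN : 2 ≤ N)
    (μ : Measure (Fin d → ℝ)) (hμ : IsProbabilityMeasure μ)
    (hμcube : μ (Set.Icc 0 1) = 1) :
    ∃ x : Fin N → (Fin d → ℝ),
      (∀ n, x n ∈ Set.Icc (0 : Fin d → ℝ) 1) ∧
      ∀ a : Fin d → ℝ, a ∈ Set.Icc (0 : Fin d → ℝ) 1 →
        |(1 / N : ℝ) * ∑ n, (Set.Icc (0 : Fin d → ℝ) a).indicator
              (fun _ => (1 : ℝ)) (x n)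
            - (μ (Set.Icc 0 a)).toReal|
          ≤ 63 * Real.sqrt d * (2 + Real.logb 2 N) ^ ((3 * (d : ℝ) + 1) / 2) / N := by
  have hN0 : (0 : ℝ) < N := by positivity
  have hd' : (1 : ℝ) ≤ d := by exact_mod_cast hd
  have hsd : 1 ≤ √(d : ℝ) := Real.one_le_sqrt.2 hd'
  set L := 2 + Real.logb 2 N with hL
  have hlogb : ∀ k : ℕ, 2 ^ k ≤ N → (k : ℝ) ≤ Real.logb 2 N := fun k hk => by
    rw [Real.le_logb_iff_rpow_le (by norm_num) hN0, Real.rpow_natCast]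
    exact_mod_cast hk
  have hL2 : 2 ≤ L := by have := hlogb 0 (by omega); push_cast at this; linarith
  have hLpow : (1 : ℝ) ≤ L ^ ((3 * (d : ℝ) + 1) / 2) :=
    Real.one_le_rpow (by linarith) (by positivity)
  by_cases hN64 : N < 64
  · refine ⟨fun _ => 0, fun _ => ⟨le_rfl, zero_le_one⟩, fun a ha => ?_⟩
    have h1 : (μ (Set.Icc 0 a)).toReal ≤ 1 := measureReal_le_one
    have h2 : (0 : ℝ) ≤ (μ (Set.Icc 0 a)).toReal := ENNReal.toReal_nonneg
    have h3 : (0 : Fin d → ℝ) ∈ Set.Icc 0 a := ⟨le_rfl, ha.1⟩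
    have h4 : (N : ℝ) ≤ 63 := by exact_mod_cast Nat.lt_succ_iff.1 hN64
    simp only [Set.indicator_of_mem h3, Finset.sum_const, Finset.card_univ, Fintype.card_fin,
      nsmul_eq_mul, mul_one, one_div, inv_mul_cancel₀ hN0.ne']
    rw [abs_of_nonneg (by linarith), le_div_iff₀ hN0]
    nlinarith [one_le_mul_of_one_le_of_one_le hsd hLpow]
  · push Not at hN64
    obtain ⟨k, hk⟩ : ∃ k, Nat.log 2 N = k + 1 := Nat.exists_eq_succ_of_ne_zero (by
      have := Nat.log_pos (b := 2) (by norm_num) hN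
      omega)
    have hle : 2 ^ (k + 1) ≤ N := hk ▸ Nat.pow_log_le_self 2 (by omega)
    have hlt : N < 2 ^ (k + 2) := by
      have := Nat.lt_pow_succ_log_self (b := 2) (by norm_num) N
      rwa [hk] at this
    have hQN : N ≤ 5 * (2 ^ k - 1) := by rw [pow_succ, pow_succ] at hlt; omega
    have hQ : 0 < 2 ^ k - 1 := by omega
    obtain ⟨x, hx, hxa⟩ := exists_points_discrepancy_le μ hμcube N (k := k + 1) hQ
      (by rw [pow_succ]; omega)
    refine ⟨x, hx, fun a _ => ?_⟩
    have hE := gridError_le (k := k + 1) hd (L := L) (by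
      have := hlogb _ hle
      linarith)
    have hslab : (N : ℝ) * (d / (2 ^ k - 1 : ℕ)) ≤ 5 * d := by
      have h1 : (0 : ℝ) < (2 ^ k - 1 : ℕ) := by exact_mod_cast hQ
      have h2 : (N : ℝ) ≤ 5 * (2 ^ k - 1 : ℕ) := by exact_mod_cast hQN
      rw [mul_div_assoc', div_le_iff₀ h1]
      nlinarith
    have hdL : √(d : ℝ) ≤ L ^ ((3 * (d : ℝ) + 1) / 2) := by
      calc √(d : ℝ) ≤ d := Real.sqrt_le_iff.2 ⟨by linarith, by nlinarith⟩
        _ ≤ 2 ^ d := by exact_mod_cast d.lt_two_pow_self.le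
        _ ≤ L ^ d := by gcongr
        _ = L ^ (d : ℝ) := (Real.rpow_natCast _ _).symm
        _ ≤ _ := Real.rpow_le_rpow_of_exponent_le (by linarith) (by linarith)
    have hdd : (d : ℝ) ≤ √d * L ^ ((3 * (d : ℝ) + 1) / 2) := by
      calc (d : ℝ) = √d * √d := (Real.mul_self_sqrt (by linarith)).symm
        _ ≤ _ := by gcongr
    rw [le_div_iff₀ hN0, ← abs_of_pos hN0, ← abs_mul, abs_of_pos hN0, sub_mul, one_div,
      mul_right_comm, inv_mul_cancel₀ hN0.ne', one_mul, mul_comm _ (N : ℝ)]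
    have := hxa a
    rw [Measure.real] at this
    nlinarith
end

section
/- For every dimension d ≥ 1 there exists a constant c_d > 0 (depending only on d) such that for every Borel probability measure μ on [0,1]^d there exists an infinite sequence (x_n)_{n ≥ 1} of points in [0,1]^d such that for every integer N ≥ 2, the first N terms satisfy D_N*(x_1, ..., x_N; μ) ≤ c_d (log N)^{d + 1/2} / N. -/
open MeasureTheory

open Set ENNReal Pointwise in
/-- One-dimensional Brunn-Minkowski inequality for midpoints. -/
theorem volume_add_volume_le_of_midpoint {A B C : Set ℝ} (hA : MeasurableSet A)
    (hB : MeasurableSet B) (hA' : A.Nonempty) (hB' : B.Nonempty)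
    (h : ∀ x ∈ A, ∀ y ∈ B, (x + y) / 2 ∈ C) :
    volume A + volume B ≤ 2 * volume C := by
  have key : ∀ K ⊆ A, IsCompact K → K.Nonempty → ∀ L ⊆ B, IsCompact L → L.Nonempty →
      volume K + volume L ≤ 2 * volume C := by
    intro K hKA hK hKn L hLB hL hLn
    obtain ⟨M, hMK, hM⟩ := hK.exists_isGreatest hKn
    obtain ⟨m, hmL, hm⟩ := hL.exists_isLeast hLn
    have e1 : volume K = 2 * volume ((fun x => (2 : ℝ)⁻¹ * (x + m)) '' K) := by
      have : (fun x => (2 : ℝ)⁻¹ * (x + m)) '' K = (2 : ℝ)⁻¹ • ((fun x => x + m) '' K) := by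
        rw [← image_smul, image_image]; rfl
      rw [this, Measure.addHaar_smul, image_add_right, measure_preimage_add_right]
      rw [← mul_assoc]
      simp [abs_of_pos, ENNReal.ofReal_inv_of_pos]
      rw [ENNReal.mul_inv_cancel (by simp) (by simp), one_mul]
    have e2 : volume L = 2 * volume ((fun x => (2 : ℝ)⁻¹ * (x + M)) '' L) := by
      have : (fun x => (2 : ℝ)⁻¹ * (x + M)) '' L = (2 : ℝ)⁻¹ • ((fun x => x + M) '' L) := by
        rw [← image_smul, image_image]; rfl
      rw [this, Measure.addHaar_smul, image_add_right, measure_preimage_add_right]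
      rw [← mul_assoc]
      simp [abs_of_pos, ENNReal.ofReal_inv_of_pos]
      rw [ENNReal.mul_inv_cancel (by simp) (by simp), one_mul]
    have hL2 : MeasurableSet ((fun x => (2 : ℝ)⁻¹ * (x + M)) '' L) :=
      (hL.image (by fun_prop)).measurableSet
    rw [e1, e2, ← mul_add]
    gcongr
    rw [← measure_union₀ hL2.nullMeasurableSet]
    · refine measure_mono (union_subset ?_ ?_)
      · rintro _ ⟨x, hx, rfl⟩
        have := h x (hKA hx) m (hLB hmL)
        convert this using 1; ring
      · rintro _ ⟨x, hx, rfl⟩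
        have := h M (hKA hMK) x (hLB hx)
        convert this using 1; ring
    · refine measure_mono_null (t := {(2 : ℝ)⁻¹ * (M + m)}) ?_ (by simp)
      rintro z ⟨⟨x, hx, rfl⟩, ⟨y, hy, hxy⟩⟩
      have h1 := hM hx
      have h2 := hm hy
      simp only [mem_singleton_iff] at *
      linarith
  have hsup : ∀ S : Set ℝ, MeasurableSet S →
      volume S = ⨆ K, ⨆ (_ : K ⊆ S ∧ IsCompact K), volume K := by
    intro S hS
    rw [hS.measure_eq_iSup_isCompact]
    simp only [iSup_and]
  obtain ⟨a, ha⟩ := hA'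
  obtain ⟨b, hb⟩ := hB'
  rw [hsup A hA, hsup B hB]
  refine ENNReal.biSup_add_biSup_le' ⟨∅, by simp⟩ ⟨∅, by simp⟩ ?_
  rintro K ⟨hKA, hK⟩ L ⟨hLB, hL⟩
  refine le_trans (add_le_add (measure_mono (subset_union_left (t := {a})))
    (measure_mono (subset_union_left (t := {b})))) (key _ ?_ (hK.union isCompact_singleton)
    (by simp) _ ?_ (hL.union isCompact_singleton) (by simp))
  · exact union_subset hKA (by simpa using ha)
  · exact union_subset hLB (by simpa using hb)

open Set ENNReal in
/-- The Prékopa–Leindler inequality on the line for functions with supremum `1`. -/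
theorem lintegral_add_le_of_midpoint {f g h : ℝ → ℝ} (hf : Measurable f) (hg : Measurable g)
    (hh : Measurable h) (hf0 : ∀ x, 0 ≤ f x) (hg0 : ∀ x, 0 ≤ g x) (hh0 : ∀ x, 0 ≤ h x)
    (hf1 : ∀ x, f x ≤ 1) (hg1 : ∀ x, g x ≤ 1)
    (hfs : ∀ τ < 1, ∃ x, τ < f x) (hgs : ∀ τ < 1, ∃ x, τ < g x)
    (H : ∀ x y, f x * g y ≤ h ((x + y) / 2) ^ 2) :
    (∫⁻ x, ENNReal.ofReal (f x)) + ∫⁻ x, ENNReal.ofReal (g x)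
      ≤ 2 * ∫⁻ x, ENNReal.ofReal (h x) := by
  have layer : ∀ k : ℝ → ℝ, Measurable k → (∀ x, 0 ≤ k x) → (∀ x, k x ≤ 1) →
      ∫⁻ x, ENNReal.ofReal (k x) = ∫⁻ t in Ioo (0 : ℝ) 1, volume {a | t < k a} := by
    intro k hk hk0 hk1
    rw [lintegral_eq_lintegral_meas_lt volume (Filter.Eventually.of_forall hk0) hk.aemeasurable]
    rw [← lintegral_indicator measurableSet_Ioi, ← lintegral_indicator measurableSet_Ioo]
    refine lintegral_congr_ae ?_
    have : ∀ᵐ t : ℝ, t ≠ 1 := by simp [ae_iff]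
    filter_upwards [this] with t ht
    by_cases h1 : t < 1
    · simp [indicator, h1]
    · have : {a | t < k a} = ∅ := by
        ext a; simpa using (hk1 a).trans (not_lt.1 h1)
      simp [indicator, this]
  rw [layer f hf hf0 hf1, layer g hg hg0 hg1,
    lintegral_eq_lintegral_meas_lt volume (Filter.Eventually.of_forall hh0) hh.aemeasurable,
    ← lintegral_add_left']
  · rw [← lintegral_const_mul']
    · refine (setLIntegral_mono_ae' measurableSet_Ioo ?_).trans
        (lintegral_mono_set (t := Ioi 0) fun x hx => hx.1)
      refine Filter.Eventually.of_forall fun t ht => ?_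
      refine volume_add_volume_le_of_midpoint (measurableSet_lt measurable_const hf)
        (measurableSet_lt measurable_const hg) (hfs t ht.2) (hgs t ht.2) ?_
      intro x hx y hy
      simp only [mem_ofPred_eq] at *
      have h0 := H x y
      by_contra! hcon
      have : h ((x + y) / 2) ^ 2 ≤ t ^ 2 := by gcongr; exact hh0 _
      have : t * t < f x * g y := mul_lt_mul'' hx hy ht.1.le ht.1.le
      nlinarith
    · simp
  · refine Antitone.measurable ?_ |>.aemeasurable
    intro a b hab
    exact measure_mono fun x hx => lt_of_le_of_lt hab hx

open Set ENNReal in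
/-- The Prékopa–Leindler inequality on the line (midpoint version, for bounded functions). -/
theorem lintegral_mul_le_sq_of_midpoint {f g h : ℝ → ℝ} (hf : Measurable f) (hg : Measurable g)
    (hh : Measurable h) (hf0 : ∀ x, 0 ≤ f x) (hg0 : ∀ x, 0 ≤ g x) (hh0 : ∀ x, 0 ≤ h x)
    (hfb : BddAbove (range f)) (hgb : BddAbove (range g))
    (H : ∀ x y, f x * g y ≤ h ((x + y) / 2) ^ 2) :
    (∫⁻ x, ENNReal.ofReal (f x)) * ∫⁻ x, ENNReal.ofReal (g x)
      ≤ (∫⁻ x, ENNReal.ofReal (h x)) ^ 2 := by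
  set a := ⨆ x, f x with ha
  set b := ⨆ x, g x with hb
  have hfa : ∀ x, f x ≤ a := fun x => le_ciSup hfb x
  have hgb' : ∀ x, g x ≤ b := fun x => le_ciSup hgb x
  have ha0 : 0 ≤ a := (hf0 0).trans (hfa 0)
  have hb0 : 0 ≤ b := (hg0 0).trans (hgb' 0)
  rcases ha0.eq_or_lt with h0 | ha0
  · have : ∀ x, f x = 0 := fun x => le_antisymm (h0 ▸ hfa x) (hf0 x)
    simp [this]
  rcases hb0.eq_or_lt with h0 | hb0
  · have : ∀ x, g x = 0 := fun x => le_antisymm (h0 ▸ hgb' x) (hg0 x)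
    simp [this]
  have hsab : 0 < √(a * b) := Real.sqrt_pos.2 (by positivity)
  have hsq : √(a * b) ^ 2 = a * b := Real.sq_sqrt (by positivity)
  have key := lintegral_add_le_of_midpoint (f := fun x => f x / a) (g := fun x => g x / b)
    (h := fun x => h x / √(a * b)) (by fun_prop) (by fun_prop) (by fun_prop)
    (fun x => div_nonneg (hf0 x) ha0.le) (fun x => div_nonneg (hg0 x) hb0.le)
    (fun x => div_nonneg (hh0 x) hsab.le)
    (fun x => (div_le_one ha0).2 (hfa x)) (fun x => (div_le_one hb0).2 (hgb' x))
    (fun τ hτ => by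
      obtain ⟨x, hx⟩ := exists_lt_of_lt_ciSup (show τ * a < ⨆ x, f x by rw [← ha]; nlinarith)
      exact ⟨x, (lt_div_iff₀ ha0).2 hx⟩)
    (fun τ hτ => by
      obtain ⟨x, hx⟩ := exists_lt_of_lt_ciSup (show τ * b < ⨆ x, g x by rw [← hb]; nlinarith)
      exact ⟨x, (lt_div_iff₀ hb0).2 hx⟩)
    (fun x y => by
      rw [div_mul_div_comm, div_pow, hsq]
      gcongr
      exact H x y)
  have hdiv : ∀ (k : ℝ → ℝ) (c : ℝ), 0 < c → (∫⁻ x, ENNReal.ofReal (k x)) =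
      ENNReal.ofReal c * ∫⁻ x, ENNReal.ofReal (k x / c) := by
    intro k c hc
    rw [← lintegral_const_mul' _ _ ENNReal.ofReal_ne_top]
    refine lintegral_congr fun x => ?_
    rw [← ENNReal.ofReal_mul hc.le]
    congr 1; field_simp
  rw [hdiv f a ha0, hdiv g b hb0, hdiv h _ hsab, mul_pow, ← ENNReal.ofReal_pow hsab.le, hsq,
    ENNReal.ofReal_mul ha0.le, mul_mul_mul_comm]
  gcongr
  generalize (∫⁻ x, ENNReal.ofReal (f x / a)) = F at key
  generalize (∫⁻ x, ENNReal.ofReal (g x / b)) = G at key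
  generalize (∫⁻ x, ENNReal.ofReal (h x / √(a * b))) = I at key
  by_cases hI : I = ∞
  · simp [hI]
  have hFG : F + G ≠ ∞ := ne_top_of_le_ne_top (by finiteness) key
  lift I to NNReal using hI
  lift F to NNReal using (by aesop)
  lift G to NNReal using (by aesop)
  norm_cast at *
  have : ((F : ℝ) + G) ≤ 2 * I := by exact_mod_cast key
  have : (F : ℝ) * G ≤ I ^ 2 := by
    nlinarith [sq_nonneg ((F : ℝ) - G), F.2, G.2, I.2, NNReal.coe_nonneg F, NNReal.coe_nonneg G]
  exact_mod_cast this

/-- A measure satisfying the midpoint Prékopa–Leindler inequality for `[0, 1]`-valued functions. -/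
def MidpointLogConcave {X : Type*} [MeasurableSpace X] [AddCommGroup X] [Module ℝ X]
    (μ : Measure X) : Prop :=
  ∀ f g h : X → ENNReal, Measurable f → Measurable g → Measurable h →
    (∀ x, f x ≤ 1) → (∀ x, g x ≤ 1) → (∀ x, h x ≤ 1) →
    (∀ x y, f x * g y ≤ h (midpoint ℝ x y) ^ 2) →
    (∫⁻ x, f x ∂μ) * (∫⁻ x, g x ∂μ) ≤ (∫⁻ x, h x ∂μ) ^ 2

namespace MidpointLogConcave

variable {X Y : Type*} [MeasurableSpace X] [AddCommGroup X] [Module ℝ X]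
  [MeasurableSpace Y] [AddCommGroup Y] [Module ℝ Y]

theorem measure_mul_le {μ : Measure X} (hμ : MidpointLogConcave μ) {A B C : Set X}
    (hA : MeasurableSet A) (hB : MeasurableSet B) (hC : MeasurableSet C)
    (h : ∀ x ∈ A, ∀ y ∈ B, midpoint ℝ x y ∈ C) : μ A * μ B ≤ μ C ^ 2 := by
  have ind1 : ∀ (S : Set X) x, S.indicator (1 : X → ENNReal) x ≤ 1 := fun S x =>
    Set.indicator_le_self' (by simp) x
  have := hμ (A.indicator 1) (B.indicator 1) (C.indicator 1) (measurable_one.indicator hA)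
    (measurable_one.indicator hB) (measurable_one.indicator hC) (ind1 A) (ind1 B) (ind1 C) ?_
  · simpa [lintegral_indicator_one, hA, hB, hC] using this
  · intro x y
    by_cases hx : x ∈ A
    · by_cases hy : y ∈ B
      · simp [hx, hy, h x hx y hy]
      · simp [hy]
    · simp [hx]

theorem map {μ : Measure X} (hμ : MidpointLogConcave μ) (e : X → Y) (he : Measurable e)
    (hm : ∀ x y, e (midpoint ℝ x y) = midpoint ℝ (e x) (e y)) :
    MidpointLogConcave (μ.map e) := by
  intro f g h hf hg hh hf1 hg1 hh1 H
  rw [lintegral_map hf he, lintegral_map hg he, lintegral_map hh he]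
  refine hμ _ _ _ (hf.comp he) (hg.comp he) (hh.comp he) (fun _ => hf1 _) (fun _ => hg1 _)
    (fun _ => hh1 _) fun x y => ?_
  rw [hm]; exact H _ _

theorem prod {μ : Measure X} {ν : Measure Y} [IsProbabilityMeasure μ] [IsProbabilityMeasure ν]
    (hμ : MidpointLogConcave μ) (hν : MidpointLogConcave ν) :
    MidpointLogConcave (μ.prod ν) := by
  intro f g h hf hg hh hf1 hg1 hh1 H
  rw [lintegral_prod _ hf.aemeasurable, lintegral_prod _ hg.aemeasurable,
    lintegral_prod _ hh.aemeasurable]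
  have le1 : ∀ k : X × Y → ENNReal, (∀ p, k p ≤ 1) → ∀ x, ∫⁻ y, k (x, y) ∂ν ≤ 1 :=
    fun k hk x => (lintegral_mono fun y => hk (x, y)).trans (by simp)
  refine hμ _ _ _ hf.lintegral_prod_right' hg.lintegral_prod_right' hh.lintegral_prod_right'
    (le1 f hf1) (le1 g hg1) (le1 h hh1) fun x x' => ?_
  refine hν _ _ _ (by fun_prop) (by fun_prop) (by fun_prop) (fun _ => hf1 _) (fun _ => hg1 _)
    (fun _ => hh1 _) fun y y' => ?_
  have := H (x, y) (x', y')
  have e : midpoint ℝ (x, y) (x', y') = (midpoint ℝ x x', midpoint ℝ y y') := by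
    simp [midpoint_eq_smul_add]
  rwa [e] at this

open ProbabilityTheory in
theorem gaussianReal : MidpointLogConcave (gaussianReal 0 1) := by
  intro f g h hf hg hh hf1 hg1 hh1 H
  have tr : ∀ k : ℝ → ENNReal, Measurable k → (∀ x, k x ≤ 1) →
      ∫⁻ x, k x ∂(ProbabilityTheory.gaussianReal 0 1) =
        ∫⁻ x, ENNReal.ofReal (gaussianPDFReal 0 1 x * (k x).toReal) := by
    intro k hk hk1
    rw [gaussianReal_of_var_ne_zero _ (by simp),
      lintegral_withDensity_eq_lintegral_mul _ (measurable_gaussianPDF _ _) hk]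
    refine lintegral_congr fun x => ?_
    rw [ENNReal.ofReal_mul (gaussianPDFReal_nonneg _ _ _),
      ENNReal.ofReal_toReal (ne_top_of_le_ne_top (by simp) (hk1 x))]
    rfl
  rw [tr f hf hf1, tr g hg hg1, tr h hh hh1]
  have pdf_le : ∀ x, gaussianPDFReal 0 1 x ≤ (√(2 * Real.pi))⁻¹ := by
    intro x
    simp only [gaussianPDFReal]
    rw [NNReal.coe_one, mul_one]
    refine mul_le_of_le_one_right (by positivity) (Real.exp_le_one_iff.2 ?_)
    have := sq_nonneg (x - 0); linarith
  have toReal_le : ∀ k : ℝ → ENNReal, (∀ x, k x ≤ 1) → ∀ x, (k x).toReal ≤ 1 := fun k hk x =>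
    ENNReal.toReal_le_of_le_ofReal zero_le_one (by simpa using hk x)
  have bdd : ∀ k : ℝ → ENNReal, (∀ x, k x ≤ 1) →
      BddAbove (Set.range fun x => gaussianPDFReal 0 1 x * (k x).toReal) := by
    intro k hk
    refine ⟨(√(2 * Real.pi))⁻¹, ?_⟩
    rintro _ ⟨x, rfl⟩
    exact (mul_le_of_le_one_right (gaussianPDFReal_nonneg _ _ _) (toReal_le k hk x)).trans
      (pdf_le x)
  have nn : ∀ (k : ℝ → ENNReal) x, 0 ≤ gaussianPDFReal 0 1 x * (k x).toReal := fun k x =>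
    mul_nonneg (gaussianPDFReal_nonneg _ _ _) ENNReal.toReal_nonneg
  refine lintegral_mul_le_sq_of_midpoint ?_ ?_ ?_ (nn f) (nn g) (nn h) (bdd f hf1) (bdd g hg1) ?_
  · exact (measurable_gaussianPDFReal _ _).mul hf.ennreal_toReal
  · exact (measurable_gaussianPDFReal _ _).mul hg.ennreal_toReal
  · exact (measurable_gaussianPDFReal _ _).mul hh.ennreal_toReal
  intro x y
  have h1 : gaussianPDFReal 0 1 x * gaussianPDFReal 0 1 y
      ≤ gaussianPDFReal 0 1 ((x + y) / 2) ^ 2 := by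
    simp only [gaussianPDFReal]
    rw [mul_mul_mul_comm, ← Real.exp_add, mul_pow, ← Real.exp_nat_mul, ← sq]
    gcongr
    push_cast
    nlinarith [sq_nonneg (x - y)]
  have h2 : (f x).toReal * (g y).toReal ≤ (h ((x + y) / 2)).toReal ^ 2 := by
    have := H x y
    have e : midpoint ℝ x y = (x + y) / 2 := by
      rw [midpoint_eq_smul_add, smul_eq_mul]; simp; ring
    rw [e] at this
    rw [← ENNReal.toReal_mul, ← ENNReal.toReal_pow]
    refine ENNReal.toReal_mono ?_ this
    exact ENNReal.pow_ne_top (ne_top_of_le_ne_top (by simp) (hh1 _))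
  calc _ = gaussianPDFReal 0 1 x * gaussianPDFReal 0 1 y * ((f x).toReal * (g y).toReal) := by ring
    _ ≤ gaussianPDFReal 0 1 ((x + y) / 2) ^ 2 * (h ((x + y) / 2)).toReal ^ 2 := by
        gcongr
    _ = _ := by ring

open ProbabilityTheory in
theorem pi_gaussianReal (n : ℕ) :
    MidpointLogConcave (Measure.pi fun _ : Fin n => ProbabilityTheory.gaussianReal 0 1) := by
  induction n with
  | zero =>
    intro f g h _ _ _ _ _ _ H
    have e : midpoint ℝ (default : Fin 0 → ℝ) default = default := Subsingleton.elim _ _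
    have := H default default
    rw [e] at this
    simp only [lintegral_unique, measure_univ, mul_one]
    convert this
  | succ n ih =>
    have := (measurePreserving_piFinSuccAbove
      (fun _ : Fin (n + 1) => ProbabilityTheory.gaussianReal 0 1) 0).symm
    rw [← this.map_eq]
    refine (MidpointLogConcave.gaussianReal.prod ih).map _ (MeasurableEquiv.measurable _) ?_
    intro x y
    ext i
    refine Fin.cases ?_ (fun j => ?_) i <;>
    simp [midpoint_eq_smul_add, MeasurableEquiv.piFinSuccAbove, mul_add]

end MidpointLogConcave

section GaussianFibre

open Set ProbabilityTheory Filter Topology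

/-- The density of the standard Gaussian measure on the real line. -/
noncomputable def stdDensity (x : ℝ) : ℝ := (√(2 * Real.pi))⁻¹ * Real.exp (-x ^ 2 / 2)

theorem stdDensity_nonneg (x : ℝ) : 0 ≤ stdDensity x := by unfold stdDensity; positivity

theorem gaussianPDF_zero_one (x : ℝ) : gaussianPDF 0 1 x = ENNReal.ofReal (stdDensity x) := by
  simp [gaussianPDF, gaussianPDFReal, stdDensity]

theorem stdDensity_le_stdDensity {x y : ℝ} (h : |y| ≤ |x|) : stdDensity x ≤ stdDensity y := by
  unfold stdDensity
  have := sq_le_sq' (by linarith [abs_nonneg x, abs_nonneg y]) h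
  rw [sq_abs, sq_abs] at this
  gcongr

theorem stdDensity_zero_le : stdDensity 0 ≤ 2 / 5 := by
  have h : (5 / 2 : ℝ) ≤ √(2 * Real.pi) := by
    apply Real.le_sqrt_of_sq_le
    have := Real.pi_gt_d2
    norm_num at this ⊢; linarith
  have := inv_anti₀ (by norm_num) h
  simpa [stdDensity] using this

theorem stdDensity_zero_le_two_mul {x : ℝ} (h : |x| ≤ 1) : stdDensity 0 ≤ 2 * stdDensity x := by
  have h1 : stdDensity 1 ≤ stdDensity x := stdDensity_le_stdDensity (by simpa using h)
  have h2 : stdDensity 0 ≤ 2 * stdDensity 1 := by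
    unfold stdDensity
    have : (1 / 2 : ℝ) ≤ Real.exp (-1 ^ 2 / 2) := by
      have := Real.add_one_le_exp (-1 ^ 2 / 2 : ℝ)
      norm_num at this ⊢; linarith
    have hp : 0 ≤ (√(2 * Real.pi))⁻¹ := by positivity
    simp only [ne_eq, OfNat.ofNat_ne_zero, not_false_eq_true, zero_pow, neg_zero, zero_div,
      Real.exp_zero, mul_one]
    nlinarith
  linarith

theorem gaussianReal_Icc_le {a b m : ℝ} (h : ∀ x ∈ Icc a b, stdDensity x ≤ m) :
    gaussianReal 0 1 (Icc a b) ≤ ENNReal.ofReal (b - a) * ENNReal.ofReal m := by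
  rw [gaussianReal_apply _ (by simp)]
  calc _ ≤ ∫⁻ _ in Icc a b, ENNReal.ofReal m := by
        refine setLIntegral_mono measurable_const fun x hx => ?_
        rw [gaussianPDF_zero_one]
        exact ENNReal.ofReal_le_ofReal (h x hx)
    _ = _ := by rw [setLIntegral_const, Real.volume_Icc, mul_comm]

theorem le_gaussianReal_of_Ioo_subset {a b m : ℝ} {S : Set ℝ} (hS : Ioo a b ⊆ S)
    (h : ∀ x ∈ Ioo a b, m ≤ stdDensity x) :
    ENNReal.ofReal (b - a) * ENNReal.ofReal m ≤ gaussianReal 0 1 S := by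
  refine le_trans ?_ (measure_mono hS)
  rw [gaussianReal_apply _ (by simp)]
  calc _ = ∫⁻ _ in Ioo a b, ENNReal.ofReal m := by
        rw [setLIntegral_const, Real.volume_Ioo, mul_comm]
    _ ≤ _ := by
        refine setLIntegral_mono' measurableSet_Ioo fun x hx => ?_
        rw [gaussianPDF_zero_one]
        exact ENNReal.ofReal_le_ofReal (h x hx)

/-- The Rayleigh-type measure with density `s * stdDensity s` on the positive half line. -/
noncomputable def rayleigh : Measure ℝ :=
  (volume.restrict (Ioi 0)).withDensity fun s => ENNReal.ofReal (s * stdDensity s)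

theorem rayleigh_Ioi {c : ℝ} (hc : 0 ≤ c) : rayleigh (Ioi c) = ENNReal.ofReal (stdDensity c) := by
  have hderiv : ∀ x, HasDerivAt (fun x => - stdDensity x) (x * stdDensity x) x := by
    intro x
    have h1 : HasDerivAt (fun x : ℝ => -x ^ 2 / 2) (-x) x := by
      refine (((hasDerivAt_pow 2 x).neg).div_const 2).congr_deriv ?_
      simp; ring
    refine ((h1.exp).const_mul (√(2 * Real.pi))⁻¹).neg.congr_deriv ?_
    unfold stdDensity; ring
  have hlim : Tendsto (fun x => - stdDensity x) atTop (𝓝 0) := by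
    have h1 : Tendsto (fun x : ℝ => -x ^ 2 / 2) atTop atBot := by
      have : Tendsto (fun x : ℝ => x ^ 2 / 2) atTop atTop :=
        (tendsto_pow_atTop (by norm_num)).atTop_div_const (by norm_num)
      refine (tendsto_neg_atTop_atBot.comp this).congr fun x => ?_
      simp [neg_div]
    have := ((Real.tendsto_exp_atBot.comp h1).const_mul (√(2 * Real.pi))⁻¹).neg
    simpa [stdDensity, Function.comp_def] using this
  have hpos : ∀ x ∈ Ioi c, 0 ≤ x * stdDensity x := fun x hx =>
    mul_nonneg (hc.trans (le_of_lt hx)) (stdDensity_nonneg x)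
  have hint := integrableOn_Ioi_deriv_of_nonneg' (fun x _ => hderiv x) hpos hlim
  have hval := integral_Ioi_of_hasDerivAt_of_nonneg' (fun x _ => hderiv x) hpos hlim
  rw [rayleigh, withDensity_apply _ measurableSet_Ioi, Measure.restrict_restrict measurableSet_Ioi,
    inter_eq_left.2 (Ioi_subset_Ioi hc), ← ofReal_integral_eq_lintegral_ofReal hint
      ((ae_restrict_iff' measurableSet_Ioi).2 (ae_of_all _ hpos)), hval]
  simp

theorem rayleigh_Iic_zero : rayleigh (Iic 0) = 0 := by
  rw [rayleigh, withDensity_apply _ measurableSet_Iic, Measure.restrict_restrict measurableSet_Iic,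
    Iic_inter_Ioi, Ioc_self]
  simp

theorem rayleigh_le_of_subset {c : ℝ} (hc : 0 ≤ c) {S : Set ℝ} (h : ∀ s ∈ S, 0 < s → c ≤ s) :
    rayleigh S ≤ ENNReal.ofReal (stdDensity c) := by
  have h1 : S ⊆ Iic 0 ∪ (Ioi c ∪ {c}) := by
    intro s hs
    rcases le_or_gt s 0 with h0 | h0
    · exact Or.inl h0
    · rcases (h s hs h0).lt_or_eq with h2 | h2
      · exact Or.inr (Or.inl h2)
      · exact Or.inr (Or.inr h2.symm)
  have h3 : rayleigh {c} = 0 := by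
    have : rayleigh ≪ volume :=
      (withDensity_absolutelyContinuous _ _).trans Measure.restrict_le_self.absolutelyContinuous
    exact this (by simp)
  calc rayleigh S ≤ rayleigh (Iic 0) + (rayleigh (Ioi c) + rayleigh {c}) :=
        (measure_mono h1).trans ((measure_union_le _ _).trans
          (add_le_add_right (measure_union_le _ _) _))
    _ = _ := by rw [rayleigh_Iic_zero, h3, rayleigh_Ioi hc]; simp

instance : IsFiniteMeasure rayleigh := ⟨by
  refine lt_of_le_of_lt (rayleigh_le_of_subset le_rfl fun s _ h => h.le) (by simp)⟩

/-- Centres of the translates `[x - t, x + t] + c t`, `|c| ≤ 2`, whose endpoints lie in `I`. -/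
def lineStar (I : Set ℝ) (t : ℝ) : Set ℝ :=
  {x | ∃ c ∈ Icc (-2 : ℝ) 2, x + (c - 1) * t ∈ I ∧ x + (c + 1) * t ∈ I}

/-- The fibre `I` contains two points at distance `τ` lying in `[-1/2, s]`. -/
def HasChord (I : Set ℝ) (τ s : ℝ) : Prop := ∃ σ, -(1 / 2) ≤ σ ∧ σ + τ ≤ s ∧ σ ∈ I ∧ σ + τ ∈ I

theorem subset_lineStar {I : Set ℝ} (hI : OrdConnected I) {t σ : ℝ} (ht : 0 < t)
    (h1 : σ ∈ I) (h2 : σ + 2 * t ∈ I) : I ⊆ lineStar I t := by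
  intro x hx
  rcases le_total (σ + 2 * t) x with h | h
  · refine ⟨-1, by norm_num, ?_, ?_⟩
    · exact hI.out h1 hx ⟨by linarith, by linarith⟩
    · simpa using hx
  rcases le_total x σ with h' | h'
  · refine ⟨1, by norm_num, ?_, ?_⟩
    · simpa using hx
    · exact hI.out hx h2 ⟨by linarith, by linarith⟩
  · refine ⟨1 - (x - σ) / t, ⟨?_, ?_⟩, ?_, ?_⟩
    · have : (x - σ) / t ≤ 2 := by rw [div_le_iff₀ ht]; linarith
      linarith
    · have : 0 ≤ (x - σ) / t := div_nonneg (by linarith) ht.le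
      linarith
    · convert h1 using 1; field_simp; ring
    · convert h2 using 1; field_simp; ring

theorem gaussianReal_diff_lineStar_le {I : Set ℝ} (hI : OrdConnected I) (hIc : IsClosed I) {t : ℝ}
    (ht : 0 < t) :
    gaussianReal 0 1 {s | (s ∈ I ∧ s ∉ lineStar I t) ∧ 0 ≤ s} ≤
      ENNReal.ofReal (2 * t) * rayleigh {s | HasChord I 0 s ∧ ¬ HasChord I (2 * t) s} := by
  rcases ({s | (s ∈ I ∧ s ∉ lineStar I t) ∧ 0 ≤ s}).eq_empty_or_nonempty with he | ⟨x, ⟨hx, hx'⟩, hx0⟩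
  · rw [he]; simp
  have hno : ∀ σ ∈ I, σ + 2 * t ∉ I := fun σ h1 h2 => hx' (subset_lineStar hI ht h1 h2 hx)
  have hne : (I ∩ Ici 0).Nonempty := ⟨x, hx, hx0⟩
  have hbd : BddBelow (I ∩ Ici 0) := ⟨0, fun y hy => hy.2⟩
  set a := sInf (I ∩ Ici 0) with ha
  obtain ⟨haI, ha0 : 0 ≤ a⟩ : a ∈ I ∩ Ici 0 := (hIc.inter isClosed_Ici).csInf_mem hne hbd
  have h1 : {s | (s ∈ I ∧ s ∉ lineStar I t) ∧ 0 ≤ s} ⊆ Icc a (a + 2 * t) := by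
    rintro s ⟨⟨hs, -⟩, hs0⟩
    refine ⟨csInf_le hbd ⟨hs, hs0⟩, ?_⟩
    by_contra! h
    exact hno a haI (hI.out haI hs ⟨by linarith, h.le⟩)
  have h2 : Ioi a ⊆ {s | HasChord I 0 s ∧ ¬ HasChord I (2 * t) s} := by
    intro s (hs : a < s)
    refine ⟨⟨a, by linarith, by linarith, haI, by simpa using haI⟩, ?_⟩
    rintro ⟨σ, -, -, h3, h4⟩
    exact hno σ h3 h4
  calc _ ≤ gaussianReal 0 1 (Icc a (a + 2 * t)) := measure_mono h1
    _ ≤ ENNReal.ofReal (a + 2 * t - a) * ENNReal.ofReal (stdDensity a) := by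
        refine gaussianReal_Icc_le fun y hy => stdDensity_le_stdDensity ?_
        rw [abs_of_nonneg ha0, abs_of_nonneg (ha0.trans hy.1)]
        exact hy.1
    _ = ENNReal.ofReal (2 * t) * rayleigh (Ioi a) := by rw [rayleigh_Ioi ha0, add_sub_cancel_left]
    _ ≤ _ := by gcongr

theorem rayleigh_hasChord_le {I : Set ℝ} (hI : OrdConnected I) (hIc : IsClosed I) {t : ℝ}
    (ht : 0 < t) (ht' : t ≤ 1 / 136) :
    ENNReal.ofReal t * rayleigh {s | HasChord I (2 * t) s ∧ ¬ HasChord I (34 * t) s} ≤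
      2 * gaussianReal 0 1 (lineStar I t \ I) := by
  set D := {s | HasChord I (2 * t) s ∧ ¬ HasChord I (34 * t) s} with hD
  have key : ∀ p q m c : ℝ, q - p = t → 0 ≤ c → Ioo p q ⊆ lineStar I t \ I →
      (∀ x ∈ Ioo p q, m ≤ 2 * stdDensity x) → (∀ s ∈ D, 0 < s → c ≤ s) → stdDensity c ≤ m →
      ENNReal.ofReal t * rayleigh D ≤ 2 * gaussianReal 0 1 (lineStar I t \ I) := by
    intro p q m c hpq hc0 hsub hm hDc hcm
    calc _ ≤ ENNReal.ofReal t * ENNReal.ofReal (stdDensity c) := by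
          gcongr; exact rayleigh_le_of_subset hc0 hDc
      _ ≤ ENNReal.ofReal t * ENNReal.ofReal m := by gcongr
      _ = 2 * (ENNReal.ofReal (q - p) * ENNReal.ofReal (m / 2)) := by
          have h2 : (2 : ENNReal) = ENNReal.ofReal 2 := by simp
          rw [hpq, h2, mul_left_comm, ← ENNReal.ofReal_mul zero_le_two]
          congr 2; ring
      _ ≤ _ := by
          gcongr
          exact le_gaussianReal_of_Ioo_subset hsub fun x hx => by linarith [hm x hx]
  by_cases hne : ∃ s ∈ D, 0 < s
  swap
  · have : rayleigh D = 0 := by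
      refine measure_mono_null (fun s hs => ?_) rayleigh_Iic_zero
      by_contra h
      exact hne ⟨s, hs, not_le.1 h⟩
    rw [this]; simp
  obtain ⟨s₀, ⟨⟨σ, hσr, hσs, hσ, hσt⟩, hlong⟩, hs₀⟩ := hne
  by_cases hleft : ∃ x ∈ I, x < -(1 / 2)
  · obtain ⟨x, hx, hxr⟩ := hleft
    have hr : -(1 / 2) ∈ I := hI.out hx hσ ⟨hxr.le, hσr⟩
    have hout : -(1 / 2) + 34 * t ∉ I := fun h =>
      hlong ⟨-(1 / 2), le_rfl, by linarith, hr, h⟩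
    have hbd : ∀ y ∈ I, y ≤ -(1 / 2) + 34 * t := fun y hy => by
      by_contra! h
      exact hout (hI.out hr hy ⟨by linarith, h.le⟩)
    have hbdd : BddAbove I := ⟨_, hbd⟩
    set b := sSup I with hb
    have hbI : b ∈ I := hIc.csSup_mem ⟨x, hx⟩ hbdd
    have hb1 := hbd b hbI
    have hb2 : σ + 2 * t ≤ b := le_csSup hbdd hσt
    refine key b (b + t) (stdDensity 0) 0 (by ring) le_rfl ?_ ?_ (fun s _ h => h.le) le_rfl
    · intro y hy
      refine ⟨⟨-1 - (y - b) / t, ⟨?_, ?_⟩, ?_, ?_⟩, fun h => ?_⟩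
      · have : (y - b) / t ≤ 1 := by rw [div_le_iff₀ ht]; linarith [hy.2]
        linarith
      · have : 0 ≤ (y - b) / t := div_nonneg (by linarith [hy.1]) ht.le
        linarith
      · have : y + (-1 - (y - b) / t - 1) * t = b - 2 * t := by field_simp; ring
        rw [this]
        exact hI.out hσ hbI ⟨by linarith, by linarith⟩
      · have : y + (-1 - (y - b) / t + 1) * t = b := by field_simp; ring
        rwa [this]
      · exact absurd (le_csSup hbdd h) (not_le.2 hy.1)
    · intro y hy
      refine stdDensity_zero_le_two_mul (abs_le.2 ⟨by linarith [hy.1], by linarith [hy.2]⟩)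
  · push Not at hleft
    have hbdd : BddBelow I := ⟨_, hleft⟩
    set a := sInf I with ha
    have haI : a ∈ I := hIc.csInf_mem ⟨σ, hσ⟩ hbdd
    have ha1 := hleft a haI
    have ha2 : a ≤ σ := csInf_le hbdd hσ
    refine key (a - t) a (stdDensity (max 0 (a + 2 * t))) (max 0 (a + 2 * t)) (by ring)
      (le_max_left _ _) ?_ ?_ ?_ le_rfl
    · intro y hy
      refine ⟨⟨1 + (a - y) / t, ⟨?_, ?_⟩, ?_, ?_⟩, fun h => ?_⟩
      · have : 0 ≤ (a - y) / t := div_nonneg (by linarith [hy.2]) ht.le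
        linarith
      · have : (a - y) / t ≤ 1 := by rw [div_le_iff₀ ht]; linarith [hy.1]
        linarith
      · have : y + (1 + (a - y) / t - 1) * t = a := by field_simp; ring
        rwa [this]
      · have : y + (1 + (a - y) / t + 1) * t = a + 2 * t := by field_simp; ring
        rw [this]
        exact hI.out haI hσt ⟨by linarith, by linarith⟩
      · exact absurd (csInf_le hbdd h) (not_le.2 hy.2)
    · intro y hy
      by_cases hy1 : |y| ≤ 1
      · refine le_trans (stdDensity_le_stdDensity ?_) (stdDensity_zero_le_two_mul hy1)
        simp
      · have hy2 : 1 < y := by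
          rcases lt_abs.1 (not_le.1 hy1) with h | h
          · exact h
          · linarith [hy.1]
        have : stdDensity (max 0 (a + 2 * t)) ≤ stdDensity y := by
          refine stdDensity_le_stdDensity ?_
          rw [abs_of_pos (by linarith), abs_of_nonneg (le_max_left _ _)]
          exact le_max_of_le_right (by linarith [hy.2])
        linarith [stdDensity_nonneg y]
    · rintro s ⟨⟨σ', h1, h2, h3, h4⟩, -⟩ hs
      refine max_le hs.le ?_
      linarith [csInf_le hbdd h3]

theorem gaussianReal_Iic_zero : gaussianReal 0 1 (Iic 0) ≤ 1 / 2 := by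
  have hneg : gaussianReal 0 1 (Iic 0) = gaussianReal 0 1 (Ici 0) := by
    have := gaussianReal_map_neg (μ := 0) (v := 1)
    rw [neg_zero] at this
    conv_lhs => rw [← this]
    rw [Measure.map_apply (by fun_prop) measurableSet_Iic]
    congr 1; ext x; simp
  have h0 : gaussianReal 0 1 {(0 : ℝ)} = 0 :=
    (gaussianReal_absolutelyContinuous 0 (by simp)) (by simp)
  have hsum : gaussianReal 0 1 (Iic (0 : ℝ)) + gaussianReal 0 1 (Ioi (0 : ℝ)) = 1 := by
    rw [← measure_union (by simp [disjoint_left]) measurableSet_Ioi]; simp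
  have hle : gaussianReal 0 1 (Ici (0 : ℝ)) ≤ gaussianReal 0 1 (Ioi 0) := by
    rw [← Ioi_union_left]
    exact (measure_union_le _ _).trans (by rw [h0, add_zero])
  rw [ENNReal.le_div_iff_mul_le (by simp) (by simp), mul_two]
  calc _ ≤ gaussianReal 0 1 (Iic 0) + gaussianReal 0 1 (Ioi 0) := by
        rw [hneg] at *; exact add_le_add_right hle _
    _ = 1 := hsum

theorem gaussianReal_Iic_half : gaussianReal 0 1 (Iic (1 / 2)) ≤ ENNReal.ofReal (7 / 10) := by
  have h1 : Iic (1 / 2 : ℝ) = Iic 0 ∪ Icc 0 (1 / 2) := by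
    rw [Iic_union_Icc_eq_Iic (by norm_num)]
  rw [h1]
  calc _ ≤ _ := measure_union_le _ _
    _ ≤ 1 / 2 + ENNReal.ofReal (1 / 2 - 0) * ENNReal.ofReal (2 / 5) := by
        gcongr
        · exact gaussianReal_Iic_zero
        · exact gaussianReal_Icc_le fun x _ =>
            (stdDensity_le_stdDensity (by simp)).trans stdDensity_zero_le
    _ = ENNReal.ofReal (1 / 2) + ENNReal.ofReal (1 / 2 - 0) * ENNReal.ofReal (2 / 5) := by
        rw [ENNReal.ofReal_div_of_pos (by norm_num)]; simp
    _ = _ := by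
        rw [← ENNReal.ofReal_mul (by norm_num), ← ENNReal.ofReal_add (by norm_num) (by norm_num)]
        norm_num

theorem gaussianReal_neg_preimage (S : Set ℝ) (hS : MeasurableSet S) :
    gaussianReal 0 1 (Neg.neg ⁻¹' S) = gaussianReal 0 1 S := by
  have := gaussianReal_map_neg (μ := 0) (v := 1)
  rw [neg_zero] at this
  conv_rhs => rw [← this]
  rw [Measure.map_apply (by fun_prop) hS]

theorem gaussianReal_le_of_not_mem {I : Set ℝ} (hI : OrdConnected I)
    (h : ¬ (-(1 / 2) ∈ I ∧ (1 / 2) ∈ I)) :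
    gaussianReal 0 1 I ≤ ENNReal.ofReal (7 / 10) := by
  have hmirror : gaussianReal 0 1 (Ici (-(1 / 2))) ≤ ENNReal.ofReal (7 / 10) := by
    rw [← gaussianReal_neg_preimage _ measurableSet_Ici]
    refine le_trans (measure_mono fun x hx => ?_) gaussianReal_Iic_half
    simpa using hx
  have cases : ∀ p ∉ I, I ⊆ Iic p ∨ I ⊆ Ici p := by
    intro p hp
    by_contra! hc
    obtain ⟨x, hx, hx'⟩ := not_subset.1 hc.1
    obtain ⟨y, hy, hy'⟩ := not_subset.1 hc.2
    exact hp (hI.out hy hx ⟨(not_le.1 hy').le, (not_le.1 hx').le⟩)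
  rcases not_and_or.1 h with h | h
  · rcases cases _ h with h | h
    · exact (measure_mono (h.trans (Iic_subset_Iic.2 (by norm_num)))).trans gaussianReal_Iic_half
    · exact (measure_mono h).trans hmirror
  · rcases cases _ h with h | h
    · exact (measure_mono h).trans gaussianReal_Iic_half
    · exact (measure_mono (h.trans (Ici_subset_Ici.2 (by norm_num)))).trans hmirror

end GaussianFibre

section ProductStar

open Set ProbabilityTheory

theorem IsCompact.isClosed_exists {A X : Type*} [TopologicalSpace A] [TopologicalSpace X]
    {C : Set A} (hC : IsCompact C) {G : Set (A × X)} (hG : IsClosed G) :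
    IsClosed {x | ∃ c ∈ C, (c, x) ∈ G} := by
  have := isCompact_iff_compactSpace.1 hC
  have h := isClosedMap_snd_of_compactSpace (X := C) (Y := X) _
    (hG.preimage (f := fun p : C × X => ((p.1 : A), p.2)) (by fun_prop))
  convert h using 1
  ext x
  simp

theorem diff_le_of_logConcave_seq (p : ℕ → ℝ) (J : ℕ) (h0 : p 0 ≤ 1)
    (hhalf : ∀ j ≤ J + 1, 1 / 2 ≤ p j) (h01 : p 1 ≤ p 0)
    (hlog : ∀ j < J, p j * p (j + 2) ≤ p (j + 1) ^ 2) :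
    J * (p 0 - p 1) ≤ 2 * (p 1 - p (J + 1)) := by
  have h1 : ∀ j ≤ J, p (j + 1) * p 0 ≤ p 1 * p j := by
    intro j hj
    induction j with
    | zero => simp
    | succ j ih =>
      have ih := ih (by omega)
      have hl := hlog j (by omega)
      have hpj := hhalf j (by omega)
      have hpj1 := hhalf (j + 1) (by omega)
      have hp0 := hhalf 0 (by omega)
      have : p j * (p (j + 1 + 1) * p 0) ≤ p j * (p 1 * p (j + 1)) := by nlinarith
      exact le_of_mul_le_mul_left this (by linarith)
  have h2 : ∀ j ≤ J, (p 0 - p 1) / 2 ≤ p j - p (j + 1) := by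
    intro j hj
    have h3 := h1 j hj
    have hpj := hhalf j (by omega)
    have hp0 := hhalf 0 (by omega)
    by_contra! hc
    nlinarith [hhalf 1 (by omega)]
  have h3 : ∀ k ≤ J, k * ((p 0 - p 1) / 2) ≤ p 1 - p (k + 1) := by
    intro k hk
    induction k with
    | zero => simp
    | succ k ih =>
      have := ih (by omega)
      have := h2 (k + 1) hk
      push_cast; linarith
  linarith [h3 J le_rfl]

variable {F : Type*} [NormedAddCommGroup F]

/-- The points of a line `ℝ × {y}` that are star points of the corresponding fibre of `K`. -/
def prodStar (K : Set (ℝ × F)) (t : ℝ) : Set (ℝ × F) :=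
  {p | p.1 ∈ lineStar {s | (s, p.2) ∈ K} t}

/-- The pairs `(s, y)` for which the fibre of `K` over `y` has a chord of length `τ` in
`[-1/2, s]`. -/
def chordSet (K : Set (ℝ × F)) (τ : ℝ) : Set (ℝ × F) :=
  {p | HasChord {s | (s, p.2) ∈ K} τ p.1}

theorem isClosed_prodStar {K : Set (ℝ × F)} (hK : IsClosed K) (t : ℝ) :
    IsClosed (prodStar K t) := by
  refine (isCompact_Icc (a := (-2 : ℝ)) (b := 2)).isClosed_exists
    (G := {q : ℝ × (ℝ × F) | (q.2.1 + (q.1 - 1) * t, q.2.2) ∈ K ∧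
      (q.2.1 + (q.1 + 1) * t, q.2.2) ∈ K}) ?_
  exact (hK.preimage (by fun_prop)).inter (hK.preimage (by fun_prop))

theorem isClosed_fibre {K : Set (ℝ × F)} (hK : IsClosed K) (y : F) :
    IsClosed {s | (s, y) ∈ K} := hK.preimage (by fun_prop)

theorem ordConnected_fibre [NormedSpace ℝ F] {K : Set (ℝ × F)} (hK : Convex ℝ K) (y : F) :
    OrdConnected {s | (s, y) ∈ K} := by
  have : Convex ℝ {s | (s, y) ∈ K} := by
    intro a ha b hb p q hp hq hpq
    have := hK ha hb hp hq hpq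
    have e : p • (a, y) + q • (b, y) = (p • a + q • b, y) := by
      ext
      · simp
      · simp [← add_smul, hpq]
    rw [e] at this
    exact this
  exact this.ordConnected

variable [MeasurableSpace F] [BorelSpace F] [SecondCountableTopology F]

theorem measurableSet_chordSet {K : Set (ℝ × F)} (hK : IsClosed K) (τ : ℝ) :
    MeasurableSet (chordSet K τ) := by
  have : chordSet K τ = ⋃ S : ℕ, {p : ℝ × F | ∃ σ ∈ Icc (-(1 / 2) : ℝ) S,
      (σ, p) ∈ {q : ℝ × (ℝ × F) | q.1 + τ ≤ q.2.1 ∧ (q.1, q.2.2) ∈ K ∧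
        (q.1 + τ, q.2.2) ∈ K}} := by
    ext p
    simp only [chordSet, HasChord, mem_ofPred_eq, mem_iUnion]
    constructor
    · rintro ⟨σ, h1, h2⟩
      obtain ⟨S, hS⟩ := exists_nat_ge σ
      exact ⟨S, σ, ⟨h1, hS⟩, h2⟩
    · rintro ⟨S, σ, ⟨h1, -⟩, h2⟩
      exact ⟨σ, h1, h2⟩
  rw [this]
  have hG : IsClosed {q : ℝ × (ℝ × F) | q.1 + τ ≤ q.2.1 ∧ (q.1, q.2.2) ∈ K ∧
      (q.1 + τ, q.2.2) ∈ K} :=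
    (isClosed_le (f := fun q : ℝ × (ℝ × F) => q.1 + τ) (by fun_prop) (by fun_prop)).inter
      ((hK.preimage (f := fun q : ℝ × (ℝ × F) => (q.1, q.2.2)) (by fun_prop)).inter
        (hK.preimage (f := fun q : ℝ × (ℝ × F) => (q.1 + τ, q.2.2)) (by fun_prop)))
  exact MeasurableSet.iUnion fun S => (isCompact_Icc.isClosed_exists hG).measurableSet

variable [NormedSpace ℝ F]

theorem half_le_measure_of_prod {ν : Measure F} [IsProbabilityMeasure ν] {K : Set (ℝ × F)}
    (hK : Convex ℝ K) (hKc : IsClosed K)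
    (hK9 : ENNReal.ofReal (9 / 10) ≤ (gaussianReal 0 1).prod ν K) :
    1 / 2 ≤ ν.real {y | (-(1 / 2), y) ∈ K ∧ (1 / 2, y) ∈ K} := by
  set W : Set F := {y | (-(1 / 2), y) ∈ K ∧ (1 / 2, y) ∈ K} with hWdef
  have hW : MeasurableSet W :=
    ((hKc.preimage (by fun_prop)).inter (hKc.preimage (by fun_prop))).measurableSet
  rw [Measure.prod_apply_symm hKc.measurableSet] at hK9
  have h1 : ∀ y, gaussianReal 0 1 ((fun s => (s, y)) ⁻¹' K) ≤
      ENNReal.ofReal (7 / 10) + W.indicator (fun _ => ENNReal.ofReal (3 / 10)) y := by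
    intro y
    by_cases hy : y ∈ W
    · rw [indicator_of_mem hy, ← ENNReal.ofReal_add (by norm_num) (by norm_num)]
      exact prob_le_one.trans (by norm_num)
    · exact (gaussianReal_le_of_not_mem (ordConnected_fibre hK y) hy).trans le_self_add
  have h2 := hK9.trans (lintegral_mono h1)
  rw [lintegral_add_left measurable_const, lintegral_indicator_const hW, lintegral_const,
    measure_univ, mul_one, ← ofReal_measureReal, ← ENNReal.ofReal_mul (by norm_num),
    ← ENNReal.ofReal_add (by norm_num) (by positivity),
    ENNReal.ofReal_le_ofReal_iff (by positivity)] at h2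
  linarith

theorem measure_chord_diff_le {ν : Measure F} [IsProbabilityMeasure ν]
    (hν : MidpointLogConcave ν) {K : Set (ℝ × F)} (hK : Convex ℝ K) (hKc : IsClosed K)
    (hK9 : ENNReal.ofReal (9 / 10) ≤ (gaussianReal 0 1).prod ν K)
    {t s : ℝ} (ht : 0 < t) (ht' : t ≤ 1 / 136) (hs : 0 ≤ s) :
    8 * ν {y | (s, y) ∈ chordSet K 0 \ chordSet K (2 * t)} ≤
      ν {y | (s, y) ∈ chordSet K (2 * t) \ chordSet K (34 * t)} := by
  set Q : ℝ → Set F := fun τ => {y | (s, y) ∈ chordSet K τ} with hQ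
  have hQm : ∀ τ, MeasurableSet (Q τ) := fun τ =>
    measurable_prodMk_left (measurableSet_chordSet hKc τ)
  have hanti : ∀ τ τ', 0 ≤ τ → τ ≤ τ' → Q τ' ⊆ Q τ := by
    rintro τ τ' h0 h y ⟨σ, h1, h2, h3, h4⟩
    exact ⟨σ, h1, by linarith, h3,
      (ordConnected_fibre hK y).out h3 h4 ⟨by linarith, by linarith⟩⟩
  have hlog : ∀ τ τ', ν (Q τ) * ν (Q τ') ≤ ν (Q ((τ + τ') / 2)) ^ 2 := by
    intro τ τ'
    refine hν.measure_mul_le (hQm _) (hQm _) (hQm _) ?_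
    rintro y ⟨σ, h1, h2, h3, h4⟩ y' ⟨σ', h1', h2', h3', h4'⟩
    have hmid : ∀ a b : ℝ, (a, y) ∈ K → (b, y') ∈ K → ((a + b) / 2, midpoint ℝ y y') ∈ K := by
      intro a b ha hb
      have := hK.midpoint_mem ha hb
      have e : midpoint ℝ (a, y) (b, y') = ((a + b) / 2, midpoint ℝ y y') := by
        simp [midpoint_eq_smul_add]; ring
      rwa [e] at this
    refine ⟨(σ + σ') / 2, by linarith, by linarith, hmid _ _ h3 h3', ?_⟩
    have e : (σ + σ') / 2 + (τ + τ') / 2 = ((σ + τ) + (σ' + τ')) / 2 := by ring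
    rw [e]
    exact hmid _ _ h4 h4'
  have hlow : ∀ τ, 0 ≤ τ → τ ≤ 1 / 2 → 1 / 2 ≤ ν.real (Q τ) := by
    intro τ h0 h1
    refine (half_le_measure_of_prod hK hKc hK9).trans (measureReal_mono ?_)
    rintro y ⟨hy, hy'⟩
    exact ⟨-(1 / 2), le_rfl, by linarith, hy,
      (ordConnected_fibre hK y).out hy hy' ⟨by linarith, by linarith⟩⟩
  have hcast : ∀ j : ℕ, j ≤ 17 → (j : ℝ) ≤ 17 := fun j hj => by exact_mod_cast hj
  have key := diff_le_of_logConcave_seq (fun j => ν.real (Q (2 * t * j))) 16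
    measureReal_le_one
    (fun j hj => hlow _ (by positivity) (by nlinarith [hcast j hj]))
    (measureReal_mono (hanti _ _ (by simp) (by simp; positivity))) (fun j _ => ?_)
  · simp only [CharP.cast_eq_zero, mul_zero, Nat.cast_one, mul_one] at key
    have e : 2 * t * ((16 + 1 : ℕ) : ℝ) = 34 * t := by push_cast; ring
    rw [e] at key
    have e1 : {y | (s, y) ∈ chordSet K 0 \ chordSet K (2 * t)} = Q 0 \ Q (2 * t) := rfl
    have e2 : {y | (s, y) ∈ chordSet K (2 * t) \ chordSet K (34 * t)} = Q (2 * t) \ Q (34 * t) := rfl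
    have h8 : (8 : ENNReal) = ENNReal.ofReal 8 := by simp
    rw [e1, e2, ← ofReal_measureReal, ← ofReal_measureReal, h8,
      ← ENNReal.ofReal_mul (by norm_num), measureReal_sdiff (hanti _ _ le_rfl (by positivity)) (hQm _),
      measureReal_sdiff (hanti _ _ (by positivity) (by linarith)) (hQm _)]
    refine ENNReal.ofReal_le_ofReal ?_
    push_cast at key
    linarith
  · have := hlog (2 * t * j) (2 * t * (j + 2 : ℕ))
    have e : (2 * t * j + 2 * t * (j + 2 : ℕ)) / 2 = 2 * t * (j + 1 : ℕ) := by push_cast; ring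
    rw [e] at this
    simp only [Measure.real]
    rw [← ENNReal.toReal_mul, ← ENNReal.toReal_pow]
    exact ENNReal.toReal_mono (by simp) this

theorem measure_loss_nonneg_le {ν : Measure F} [IsProbabilityMeasure ν]
    (hν : MidpointLogConcave ν) {K : Set (ℝ × F)} (hK : Convex ℝ K) (hKc : IsClosed K)
    (hK9 : ENNReal.ofReal (9 / 10) ≤ (gaussianReal 0 1).prod ν K)
    {t : ℝ} (ht : 0 < t) (ht' : t ≤ 1 / 136) :
    2 * (gaussianReal 0 1).prod ν ((K \ prodStar K t) ∩ {p | 0 ≤ p.1}) ≤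
      (gaussianReal 0 1).prod ν (prodStar K t \ K) := by
  have hKm := hKc.measurableSet
  have hSm := (isClosed_prodStar hKc t).measurableSet
  have hpos : MeasurableSet {p : ℝ × F | 0 ≤ p.1} :=
    (isClosed_le continuous_const continuous_fst).measurableSet
  have hD1 := (measurableSet_chordSet hKc 0).diff (measurableSet_chordSet hKc (2 * t))
  have hD2 := (measurableSet_chordSet hKc (2 * t)).diff (measurableSet_chordSet hKc (34 * t))
  have h1 : (gaussianReal 0 1).prod ν ((K \ prodStar K t) ∩ {p | 0 ≤ p.1}) ≤
      ENNReal.ofReal (2 * t) * rayleigh.prod ν (chordSet K 0 \ chordSet K (2 * t)) := by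
    rw [Measure.prod_apply_symm ((hKm.diff hSm).inter hpos), Measure.prod_apply_symm hD1,
      ← lintegral_const_mul _ (measurable_measure_prodMk_right hD1)]
    exact lintegral_mono fun y =>
      gaussianReal_diff_lineStar_le (ordConnected_fibre hK y) (isClosed_fibre hKc y) ht
  have h2 : 8 * rayleigh.prod ν (chordSet K 0 \ chordSet K (2 * t)) ≤
      rayleigh.prod ν (chordSet K (2 * t) \ chordSet K (34 * t)) := by
    rw [Measure.prod_apply hD1, Measure.prod_apply hD2,
      ← lintegral_const_mul _ (measurable_measure_prodMk_left hD1)]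
    refine lintegral_mono_ae ?_
    have hae : ∀ᵐ s ∂rayleigh, 0 ≤ s := by
      refine measure_mono_null (fun s hs => ?_) rayleigh_Iic_zero
      exact le_of_lt (not_le.1 (show ¬ (0 : ℝ) ≤ s from hs))
    filter_upwards [hae] with s hs
    exact measure_chord_diff_le hν hK hKc hK9 ht ht' hs
  have h3 : ENNReal.ofReal t * rayleigh.prod ν (chordSet K (2 * t) \ chordSet K (34 * t)) ≤
      2 * (gaussianReal 0 1).prod ν (prodStar K t \ K) := by
    rw [Measure.prod_apply_symm (hSm.diff hKm), Measure.prod_apply_symm hD2,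
      ← lintegral_const_mul _ (measurable_measure_prodMk_right hD2),
      ← lintegral_const_mul _ (measurable_measure_prodMk_right (hSm.diff hKm))]
    exact lintegral_mono fun y =>
      rayleigh_hasChord_le (ordConnected_fibre hK y) (isClosed_fibre hKc y) ht ht'
  set L := (gaussianReal 0 1).prod ν ((K \ prodStar K t) ∩ {p | 0 ≤ p.1})
  set G := (gaussianReal 0 1).prod ν (prodStar K t \ K)
  set P := rayleigh.prod ν (chordSet K 0 \ chordSet K (2 * t))
  set R := rayleigh.prod ν (chordSet K (2 * t) \ chordSet K (34 * t))
  rw [ENNReal.ofReal_mul zero_le_two, ENNReal.ofReal_ofNat] at h1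
  have h4 : 2 * (2 * L) ≤ 2 * G := by
    calc 2 * (2 * L) ≤ 2 * (2 * (2 * ENNReal.ofReal t * P)) := by gcongr
      _ = ENNReal.ofReal t * (8 * P) := by ring
      _ ≤ ENNReal.ofReal t * R := by gcongr
      _ ≤ 2 * G := h3
  exact (ENNReal.mul_le_mul_iff_right (by simp) (by simp)).1 h4

/-- Replacing `K` by its star set along the Gaussian direction does not decrease the measure. -/
theorem prod_measure_le_prodStar {ν : Measure F} [IsProbabilityMeasure ν]
    (hν : MidpointLogConcave ν) {K : Set (ℝ × F)} (hK : Convex ℝ K) (hKc : IsClosed K)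
    (hK9 : ENNReal.ofReal (9 / 10) ≤ (gaussianReal 0 1).prod ν K)
    {t : ℝ} (ht : 0 < t) (ht' : t ≤ 1 / 136) :
    (gaussianReal 0 1).prod ν K ≤ (gaussianReal 0 1).prod ν (prodStar K t) := by
  set γ := (gaussianReal 0 1).prod ν with hγ
  have hSm := (isClosed_prodStar hKc t).measurableSet
  let e : ℝ × F →L[ℝ] ℝ × F := (-ContinuousLinearMap.fst ℝ ℝ F).prod (ContinuousLinearMap.snd ℝ ℝ F)
  have he : ∀ p, e p = (-p.1, p.2) := fun p => rfl
  have hinv : ∀ S, MeasurableSet S → γ (e ⁻¹' S) = γ S := by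
    intro S hS
    rw [hγ, Measure.prod_apply_symm hS, Measure.prod_apply_symm (e.continuous.measurable hS)]
    refine lintegral_congr fun y => ?_
    rw [← gaussianReal_neg_preimage _ (measurable_prodMk_right hS)]
    rfl
  have hstar : prodStar (e ⁻¹' K) t = e ⁻¹' prodStar K t := by
    ext ⟨s, y⟩
    constructor
    · rintro ⟨c, hc, (h1 : (-(s + (c - 1) * t), y) ∈ K), (h2 : (-(s + (c + 1) * t), y) ∈ K)⟩
      refine ⟨-c, ⟨by linarith [hc.2], by linarith [hc.1]⟩, (?_ : (-s + (-c - 1) * t, y) ∈ K),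
        (?_ : (-s + (-c + 1) * t, y) ∈ K)⟩
      · rwa [show -s + (-c - 1) * t = -(s + (c + 1) * t) by ring]
      · rwa [show -s + (-c + 1) * t = -(s + (c - 1) * t) by ring]
    · rintro ⟨c, hc, (h1 : (-s + (c - 1) * t, y) ∈ K), (h2 : (-s + (c + 1) * t, y) ∈ K)⟩
      refine ⟨-c, ⟨by linarith [hc.2], by linarith [hc.1]⟩, (?_ : (-(s + (-c - 1) * t), y) ∈ K),
        (?_ : (-(s + (-c + 1) * t), y) ∈ K)⟩
      · rwa [show -(s + (-c - 1) * t) = -s + (c + 1) * t by ring]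
      · rwa [show -(s + (-c + 1) * t) = -s + (c - 1) * t by ring]
  have h1 := measure_loss_nonneg_le hν hK hKc hK9 ht ht'
  have h2 := measure_loss_nonneg_le hν (hK.linear_preimage e.toLinearMap)
    (hKc.preimage e.continuous) (K := e ⁻¹' K)
    (by rw [← hγ, hinv _ hKc.measurableSet]; exact hK9) ht ht'
  rw [hstar, ← preimage_sdiff, ← preimage_sdiff, ← hγ, hinv _ (hSm.diff hKc.measurableSet)] at h2
  have h3 : γ (e ⁻¹' (K \ prodStar K t) ∩ {p | 0 ≤ p.1}) =
      γ ((K \ prodStar K t) ∩ {p | p.1 ≤ 0}) := by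
    rw [← hinv ((K \ prodStar K t) ∩ {p | p.1 ≤ 0}) ((hKc.measurableSet.diff hSm).inter
      (isClosed_le continuous_fst continuous_const).measurableSet)]
    congr 1
    ext p
    simp [he]
  rw [h3] at h2
  have h4 : γ (K \ prodStar K t) ≤ γ (prodStar K t \ K) := by
    have h5 : γ (K \ prodStar K t) ≤ γ ((K \ prodStar K t) ∩ {p | 0 ≤ p.1}) +
        γ ((K \ prodStar K t) ∩ {p | p.1 ≤ 0}) := by
      refine (measure_mono fun p hp => ?_).trans (measure_union_le _ _)
      exact (le_total 0 p.1).imp (fun h => ⟨hp, h⟩) (fun h => ⟨hp, h⟩)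
    have h6 : 2 * γ (K \ prodStar K t) ≤ 2 * γ (prodStar K t \ K) := by
      calc _ ≤ 2 * _ := mul_le_mul_right h5 2
        _ = _ := mul_add _ _ _
        _ ≤ _ := add_le_add h1 h2
        _ = _ := (two_mul _).symm
    exact (ENNReal.mul_le_mul_iff_right (by simp) (by simp)).1 h6
  calc γ K = γ (K ∩ prodStar K t) + γ (K \ prodStar K t) := (measure_inter_add_sdiff _ hSm).symm
    _ ≤ γ (prodStar K t ∩ K) + γ (prodStar K t \ K) := by rw [inter_comm]; gcongr
    _ = _ := measure_inter_add_sdiff _ hKc.measurableSet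

end ProductStar

section PrefixBalancing

open Set ProbabilityTheory
open scoped RealInnerProductSpace

/-- The points `x` for which some translate by `c • u`, `|c| ≤ 2`, of the segment
`[x - u, x + u]` has both endpoints in `K`. -/
def starSet {E : Type*} [AddCommGroup E] [Module ℝ E] (K : Set E) (u : E) : Set E :=
  {x | ∃ c ∈ Icc (-2 : ℝ) 2, x + (c - 1) • u ∈ K ∧ x + (c + 1) • u ∈ K}

variable {E : Type*} [NormedAddCommGroup E] [InnerProductSpace ℝ E]

theorem isClosed_starSet {K : Set E} (hK : IsClosed K) (u : E) : IsClosed (starSet K u) :=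
  (isCompact_Icc (a := (-2 : ℝ)) (b := 2)).isClosed_exists
    (G := {q : ℝ × E | q.2 + (q.1 - 1) • u ∈ K ∧ q.2 + (q.1 + 1) • u ∈ K})
    ((hK.preimage (by fun_prop)).inter (hK.preimage (by fun_prop)))

theorem convex_starSet {K : Set E} (hK : Convex ℝ K) (u : E) : Convex ℝ (starSet K u) := by
  rintro x ⟨c, hc, h1, h2⟩ y ⟨c', hc', h1', h2'⟩ a b ha hb hab
  refine ⟨a * c + b * c', convex_Icc _ _ hc hc' ha hb hab, ?_, ?_⟩
  · convert hK h1 h1' ha hb hab using 1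
    have : b = 1 - a := by linarith
    subst this
    module
  · convert hK h2 h2' ha hb hab using 1
    have : b = 1 - a := by linarith
    subst this
    module

theorem exists_sign_of_mem_starSet {K : Set E} (hK : Convex ℝ K) {u x : E}
    (hx : x ∈ starSet K u) : ∃ ε : ℝ, (ε = 1 ∨ ε = -1) ∧ x + ε • u ∈ K := by
  obtain ⟨c, ⟨hc1, hc2⟩, h1, h2⟩ := hx
  have key : ∀ ε : ℝ, c - 1 ≤ ε → ε ≤ c + 1 → x + ε • u ∈ K := by
    intro ε he1 he2
    have := hK h1 h2 (a := (c + 1 - ε) / 2) (b := (ε - c + 1) / 2) (by linarith) (by linarith)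
      (by ring)
    convert this using 1
    module
  rcases le_total 0 c with h | h
  · exact ⟨1, Or.inl rfl, key 1 (by linarith) (by linarith)⟩
  · exact ⟨-1, Or.inr rfl, key (-1) (by linarith) (by linarith)⟩

variable [FiniteDimensional ℝ E] [MeasurableSpace E] [BorelSpace E]

theorem stdGaussian_le_starSet {K : Set E} (hK : Convex ℝ K) (hKc : IsClosed K)
    (hK9 : ENNReal.ofReal (9 / 10) ≤ stdGaussian E K) {u : E} (hu : ‖u‖ ≤ 1 / 136) :
    stdGaussian E K ≤ stdGaussian E (starSet K u) := by
  rcases eq_or_ne u 0 with rfl | hu0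
  · refine measure_mono fun x hx => ⟨0, by norm_num, ?_, ?_⟩ <;> simpa using hx
  have hpos : 0 < ‖u‖ := norm_pos_iff.2 hu0
  have : Nontrivial E := ⟨u, 0, hu0⟩
  obtain ⟨n, hn⟩ : ∃ n, Module.finrank ℝ E = n + 1 :=
    Nat.exists_eq_add_one.2 Module.finrank_pos
  obtain ⟨b, hb⟩ := Orthonormal.exists_orthonormalBasis_extension_of_card_eq (𝕜 := ℝ)
    (ι := Fin (n + 1)) (by simpa using hn) (v := fun _ : Fin (n + 1) => ‖u‖⁻¹ • u) (s := {0})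
    (by
      refine ⟨fun _ => ?_, fun i j hij => absurd (Subsingleton.elim i j) hij⟩
      simp [Set.domRestrict, norm_smul, hpos.ne'])
  have hb0 : b 0 = ‖u‖⁻¹ • u := hb 0 rfl
  have hub : u = ‖u‖ • b 0 := by rw [hb0, smul_inv_smul₀ hpos.ne']
  let ν : Measure (Fin n → ℝ) := Measure.pi fun _ => gaussianReal 0 1
  let T : ℝ × (Fin n → ℝ) →ₗ[ℝ] E :=
    { toFun := fun p => p.1 • b 0 + ∑ i, p.2 i • b i.succ
      map_add' := fun p q => by
        simp only [Prod.fst_add, Prod.snd_add, Pi.add_apply, add_smul, Finset.sum_add_distrib]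
        abel
      map_smul' := fun c p => by
        simp [smul_smul, Finset.smul_sum] }
  have hTc : Continuous T := LinearMap.continuous_of_finiteDimensional T
  have hmap : stdGaussian E = ((gaussianReal 0 1).prod ν).map T := by
    rw [stdGaussian_eq_map_pi_orthonormalBasis b,
      ← (measurePreserving_piFinSuccAbove (fun _ : Fin (n + 1) => gaussianReal 0 1) 0).map_eq,
      Measure.map_map hTc.measurable (MeasurableEquiv.measurable _)]
    congr 1
    ext x
    simp [T, Fin.sum_univ_succ, MeasurableEquiv.piFinSuccAbove, Fin.tail]
  have hstar : T ⁻¹' starSet K u = prodStar (T ⁻¹' K) ‖u‖ := by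
    ext ⟨s, y⟩
    have hT : ∀ c : ℝ, T (s, y) + c • u = T (s + c * ‖u‖, y) := by
      intro c
      conv_lhs => rw [hub]
      simp only [T, LinearMap.coe_mk, AddHom.coe_mk]
      module
    simp only [starSet, prodStar, lineStar, mem_preimage, mem_ofPred_eq, hT]
  rw [hmap, Measure.map_apply hTc.measurable hKc.measurableSet,
    Measure.map_apply hTc.measurable (isClosed_starSet hKc u).measurableSet, hstar]
  refine prod_measure_le_prodStar (MidpointLogConcave.pi_gaussianReal n) (hK.linear_preimage T)
    (hKc.preimage hTc) ?_ hpos hu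
  rwa [hmap, Measure.map_apply hTc.measurable hKc.measurableSet] at hK9

theorem exists_convex_subset_of_signs (n : ℕ) {K : Set E} (hK : Convex ℝ K) (hKc : IsClosed K)
    {δ : ℝ} (hδ : 0 ≤ δ) (hδn : (n + 1) * δ ≤ 1 / 10)
    (hKδ : stdGaussian E Kᶜ ≤ ENNReal.ofReal δ) (v : ℕ → E) (hv : ∀ i, ‖v i‖ ≤ 1 / 136) :
    ∃ C ⊆ K, Convex ℝ C ∧ IsClosed C ∧ stdGaussian E Cᶜ ≤ ENNReal.ofReal ((n + 1) * δ) ∧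
      ∀ x ∈ C, ∃ ε : ℕ → ℝ, (∀ i, ε i = 1 ∨ ε i = -1) ∧
        ∀ k ≤ n, x + ∑ i ∈ Finset.range k, ε i • v i ∈ K := by
  induction n generalizing v with
  | zero =>
    refine ⟨K, Subset.rfl, hK, hKc, by simpa using hKδ, fun x hx =>
      ⟨fun _ => 1, fun _ => Or.inl rfl, fun k hk => ?_⟩⟩
    obtain rfl : k = 0 := by omega
    simpa using hx
  | succ n ih =>
    push_cast at hδn
    obtain ⟨C, hCK, hC, hCc, hCδ, hCs⟩ := ih (by nlinarith) (fun i => v (i + 1)) fun i => hv _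
    have hC9 : ENNReal.ofReal (9 / 10) ≤ stdGaussian E C := by
      rw [prob_compl_eq_one_sub hCc.measurableSet] at hCδ
      have h1 : (1 : ENNReal) ≤ ENNReal.ofReal (1 / 10) + stdGaussian E C := by
        refine tsub_le_iff_right.1 (hCδ.trans (ENNReal.ofReal_le_ofReal ?_))
        nlinarith
      rw [show (9 / 10 : ℝ) = 1 - 1 / 10 by norm_num, ENNReal.ofReal_sub _ (by norm_num),
        ENNReal.ofReal_one]
      exact tsub_le_iff_left.2 h1
    have hstar := stdGaussian_le_starSet hC hCc hC9 (hv 0)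
    refine ⟨starSet C (v 0) ∩ K, inter_subset_right, (convex_starSet hC _).inter hK,
      (isClosed_starSet hCc _).inter hKc, ?_, ?_⟩
    · rw [compl_inter]
      calc _ ≤ stdGaussian E (starSet C (v 0))ᶜ + stdGaussian E Kᶜ := measure_union_le _ _
        _ ≤ stdGaussian E Cᶜ + stdGaussian E Kᶜ := by
            refine add_le_add_left ?_ _
            rw [prob_compl_eq_one_sub hCc.measurableSet,
              prob_compl_eq_one_sub (isClosed_starSet hCc _).measurableSet]
            exact tsub_le_tsub_left hstar 1
        _ ≤ ENNReal.ofReal ((n + 1) * δ) + ENNReal.ofReal δ := by gcongr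
        _ = _ := by
            rw [← ENNReal.ofReal_add (by positivity) hδ]
            congr 1; push_cast; ring
    · rintro x ⟨hx, hxK⟩
      obtain ⟨e, he, hxe⟩ := exists_sign_of_mem_starSet hC hx
      obtain ⟨ε, hε, hεK⟩ := hCs _ hxe
      refine ⟨fun i => Nat.casesOn i e ε, fun i => ?_, fun k hk => ?_⟩
      · cases i with
        | zero => exact he
        | succ i => exact hε i
      · cases k with
        | zero => simpa using hxK
        | succ k =>
          rw [Finset.sum_range_succ', add_comm (∑ i ∈ _, _), ← add_assoc]
          exact hεK k (by omega)

theorem stdGaussian_lt_abs_inner_le {θ : E} (hθ : ‖θ‖ ≤ 1) {R : ℝ} (hR : 0 ≤ R) :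
    stdGaussian E {x | R < |⟪θ, x⟫|} ≤ ENNReal.ofReal (2 * Real.exp (-R ^ 2 / 2)) := by
  set L : StrongDual ℝ E := innerSL ℝ θ with hL
  have hLx : ∀ x, L x = ⟪θ, x⟫ := fun x => rfl
  have hmap : (stdGaussian E).map L = gaussianReal 0 (‖θ‖ ^ 2).toNNReal := by
    rw [IsGaussian.map_eq_gaussianReal, integral_strongDual_stdGaussian,
      variance_dual_stdGaussian, hL, innerSL_apply_norm]
  have hsub : HasSubgaussianMGF L 1 (stdGaussian E) := by
    refine ⟨fun t => ?_, fun t => ?_⟩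
    · have := integrable_exp_mul_gaussianReal (μ := 0) (v := (‖θ‖ ^ 2).toNNReal) t
      rw [← hmap] at this
      exact this.comp_measurable L.continuous.measurable
    · rw [mgf_gaussianReal hmap]
      refine Real.exp_le_exp.2 ?_
      rw [Real.coe_toNNReal _ (by positivity), NNReal.coe_one]
      have : ‖θ‖ ^ 2 ≤ 1 := pow_le_one₀ (norm_nonneg _) hθ
      nlinarith [sq_nonneg t]
  have h1 := hsub.measure_ge_le hR
  have h2 := hsub.neg.measure_ge_le hR
  calc _ ≤ stdGaussian E ({x | R ≤ L x} ∪ {x | R ≤ (-L) x}) := by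
        refine measure_mono fun x (hx : R < |⟪θ, x⟫|) => ?_
        rcases lt_abs.1 hx with h | h
        · exact Or.inl h.le
        · exact Or.inr h.le
    _ ≤ stdGaussian E {x | R ≤ L x} + stdGaussian E {x | R ≤ (-L) x} := measure_union_le _ _
    _ ≤ ENNReal.ofReal (Real.exp (-R ^ 2 / 2)) + ENNReal.ofReal (Real.exp (-R ^ 2 / 2)) := by
        rw [← ofReal_measureReal, ← ofReal_measureReal]
        simp only [NNReal.coe_one, mul_one] at h1 h2
        gcongr
        exact h2
    _ = _ := by rw [← ENNReal.ofReal_add (by positivity) (by positivity), two_mul]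

/-- Signs balancing all prefixes of a sequence of short vectors against finitely many tests. -/
theorem exists_signs_abs_inner_initial_sum_le {J : Type*} [Fintype J] (θ : J → E) (hθ : ∀ j, ‖θ j‖ ≤ 1)
    (v : ℕ → E) (hv : ∀ i, ‖v i‖ ≤ 1 / 136) (n : ℕ) {R : ℝ} (hR : 0 ≤ R)
    (hRn : (n + 1) * (Fintype.card J * (2 * Real.exp (-R ^ 2 / 2))) ≤ 1 / 10) :
    ∃ ε : ℕ → ℝ, (∀ i, ε i = 1 ∨ ε i = -1) ∧
      ∀ k ≤ n, ∀ j, |⟪θ j, ∑ i ∈ Finset.range k, ε i • v i⟫| ≤ 2 * R := by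
  set K : Set E := ⋂ j, {x | |⟪θ j, x⟫| ≤ R} with hKdef
  have hKmem : ∀ x, x ∈ K ↔ ∀ j, |⟪θ j, x⟫| ≤ R := fun x => by simp [hKdef]
  have hKc : IsClosed K := isClosed_iInter fun j => isClosed_le (by fun_prop) continuous_const
  have hK : Convex ℝ K := by
    refine convex_iInter fun j => ?_
    have : {x | |⟪θ j, x⟫| ≤ R} = (innerSL ℝ (θ j)).toLinearMap ⁻¹' Icc (-R) R := by
      ext x; simp [abs_le]
    rw [this]
    exact (convex_Icc _ _).linear_preimage _
  have hKδ : stdGaussian E Kᶜ ≤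
      ENNReal.ofReal (Fintype.card J * (2 * Real.exp (-R ^ 2 / 2))) := by
    have : Kᶜ = ⋃ j, {x | R < |⟪θ j, x⟫|} := by
      ext x; simp [hKdef]
    rw [this]
    calc _ ≤ ∑ j, stdGaussian E {x | R < |⟪θ j, x⟫|} := measure_iUnion_fintype_le _ _
      _ ≤ ∑ _j : J, ENNReal.ofReal (2 * Real.exp (-R ^ 2 / 2)) :=
          Finset.sum_le_sum fun j _ => stdGaussian_lt_abs_inner_le (hθ j) hR
      _ = _ := by
          rw [Finset.sum_const, Finset.card_univ, nsmul_eq_mul,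
            ENNReal.ofReal_mul (Nat.cast_nonneg _), ENNReal.ofReal_natCast]
  obtain ⟨C, hCK, -, hCc, hCδ, hCs⟩ :=
    exists_convex_subset_of_signs n hK hKc (by positivity) hRn hKδ v hv
  have hne : C.Nonempty := by
    rw [nonempty_iff_ne_empty]
    rintro rfl
    rw [compl_empty, measure_univ] at hCδ
    have := hCδ.trans (ENNReal.ofReal_le_ofReal hRn)
    rw [ENNReal.one_le_ofReal] at this
    norm_num at this
  obtain ⟨x, hx⟩ := hne
  obtain ⟨ε, hε, hεK⟩ := hCs x hx
  refine ⟨ε, hε, fun k hk j => ?_⟩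
  have h1 := (hKmem _).1 (hCK hx) j
  have h2 := (hKmem _).1 (hεK k hk) j
  rw [inner_add_right] at h2
  rw [abs_le] at *
  constructor <;> linarith

end PrefixBalancing

section SignedBoxes

open Finset
open scoped RealInnerProductSpace

/-- Indicator of the box with upper corner `a`. -/
noncomputable def boxInd {d : ℕ} (a x : Fin d → ℝ) : ℝ := (Set.Iic a).indicator (fun _ => 1) x

theorem boxInd_eq {d : ℕ} (a x : Fin d → ℝ) [Decidable (x ≤ a)] :
    boxInd a x = if x ≤ a then 1 else 0 := by
  classical
  rw [boxInd, Set.indicator_apply]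
  simp

theorem sum_dyadic_eq (K r c : ℕ) (hr : r < 2 ^ K) (hc : c < 2 ^ K) :
    ∑ l ∈ range K, (if c / 2 ^ l % 2 = 1 ∧ r / 2 ^ l + 1 = c / 2 ^ l then (1 : ℝ) else 0) =
      if r < c then 1 else 0 := by
  induction K generalizing r c with
  | zero =>
    obtain rfl : c = 0 := by simpa using hc
    simp
  | succ K ih =>
    have := ih (r / 2) (c / 2) (by rw [pow_succ] at hr; omega) (by rw [pow_succ] at hc; omega)
    rw [sum_range_succ']
    simp only [pow_succ', ← Nat.div_div_eq_div_mul]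
    rw [this]
    simp only [pow_zero, Nat.div_one]
    by_cases h1 : r / 2 < c / 2 <;> by_cases h2 : c % 2 = 1 ∧ r + 1 = c <;>
      by_cases h3 : r < c <;> simp only [h1, h2, h3, if_true, if_false] <;> first | (exfalso; omega) | norm_num

theorem inner_prod_eq {e : ℕ} {α : Type*} [Fintype α] (f g : Fin e → α → ℝ) :
    ⟪(WithLp.toLp 2 fun x : Fin e → α => ∏ i, f i (x i)),
      (WithLp.toLp 2 fun x : Fin e → α => ∏ i, g i (x i))⟫ = ∏ i, ∑ a, f i a * g i a := by
  classical
  rw [prod_univ_sum, Fintype.piFinset_univ, PiLp.inner_apply]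
  refine sum_congr rfl fun x _ => ?_
  simp [prod_mul_distrib, mul_comm]

theorem norm_tensor_le {e : ℕ} {α : Type*} [Fintype α] (f : Fin e → α → ℝ) {s : ℝ} (hs : 0 ≤ s)
    (hf : ∀ i, ∑ a, f i a * f i a ≤ s ^ 2) :
    ‖(WithLp.toLp 2 fun x : Fin e → α => ∏ i, f i (x i) : EuclideanSpace ℝ (Fin e → α))‖
      ≤ s ^ e := by
  refine abs_le_of_sq_le_sq' ?_ (by positivity) |>.2
  rw [← real_inner_self_eq_norm_sq, inner_prod_eq]
  calc _ ≤ ∏ _i : Fin e, s ^ 2 :=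
        prod_le_prod (fun i _ => sum_nonneg fun a _ => mul_self_nonneg _) fun i _ => hf i
    _ = _ := by simp [← pow_mul, mul_comm]

theorem exists_signs_ranks_le (e k : ℕ) (r : ℕ → Fin e → ℕ)
    (hr : ∀ p i, r p i < 2 ^ k) :
    ∃ ε : ℕ → ℝ, (∀ p, ε p = 1 ∨ ε p = -1) ∧ ∀ m ≤ 2 ^ k, ∀ c : Fin e → ℕ, (∀ i, c i ≤ 2 ^ k) →
      |∑ p ∈ range m, ε p * ∏ i, (if r p i < c i then (1 : ℝ) else 0)| ≤
        272 * √(2 * (e + 6)) * ((k + 1) ^ e * √(k + 1)) := by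
  let α := Fin (k + 1) × Fin (2 ^ k)
  let E := EuclideanSpace ℝ (Fin e → α)
  let f : ℕ → Fin e → α → ℝ := fun p i a => if r p i / 2 ^ (a.1 : ℕ) = a.2 then 1 else 0
  let g : (Fin e → ℕ) → Fin e → α → ℝ := fun c i a =>
    if c i / 2 ^ (a.1 : ℕ) % 2 = 1 ∧ (a.2 : ℕ) + 1 = c i / 2 ^ (a.1 : ℕ) then 1 else 0
  let V : ℕ → E := fun p => WithLp.toLp 2 fun x => ∏ i, f p i (x i)
  let Θ : (Fin e → ℕ) → E := fun c => WithLp.toLp 2 fun x => ∏ i, g c i (x i)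
  set s : ℝ := √(k + 1) with hs
  have hs0 : 0 < s := Real.sqrt_pos.2 (by positivity)
  have hs2 : s ^ 2 = k + 1 := Real.sq_sqrt (by positivity)
  have hV : ∀ p, ‖V p‖ ≤ s ^ e := by
    refine fun p => norm_tensor_le _ hs0.le fun i => ?_
    rw [Fintype.sum_prod_type, hs2]
    calc _ ≤ ∑ _l : Fin (k + 1), (1 : ℝ) := by
          refine sum_le_sum fun l _ => ?_
          have hq : r p i / 2 ^ (l : ℕ) < 2 ^ k := (Nat.div_le_self _ _).trans_lt (hr p i)
          rw [sum_eq_single_of_mem (⟨_, hq⟩ : Fin (2 ^ k)) (mem_univ _)]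
          · simp [f]
          · intro q _ hne
            have : ¬ r p i / 2 ^ (l : ℕ) = q := fun h => hne (Fin.ext h.symm)
            simp [f, this]
      _ = _ := by simp
  have hΘ : ∀ c, ‖Θ c‖ ≤ s ^ e := by
    refine fun c => norm_tensor_le _ hs0.le fun i => ?_
    rw [Fintype.sum_prod_type, hs2]
    calc _ ≤ ∑ _l : Fin (k + 1), (1 : ℝ) := by
          refine sum_le_sum fun l _ => ?_
          by_cases h : ∃ q : Fin (2 ^ k), (q : ℕ) + 1 = c i / 2 ^ (l : ℕ)
          · obtain ⟨q, hq⟩ := h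
            rw [sum_eq_single_of_mem q (mem_univ _)]
            · simp only [g]; split_ifs <;> norm_num
            · intro q' _ hne
              have : ¬ (q' : ℕ) + 1 = c i / 2 ^ (l : ℕ) := fun h => hne (Fin.ext (by omega))
              simp [g, this]
          · push Not at h
            rw [sum_eq_zero]
            · norm_num
            · intro q _
              simp [g, h q]
      _ = _ := by simp
  have hinner : ∀ p c, (∀ i, c i ≤ 2 ^ k) →
      ⟪Θ c, V p⟫ = ∏ i, (if r p i < c i then (1 : ℝ) else 0) := by
    intro p c hc
    rw [inner_prod_eq]
    refine prod_congr rfl fun i _ => ?_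
    have hck : c i < 2 ^ (k + 1) := (hc i).trans_lt (by rw [pow_succ]; have := Nat.two_pow_pos k; omega)
    rw [← sum_dyadic_eq (k + 1) (r p i) (c i)
      ((hr p i).trans (Nat.pow_lt_pow_right (by norm_num) (by omega))) hck,
      ← Fin.sum_univ_eq_sum_range (fun l => if c i / 2 ^ l % 2 = 1 ∧ r p i / 2 ^ l + 1 = c i / 2 ^ l
        then (1 : ℝ) else 0), Fintype.sum_prod_type]
    refine sum_congr rfl fun l _ => ?_
    have hq : r p i / 2 ^ (l : ℕ) < 2 ^ k := (Nat.div_le_self _ _).trans_lt (hr p i)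
    rw [sum_eq_single_of_mem (⟨_, hq⟩ : Fin (2 ^ k)) (mem_univ _)]
    · simp [f, g]
    · intro q _ hne
      have : ¬ r p i / 2 ^ (l : ℕ) = q := fun h => hne (Fin.ext h.symm)
      simp [f, this]
  set R : ℝ := √(2 * (e + 6)) * √(k + 1) with hRdef
  have hR0 : 0 ≤ R := by positivity
  have hR2 : -R ^ 2 / 2 = -((((e + 6) * (k + 1) : ℕ)) : ℝ) := by
    rw [hRdef, mul_pow, Real.sq_sqrt (by positivity), Real.sq_sqrt (by positivity)]
    push_cast; ring
  have hcard : Fintype.card (Fin e → Fin (2 ^ k + 1)) = (2 ^ k + 1) ^ e := by simp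
  have hRn : (((2 ^ k : ℕ) : ℝ) + 1) * (Fintype.card (Fin e → Fin (2 ^ k + 1)) *
      (2 * Real.exp (-R ^ 2 / 2))) ≤ 1 / 10 := by
    have hexp : Real.exp (-R ^ 2 / 2) ≤ (1 / 2) ^ ((e + 6) * (k + 1)) := by
      rw [hR2, ← neg_one_mul, mul_comm, Real.exp_nat_mul]
      gcongr
      rw [Real.exp_neg, one_div]
      gcongr
      have := Real.add_one_le_exp 1
      linarith
    have h2 : ((2 : ℝ) ^ k + 1) ≤ 2 ^ (k + 1) := by
      rw [pow_succ]; linarith [one_le_pow₀ (one_le_two : (1 : ℝ) ≤ 2) (n := k)]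
    rw [hcard]
    push_cast
    calc ((2 : ℝ) ^ k + 1) * (((2 : ℝ) ^ k + 1) ^ e * (2 * Real.exp (-R ^ 2 / 2)))
        ≤ 2 ^ (k + 1) * ((2 ^ (k + 1)) ^ e * (2 ^ (k + 1) * (1 / 2) ^ ((e + 6) * (k + 1)))) := by
          gcongr
          exact le_self_pow₀ one_le_two (by omega)
      _ = (1 / 2) ^ (4 * (k + 1)) := by
          have : (e + 6) * (k + 1) = (k + 1) + (k + 1) * e + (k + 1) + 4 * (k + 1) := by ring
          rw [this, pow_add _ _ (4 * (k + 1)), ← pow_mul, ← mul_assoc, ← mul_assoc, ← mul_assoc,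
            ← pow_add, ← pow_add, ← mul_pow]
          norm_num
      _ ≤ (1 / 2) ^ 4 := pow_le_pow_of_le_one (by norm_num) (by norm_num) (by omega)
      _ ≤ _ := by norm_num
  have hnorm : ∀ w : E, ‖w‖ ≤ s ^ e → ‖(s ^ e)⁻¹ • w‖ ≤ 1 := by
    intro w hw
    rw [norm_smul, Real.norm_of_nonneg (by positivity), ← div_eq_inv_mul]
    exact div_le_one_of_le₀ hw (by positivity)
  obtain ⟨ε, hε, hbound⟩ := exists_signs_abs_inner_initial_sum_le (E := E)
    (J := Fin e → Fin (2 ^ k + 1)) (fun c => (s ^ e)⁻¹ • Θ (fun i => c i)) (fun c => hnorm _ (hΘ _))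
    (fun p => (1 / 136 : ℝ) • (s ^ e)⁻¹ • V p)
    (fun p => by
      rw [norm_smul, Real.norm_of_nonneg (by norm_num)]
      linarith [hnorm _ (hV p)]) (2 ^ k) hR0 hRn
  refine ⟨ε, hε, fun m hm c hc => ?_⟩
  have h := hbound m hm (fun i => ⟨c i, Nat.lt_succ_of_le (hc i)⟩)
  have hse : s ^ e * s ^ e = (k + 1) ^ e := by rw [← mul_pow, ← sq, hs2]
  have hsum : ∑ p ∈ range m, ε p * ∏ i, (if r p i < c i then (1 : ℝ) else 0) =
      136 * (s ^ e * s ^ e) * ⟪(s ^ e)⁻¹ • Θ c,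
        ∑ p ∈ range m, ε p • (1 / 136 : ℝ) • (s ^ e)⁻¹ • V p⟫ := by
    rw [inner_sum, mul_sum]
    refine sum_congr rfl fun p _ => ?_
    simp only [real_inner_smul_left, real_inner_smul_right, hinner p c hc]
    field_simp
  rw [hsum, hse, abs_mul, abs_of_nonneg (by positivity)]
  calc _ ≤ 136 * ((k : ℝ) + 1) ^ e * (2 * R) := mul_le_mul_of_nonneg_left h (by positivity)
    _ = _ := by rw [hRdef]; ring

/-- Signs with small discrepancy on all boxes for `2 ^ k` points, in dimension `e + 1`. -/
theorem exists_signs_boxInd_le (e k : ℕ) (y : Fin (2 ^ k) → Fin (e + 1) → ℝ) :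
    ∃ ε : Fin (2 ^ k) → ℝ, (∀ p, ε p = 1 ∨ ε p = -1) ∧ ∀ a : Fin (e + 1) → ℝ,
      |∑ p, ε p * boxInd a (y p)| ≤
        272 * √(2 * (e + 6)) * ((k + 1) ^ e * √(k + 1)) := by
  classical
  let σ := Tuple.sort fun p => y p 0
  let z : Fin (2 ^ k) → Fin (e + 1) → ℝ := fun p => y (σ p)
  have hz : Monotone fun p => z p 0 := Tuple.monotone_sort fun p => y p 0
  let r : ℕ → Fin e → ℕ := fun p i =>
    if h : p < 2 ^ k then #{q | z q i.succ < z ⟨p, h⟩ i.succ} else 0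
  have hr : ∀ p i, r p i < 2 ^ k := by
    intro p i
    simp only [r]
    split_ifs with h
    · calc _ < #(univ : Finset (Fin (2 ^ k))) :=
            card_lt_card ((filter_ssubset).2 ⟨⟨p, h⟩, mem_univ _, by simp⟩)
        _ = _ := by simp
    · positivity
  obtain ⟨ε, hε, hb⟩ := exists_signs_ranks_le e k r hr
  refine ⟨fun p => ε (σ.symm p), fun p => hε _, fun a => ?_⟩
  let c : Fin e → ℕ := fun i => #{q | z q i.succ ≤ a i.succ}
  have hc : ∀ i, c i ≤ 2 ^ k := fun i => (card_le_univ _).trans (by simp)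
  have hrc : ∀ (p : Fin (2 ^ k)) i, r p i < c i ↔ z p i.succ ≤ a i.succ := by
    intro p i
    simp only [r, c, p.2, dif_pos, Fin.eta]
    constructor
    · intro h
      by_contra! h'
      refine absurd h (not_lt.2 (card_le_card fun q hq => ?_))
      simp only [mem_filter, mem_univ, true_and] at hq ⊢
      exact hq.trans_lt h'
    · intro h
      refine card_lt_card (Finset.ssubset_iff_subset_ne.2 ⟨fun q hq => ?_, fun heq => ?_⟩)
      · simp only [mem_filter, mem_univ, true_and] at hq ⊢
        exact hq.le.trans h
      · have : p ∈ ({q | z q i.succ < z p i.succ} : Finset (Fin (2 ^ k))) := by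
          rw [heq]; simpa using h
        simp at this
  have hex : ∃ m, ∀ h : m < 2 ^ k, a 0 < z ⟨m, h⟩ 0 := ⟨2 ^ k, fun h => absurd h (lt_irrefl _)⟩
  let m := Nat.find hex
  have hm : m ≤ 2 ^ k := Nat.find_min' hex fun h => absurd h (lt_irrefl _)
  have hmp : ∀ p : Fin (2 ^ k), (p : ℕ) < m ↔ z p 0 ≤ a 0 := by
    intro p
    constructor
    · intro h
      have := Nat.find_min hex h
      push Not at this
      exact this.2
    · intro h
      by_contra! h'
      have hmk : m < 2 ^ k := h'.trans_lt p.2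
      have h1 := Nat.find_spec hex hmk
      have h2 : z ⟨m, hmk⟩ 0 ≤ z p 0 := hz (show (⟨m, hmk⟩ : Fin (2 ^ k)) ≤ p from h')
      linarith
  have hsum : ∑ p, ε (σ.symm p) * boxInd a (y p) =
      ∑ p ∈ range m, ε p * ∏ i, (if r p i < c i then (1 : ℝ) else 0) := by
    rw [← Equiv.sum_comp σ]
    simp only [Equiv.symm_apply_apply]
    have h1 : ∀ p : Fin (2 ^ k), ε p * boxInd a (y (σ p)) =
        if (p : ℕ) < m then ε p * ∏ i, (if r p i < c i then (1 : ℝ) else 0) else 0 := by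
      intro p
      have h2 : y (σ p) ≤ a ↔ (p : ℕ) < m ∧ ∀ i, r p i < c i := by
        rw [hmp, Pi.le_def, Fin.forall_fin_succ]
        simp only [hrc]
        rfl
      rw [boxInd_eq, Fintype.prod_ite_zero]
      by_cases h3 : (p : ℕ) < m <;> simp [h2, h3]
    rw [sum_congr rfl fun p _ => h1 p,
      Fin.sum_univ_eq_sum_range (fun p => if p < m then
        ε p * ∏ i, (if r p i < c i then (1 : ℝ) else 0) else 0), ← sum_filter]
    congr 1
    ext p
    simp only [mem_filter, mem_range]
    omega
  rw [hsum]
  exact hb m hm c hc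

end SignedBoxes

section Halving

variable {d : ℕ}

/-- Signed counting error of a list of points against `F`, on the box with upper corner `a`. -/
noncomputable def boxErr (F : (Fin d → ℝ) → ℝ) (l : List (Fin d → ℝ)) (a : Fin d → ℝ) : ℝ :=
  (l.map fun x => boxInd a x - F a).sum

theorem boxErr_append (F : (Fin d → ℝ) → ℝ) (l l' : List (Fin d → ℝ)) (a : Fin d → ℝ) :
    boxErr F (l ++ l') a = boxErr F l a + boxErr F l' a := by
  simp [boxErr]

theorem List.Perm.boxErr_eq {l l' : List (Fin d → ℝ)} (h : l.Perm l') (F : (Fin d → ℝ) → ℝ)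
    (a : Fin d → ℝ) : boxErr F l a = boxErr F l' a :=
  (h.map _).sum_eq

theorem boxErr_eq (F : (Fin d → ℝ) → ℝ) (l : List (Fin d → ℝ)) (a : Fin d → ℝ) :
    boxErr F l a = (l.map (boxInd a)).sum - l.length * F a := by
  induction l with
  | nil => simp [boxErr]
  | cons x l ih =>
    simp only [boxErr, List.map_cons, List.sum_cons, List.length_cons, Nat.cast_add_one] at ih ⊢
    linarith

theorem boxInd_nonneg (a x : Fin d → ℝ) : 0 ≤ boxInd a x := by
  classical
  rw [boxInd_eq]; split_ifs <;> norm_num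

theorem boxInd_le_one (a x : Fin d → ℝ) : boxInd a x ≤ 1 := by
  classical
  rw [boxInd_eq]; split_ifs <;> norm_num

theorem sum_map_filter_sub {ι : Type*} (L : List ι) (ε g : ι → ℝ) (p : ι → Bool)
    (hp : ∀ i, p i = true → ε i = 1) (hn : ∀ i, p i = false → ε i = -1) :
    ((L.filter p).map g).sum - ((L.filter fun i => !p i).map g).sum =
      (L.map fun i => ε i * g i).sum := by
  induction L with
  | nil => simp
  | cons i L ih =>
    cases h : p i
    · simp [h, hn i h, ← ih]; ring
    · simp [h, hp i h, ← ih]; ring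

/-- Every list of length `2 ^ k` splits in two parts with nearly equal counts in all boxes. -/
def SplitBound (d : ℕ) (B : ℕ → ℝ) : Prop :=
  ∀ k, ∀ y : Fin (2 ^ k) → Fin d → ℝ, ∃ ε : Fin (2 ^ k) → ℝ, (∀ p, ε p = 1 ∨ ε p = -1) ∧
    ∀ a, |∑ p, ε p * boxInd a (y p)| ≤ B k

theorem exists_append_perm {B : ℕ → ℝ} (hB : SplitBound d B) (k : ℕ) (l : List (Fin d → ℝ))
    (hl : l.length = 2 ^ k) :
    ∃ t u : List (Fin d → ℝ), (t ++ u).Perm l ∧ u.length ≤ t.length ∧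
      ∀ a, |(t.map (boxInd a)).sum - (u.map (boxInd a)).sum| ≤ B k := by
  obtain ⟨ε, hε, hb⟩ := hB k fun p => l.get (p.cast hl.symm)
  set y : Fin (2 ^ k) → Fin d → ℝ := fun p => l.get (p.cast hl.symm)
  classical
  let t := ((List.finRange (2 ^ k)).filter fun p => decide (ε p = 1)).map y
  let u := ((List.finRange (2 ^ k)).filter fun p => !decide (ε p = 1)).map y
  have hyl : (List.finRange (2 ^ k)).map y = l := by
    apply List.ext_get
    · simp [hl]
    · intro n h1 h2
      simp [y]
  have hperm : (t ++ u).Perm l := by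
    rw [← hyl, ← List.map_append]
    exact (List.filter_append_perm _ _).map _
  have hd : ∀ a, |(t.map (boxInd a)).sum - (u.map (boxInd a)).sum| ≤ B k := by
    intro a
    have h := sum_map_filter_sub (List.finRange (2 ^ k)) ε (fun p => boxInd a (y p))
      (fun p => decide (ε p = 1)) (by simp) (fun p hp => (hε p).resolve_left (by simpa using hp))
    rw [← Fin.sum_univ_def] at h
    simp only [t, u, List.map_map]
    rw [Function.comp_def, h]
    exact hb a
  rcases le_total u.length t.length with h | h
  · exact ⟨t, u, hperm, h, hd⟩
  · exact ⟨u, t, List.perm_append_comm.trans hperm, h, fun a => by rw [abs_sub_comm]; exact hd a⟩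

theorem sum_map_boxInd_le (l : List (Fin d → ℝ)) (a : Fin d → ℝ) :
    0 ≤ (l.map (boxInd a)).sum ∧ (l.map (boxInd a)).sum ≤ l.length := by
  induction l with
  | nil => simp
  | cons x l ih =>
    have := boxInd_nonneg a x
    have := boxInd_le_one a x
    simp only [List.map_cons, List.sum_cons, List.length_cons, Nat.cast_add_one]
    constructor <;> linarith

theorem exists_sum_map_boxInd_eq (l : List (Fin d → ℝ)) :
    ∃ b, ∀ a, b ≤ a → (l.map (boxInd a)).sum = l.length := by
  classical
  induction l with
  | nil => simp
  | cons x l ih =>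
    obtain ⟨b, hb⟩ := ih
    refine ⟨b ⊔ x, fun a ha => ?_⟩
    simp [hb a (le_sup_left.trans ha), boxInd_eq, le_sup_right.trans ha, add_comm]

/-- Balanced splitting. -/
theorem exists_halves_perm {B : ℕ → ℝ} (hB : SplitBound d B) (F : (Fin d → ℝ) → ℝ) (k : ℕ)
    (l : List (Fin d → ℝ)) (hl : l.length = 2 ^ (k + 1)) :
    ∃ t u : List (Fin d → ℝ), (t ++ u).Perm l ∧ t.length = 2 ^ k ∧ u.length = 2 ^ k ∧
      ∀ a, |boxErr F t a - boxErr F u a| ≤ 2 * B (k + 1) := by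
  obtain ⟨t, u, hperm, hle, hd⟩ := exists_append_perm hB (k + 1) l hl
  have hlen : t.length + u.length = 2 ^ k + 2 ^ k := by
    rw [← List.length_append, hperm.length_eq, hl]; ring
  set j := t.length - 2 ^ k
  have hj : t.length = 2 ^ k + j := by omega
  have hj' : u.length + j = 2 ^ k := by omega
  have hjB : 2 * (j : ℝ) ≤ B (k + 1) := by
    obtain ⟨b, hb⟩ := exists_sum_map_boxInd_eq t
    obtain ⟨b', hb'⟩ := exists_sum_map_boxInd_eq u
    have h := hd (b ⊔ b')
    rw [hb _ le_sup_left, hb' _ le_sup_right] at h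
    have h1 : (t.length : ℝ) = 2 ^ k + j := by exact_mod_cast hj
    have h2 : (u.length : ℝ) + j = 2 ^ k := by exact_mod_cast hj'
    have := (abs_le.1 h).2
    linarith
  refine ⟨t.drop j, t.take j ++ u, ?_, ?_, ?_, fun a => ?_⟩
  · refine List.Perm.trans ?_ hperm
    rw [← List.append_assoc]
    refine List.Perm.append_right _ ?_
    conv_rhs => rw [← List.take_append_drop j t]
    exact List.perm_append_comm
  · simp; omega
  · simp; omega
  · have h1 : (t.map (boxInd a)).sum =
        ((t.take j).map (boxInd a)).sum + ((t.drop j).map (boxInd a)).sum := by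
      conv_lhs => rw [← List.take_append_drop j t, List.map_append, List.sum_append]
    have h2 := sum_map_boxInd_le (t.take j) a
    have h3 : ((t.take j).length : ℝ) ≤ j := by simp
    have h4 := abs_le.1 (hd a)
    have h5 : (t.drop j).length = 2 ^ k := by simp; omega
    have h6 : (t.take j ++ u).length = 2 ^ k := by simp; omega
    rw [boxErr_eq, boxErr_eq, h5, h6, List.map_append, List.sum_append, abs_le]
    constructor <;> linarith [h4.1, h4.2]

theorem exists_halves_boxErr_le {B : ℕ → ℝ} (hB : SplitBound d B) (F : (Fin d → ℝ) → ℝ) (k : ℕ)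
    (l : List (Fin d → ℝ)) (hl : l.length = 2 ^ (k + 1)) {C : ℝ} (hC : ∀ a, |boxErr F l a| ≤ C) :
    ∃ t u : List (Fin d → ℝ), (t ++ u).Perm l ∧ t.length = 2 ^ k ∧ u.length = 2 ^ k ∧
      (∀ a, |boxErr F t a| ≤ C / 2 + B (k + 1)) ∧ ∀ a, |boxErr F u a| ≤ C / 2 + B (k + 1) := by
  obtain ⟨t, u, hp, ht, hu, hd⟩ := exists_halves_perm hB F k l hl
  have h1 : ∀ a, boxErr F t a + boxErr F u a = boxErr F l a := fun a => by
    rw [← boxErr_append, hp.boxErr_eq]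
  refine ⟨t, u, hp, ht, hu, fun a => ?_, fun a => ?_⟩ <;>
  · have h2 := abs_le.1 (hd a)
    have h3 := abs_le.1 (hC a)
    rw [← h1] at h3
    rw [abs_le]
    constructor <;> linarith [h2.1, h2.2, h3.1, h3.2]

/-- Recursive halving orders a list so that all its prefixes have small error. -/
theorem exists_perm_boxErr_take_le {B : ℕ → ℝ} (hB : SplitBound d B) (F : (Fin d → ℝ) → ℝ)
    {b : ℝ} (hb : 0 ≤ b) (k : ℕ) (hk : ∀ j ≤ k, B j ≤ b) (l : List (Fin d → ℝ))
    (hl : l.length = 2 ^ k) (hC : ∀ a, |boxErr F l a| ≤ 2 * b) :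
    ∃ l' : List (Fin d → ℝ), l'.Perm l ∧ ∀ m a, |boxErr F (l'.take m) a| ≤ 2 * b * (k + 1) := by
  induction k generalizing l with
  | zero =>
    refine ⟨l, List.Perm.refl _, fun m a => ?_⟩
    rcases Nat.eq_zero_or_pos m with rfl | hm
    · simpa [boxErr] using hb
    · rw [List.take_of_length_le (by rw [hl, pow_zero]; exact hm)]
      simpa using hC a
  | succ k ih =>
    obtain ⟨t, u, hp, ht, hu, htC, huC⟩ := exists_halves_boxErr_le hB F k l hl hC
    have h2 : 2 * b / 2 + B (k + 1) ≤ 2 * b := by linarith [hk (k + 1) le_rfl]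
    obtain ⟨t', htp, ht'⟩ := ih (fun j hj => hk j (by omega)) t ht fun a => (htC a).trans h2
    obtain ⟨u', hup, hu'⟩ := ih (fun j hj => hk j (by omega)) u hu fun a => (huC a).trans h2
    refine ⟨t' ++ u', (htp.append hup).trans hp, fun m a => ?_⟩
    push_cast
    rcases le_total m t'.length with hm | hm
    · rw [List.take_append_of_le_length hm]
      linarith [ht' m a]
    · rw [List.take_append, List.take_of_length_le hm, boxErr_append, htp.boxErr_eq]
      have := abs_add_le (boxErr F t a) (boxErr F (List.take (m - t'.length) u') a)
      linarith [hu' (m - t'.length) a, htC a]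

/-- Repeated halving reduces a long list with small relative error to a short one. -/
theorem exists_subperm_boxErr_le {B : ℕ → ℝ} (hB : SplitBound d B) (hB0 : ∀ k, 0 ≤ B k)
    (hB3 : ∀ k, B (k + 1) ≤ 3 / 2 * B k) (F : (Fin d → ℝ) → ℝ) {δ : ℝ} (k L : ℕ)
    (l : List (Fin d → ℝ)) (hl : l.length = 2 ^ (k + L)) (hC : ∀ a, |boxErr F l a| ≤ δ * 2 ^ (k + L)) :
    ∃ l' : List (Fin d → ℝ), (∀ x ∈ l', x ∈ l) ∧ l'.length = 2 ^ k ∧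
      ∀ a, |boxErr F l' a| ≤ δ * 2 ^ k + 6 * B k := by
  suffices H : ∀ L (l : List (Fin d → ℝ)), l.length = 2 ^ (k + L) →
      (∀ a, |boxErr F l a| ≤ δ * 2 ^ (k + L) + 6 * B (k + L)) →
      ∃ l' : List (Fin d → ℝ), (∀ x ∈ l', x ∈ l) ∧ l'.length = 2 ^ k ∧
        ∀ a, |boxErr F l' a| ≤ δ * 2 ^ k + 6 * B k from
    H L l hl fun a => (hC a).trans (by linarith [hB0 (k + L)])
  intro L
  induction L with
  | zero => exact fun l hl hC => ⟨l, fun x hx => hx, hl, hC⟩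
  | succ L ih =>
    intro l hl hC
    obtain ⟨t, u, hp, ht, -, htC, -⟩ := exists_halves_boxErr_le hB F (k + L) l hl hC
    obtain ⟨l', hl't, h⟩ := ih t ht fun a => (htC a).trans (by
      have := hB3 (k + L)
      rw [← add_assoc, pow_succ]
      linarith)
    exact ⟨l', fun x hx => hp.subset (List.mem_append_left _ (hl't x hx)), h⟩

end Halving

section Discretization

open Finset

/-- Rounding the masses of the cells of a finite partition. -/
theorem exists_list_count_cells {X ι : Type*} [MeasurableSpace X] [Fintype ι] (μ : Measure X)
    [IsProbabilityMeasure μ] (c : X → ι) (hc : ∀ i, MeasurableSet (c ⁻¹' {i})) {K : Set X}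
    (hK : MeasurableSet K) (hμK : μ K = 1) (N : ℕ) :
    ∃ l : List X, l.length = N ∧ (∀ x ∈ l, x ∈ K) ∧ ∀ (A : Set X) (bad : Set ι), MeasurableSet A →
      (∀ x y, c x = c y → c x ∉ bad → x ∈ A → y ∈ A) →
      |(l.map (A.indicator fun _ => (1 : ℝ))).sum - N * μ.real A| ≤
        2 * Fintype.card ι + N * μ.real (c ⁻¹' bad) := by
  classical
  have hKne : K.Nonempty := by
    rw [Set.nonempty_iff_ne_empty]; rintro rfl; simp at hμK
  obtain ⟨x₀, hx₀⟩ := hKne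
  have hKc : μ Kᶜ = 0 := by rw [prob_compl_eq_zero_iff hK, hμK]
  let w : ι → ℝ := fun i => μ.real (c ⁻¹' {i})
  have hw0 : ∀ i, 0 ≤ w i := fun i => measureReal_nonneg
  have hdisj : ∀ (A : Set X) (s : Finset ι), MeasurableSet A →
      ∑ i ∈ s, μ.real (c ⁻¹' {i} ∩ A) = μ.real (c ⁻¹' s ∩ A) := by
    intro A s hA
    rw [← measureReal_biUnion_finset (fun i _ j _ hij => ?_) fun i _ => (hc i).inter hA]
    · congr 1
      ext x
      simp
    · refine Set.disjoint_left.2 fun x hx hx' => hij ?_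
      simp only [Set.mem_inter_iff, Set.mem_preimage, Set.mem_singleton_iff] at hx hx'
      exact hx.1.symm.trans hx'.1
  have hp : ∀ i, ∃ x ∈ K, 0 < w i → c x = i := by
    intro i
    by_cases h : (K ∩ c ⁻¹' {i}).Nonempty
    · obtain ⟨x, hx, hxi⟩ := h
      exact ⟨x, hx, fun _ => hxi⟩
    · refine ⟨x₀, hx₀, fun hpos => absurd hpos (not_lt.2 (le_of_eq ?_))⟩
      simp only [w, measureReal_def]
      rw [measure_mono_null (fun x hx hxK => h ⟨x, hxK, hx⟩) hKc]
      simp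
  choose p hpK hpc using hp
  let n : ι → ℕ := fun i => ⌊N * w i⌋₊
  have hn1 : ∀ i, (n i : ℝ) ≤ N * w i := fun i => Nat.floor_le (by have := hw0 i; positivity)
  have hn2 : ∀ i, N * w i < n i + 1 := fun i => Nat.lt_floor_add_one _
  have hwsum : ∑ i, w i = 1 := by
    have := hdisj Set.univ Finset.univ MeasurableSet.univ
    simpa [w] using this
  have hnsum : ∑ i, n i ≤ N := by
    have : ((∑ i, n i : ℕ) : ℝ) ≤ N := by
      push_cast
      calc _ ≤ ∑ i, N * w i := sum_le_sum fun i _ => hn1 i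
        _ = N := by rw [← mul_sum, hwsum, mul_one]
    exact_mod_cast this
  have hrem : (N : ℝ) - ∑ i, (n i : ℝ) ≤ Fintype.card ι := by
    calc (N : ℝ) - ∑ i, (n i : ℝ) = ∑ i, (N * w i - n i) := by
          rw [sum_sub_distrib, ← mul_sum, hwsum, mul_one]
      _ ≤ ∑ _i : ι, (1 : ℝ) := sum_le_sum fun i _ => by linarith [hn2 i]
      _ = _ := by simp
  let l₁ : List X := (univ : Finset ι).toList.flatMap fun i => List.replicate (n i) (p i)
  let l : List X := l₁ ++ List.replicate (N - ∑ i, n i) x₀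
  have hl₁ : ∀ f : X → ℝ, (l₁.map f).sum = ∑ i, n i * f (p i) := by
    intro f
    rw [← sum_map_toList]
    simp only [l₁]
    induction (univ : Finset ι).toList with
    | nil => simp
    | cons i L ih => simp [ih]
  have hlen₁ : l₁.length = ∑ i, n i := by
    have := hl₁ fun _ => 1
    simp only [mul_one] at this
    have h2 : (l₁.map fun _ => (1 : ℝ)).sum = l₁.length := by simp
    rw [h2] at this
    exact_mod_cast this
  refine ⟨l, by simp [l, hlen₁]; omega, ?_, fun A bad hA hbad => ?_⟩
  · intro x hx
    simp only [l, l₁, List.mem_append, List.mem_flatMap, List.mem_replicate] at hx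
    rcases hx with ⟨i, -, -, rfl⟩ | ⟨-, rfl⟩
    exacts [hpK i, hx₀]
  · set g : X → ℝ := A.indicator fun _ => (1 : ℝ)
    have hg0 : ∀ x, 0 ≤ g x := fun x => Set.indicator_nonneg (fun _ _ => zero_le_one) x
    have hg1 : ∀ x, g x ≤ 1 := fun x => Set.indicator_le_self' (fun _ _ => zero_le_one) x
    have hlsum : (l.map g).sum = ∑ i, n i * g (p i) + (N - ∑ i, (n i : ℝ)) * g x₀ := by
      simp only [l, List.map_append, List.sum_append, hl₁]
      simp [Nat.cast_sub hnsum]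
    have hAsum : μ.real A = ∑ i, μ.real (c ⁻¹' {i} ∩ A) := by
      rw [hdisj A univ hA]; simp
    have hbadsum : μ.real (c ⁻¹' bad) = ∑ i, if i ∈ bad then w i else 0 := by
      rw [← sum_filter]
      have := hdisj Set.univ ({i | i ∈ bad} : Finset ι) MeasurableSet.univ
      simp only [Set.inter_univ] at this
      rw [this]
      simp
    have hcell : ∀ i, |n i * g (p i) - N * μ.real (c ⁻¹' {i} ∩ A)| ≤
        1 + N * (if i ∈ bad then w i else 0) := by
      intro i
      have hN : (0 : ℝ) ≤ N := by positivity
      have hm0 : 0 ≤ μ.real (c ⁻¹' {i} ∩ A) := measureReal_nonneg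
      have hm1 : μ.real (c ⁻¹' {i} ∩ A) ≤ w i := measureReal_mono Set.inter_subset_left
      have h1 := mul_le_mul_of_nonneg_left hm1 hN
      have h2 := mul_nonneg hN hm0
      have h3 : (n i : ℝ) * g (p i) ≤ n i := mul_le_of_le_one_right (by positivity) (hg1 _)
      have h4 : 0 ≤ (n i : ℝ) * g (p i) := mul_nonneg (by positivity) (hg0 _)
      have h5 := hn1 i
      have h6 := hn2 i
      by_cases hi : i ∈ bad
      · rw [if_pos hi, abs_le]; constructor <;> linarith
      · rw [if_neg hi]
        rcases (hw0 i).eq_or_lt with h0 | h0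
        · rw [← h0] at h1 h5 hm1
          rw [abs_le]; constructor <;> linarith
        have hpi := hpc i h0
        by_cases hpA : p i ∈ A
        · have e1 : g (p i) = 1 := by simp [g, hpA]
          have e2 : c ⁻¹' {i} ∩ A = c ⁻¹' {i} := by
            refine Set.inter_eq_left.2 fun x hx => hbad (p i) x ?_ ?_ hpA
            · rw [hpi]; exact (Set.mem_singleton_iff.1 hx).symm
            · rwa [hpi]
          rw [e1, e2, abs_le]
          simp only [w] at h5 h6
          constructor <;> linarith
        · have e1 : g (p i) = 0 := by simp [g, hpA]
          have e2 : c ⁻¹' {i} ∩ A = ∅ := by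
            refine Set.eq_empty_of_forall_notMem fun x hx => hpA (hbad x (p i) ?_ ?_ hx.2)
            · rw [hpi]; exact hx.1
            · rw [show c x = i from hx.1]; exact hi
          rw [e1, e2]; simp
    calc |(l.map g).sum - N * μ.real A|
        = |∑ i, (n i * g (p i) - N * μ.real (c ⁻¹' {i} ∩ A)) +
            (N - ∑ i, (n i : ℝ)) * g x₀| := by
          rw [hlsum, hAsum, mul_sum, sum_sub_distrib]; ring_nf
      _ ≤ ∑ i, |n i * g (p i) - N * μ.real (c ⁻¹' {i} ∩ A)| + (N - ∑ i, (n i : ℝ)) := by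
          refine (abs_add_le _ _).trans (add_le_add (abs_sum_le_sum_abs _ _) ?_)
          have : 0 ≤ (N : ℝ) - ∑ i, (n i : ℝ) := by
            rw [sub_nonneg]; exact_mod_cast hnsum
          rw [abs_of_nonneg (mul_nonneg this (hg0 _))]
          exact mul_le_of_le_one_right this (hg1 _)
      _ ≤ ∑ i, (1 + N * (if i ∈ bad then w i else 0)) + Fintype.card ι :=
          add_le_add (sum_le_sum fun i _ => hcell i) hrem
      _ = _ := by
          rw [hbadsum, sum_add_distrib, mul_sum]; simp; ring

/-- A finite set of thresholds leaving gaps of small mass. -/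
theorem exists_finset_measure_gap_le (ν : Measure ℝ) [IsFiniteMeasure ν]
    (hν : ν (Set.Icc 0 1)ᶜ = 0) {δ : ENNReal} (hδ : 0 < δ) :
    ∃ T : Finset ℝ, ∀ a ∉ T, ν {x | ∀ t ∈ T, (t < x ↔ t < a) ∧ (t ≤ x ↔ t ≤ a)} ≤ δ := by
  have hnear : ∀ a : ℝ, ∃ r : ℝ, 0 < r ∧ ν (Set.Ioo (a - r) (a + r) \ {a}) < δ := by
    intro a
    let s : ℕ → Set ℝ := fun n => Set.Ioo (a - 1 / ((n : ℝ) + 1)) (a + 1 / ((n : ℝ) + 1)) \ {a}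
    have hs : Antitone s := by
      intro m n hmn
      have : 1 / ((n : ℝ) + 1) ≤ 1 / ((m : ℝ) + 1) := by gcongr
      exact Set.sdiff_subset_sdiff_left (Set.Ioo_subset_Ioo (by linarith) (by linarith))
    have hi : ⋂ n, s n = ∅ := by
      refine Set.eq_empty_of_forall_notMem fun x hx => ?_
      rw [Set.mem_iInter] at hx
      have hne : x ≠ a := (hx 0).2
      obtain ⟨n, hn⟩ := exists_nat_one_div_lt (abs_pos.2 (sub_ne_zero.2 hne))
      obtain ⟨⟨h1, h2⟩, -⟩ := hx n
      exact absurd hn (not_lt.2 (abs_le.2 ⟨by linarith, by linarith⟩))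
    have ht := tendsto_measure_iInter_atTop (μ := ν) (s := s)
      (fun n => (measurableSet_Ioo.diff (measurableSet_singleton a)).nullMeasurableSet) hs
      ⟨0, measure_ne_top _ _⟩
    rw [hi, measure_empty] at ht
    obtain ⟨n, hn⟩ := (ht.eventually_lt_const hδ).exists
    exact ⟨_, Nat.one_div_pos_of_nat, hn⟩
  choose r hr0 hr using hnear
  obtain ⟨t, -, ht⟩ := (isCompact_Icc : IsCompact (Set.Icc (0 : ℝ) 1)).elim_nhds_subcover
    (fun a => Set.Ioo (a - r a) (a + r a))
    fun a _ => Ioo_mem_nhds (by linarith [hr0 a]) (by linarith [hr0 a])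
  classical
  refine ⟨{0, 1} ∪ t ∪ t.image (fun a => a - r a) ∪ t.image (fun a => a + r a), fun a ha => ?_⟩
  by_cases haI : a ∈ Set.Icc (0 : ℝ) 1
  · obtain ⟨b, hb, hab⟩ := Set.mem_iUnion₂.1 (ht haI)
    refine (measure_mono ?_).trans (hr b).le
    intro x hx
    rw [Set.mem_ofPred_eq] at hx
    have h1 := (hx (b - r b) (mem_union_left _ (mem_union_right _ (mem_image_of_mem _ hb)))).1.2 hab.1
    have h2 := (hx (b + r b) (mem_union_right _ (mem_image_of_mem _ hb))).2
    have h3 := hx b (by simp [hb])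
    have hne : a ≠ b := by rintro rfl; simp [hb] at ha
    refine ⟨⟨h1, ?_⟩, ?_⟩
    · by_contra! h; exact absurd (h2.1 h) (not_le.2 hab.2)
    · rintro rfl
      exact hne (le_antisymm (not_lt.1 fun h => lt_irrefl _ (h3.1.2 h)) (h3.2.1 le_rfl))
  · refine (measure_mono_null ?_ hν).trans_le zero_le
    intro x hx hxI
    rw [Set.mem_ofPred_eq] at hx
    have h0 := hx 0 (by simp)
    have h1 := hx 1 (by simp)
    exact haI ⟨h0.2.1 hxI.1, not_lt.1 fun h => absurd (h1.1.2 h) (not_lt.2 hxI.2)⟩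

theorem exists_list_boxErr_le {d : ℕ} (μ : Measure (Fin d → ℝ)) [IsProbabilityMeasure μ]
    (hμ : μ (Set.Icc 0 1) = 1) {δ : ℝ} (hδ : 0 < δ) :
    ∃ N₀ : ℕ, ∀ N ≥ N₀, ∃ l : List (Fin d → ℝ), l.length = N ∧ (∀ x ∈ l, x ∈ Set.Icc 0 1) ∧
      ∀ a, |boxErr (fun a => μ.real (Set.Iic a)) l a| ≤ δ * N := by
  classical
  have hμc : μ (Set.Icc 0 1)ᶜ = 0 := by rw [prob_compl_eq_zero_iff measurableSet_Icc, hμ]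
  have hmarg : ∀ i : Fin d, (μ.map fun x => x i) (Set.Icc 0 1)ᶜ = 0 := by
    intro i
    rw [Measure.map_apply (measurable_pi_apply i) measurableSet_Icc.compl]
    refine measure_mono_null ?_ hμc
    intro x hx hxI
    exact hx ⟨hxI.1 i, hxI.2 i⟩
  have hδ' : 0 < δ / (2 * (d + 1)) := by positivity
  have hT := fun i => exists_finset_measure_gap_le (μ.map fun x => x i) (hmarg i)
    (ENNReal.ofReal_pos.2 hδ')
  choose T hT using hT
  let c : (Fin d → ℝ) → (∀ i, T i → Prop × Prop) := fun x i t => ((t : ℝ) < x i, (t : ℝ) ≤ x i)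
  have hc : ∀ x y i, c x i = c y i ↔ ∀ t ∈ T i, (t < x i ↔ t < y i) ∧ (t ≤ x i ↔ t ≤ y i) := by
    intro x y i
    simp [c, funext_iff]
  have hcm : ∀ i, MeasurableSet (c ⁻¹' {i}) := by
    intro q
    have : c ⁻¹' {q} = ⋂ i, ⋂ t : T i, {x | ((t : ℝ) < x i) = (q i t).1} ∩
        {x | ((t : ℝ) ≤ x i) = (q i t).2} := by
      ext x
      simp only [Set.mem_preimage, Set.mem_singleton_iff, funext_iff, c, Prod.ext_iff,
        Set.mem_iInter, Set.mem_inter_iff, Set.mem_ofPred_eq]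
    rw [this]
    refine MeasurableSet.iInter fun i => MeasurableSet.iInter fun t => ?_
    refine MeasurableSet.inter ?_ ?_
    · by_cases h : (q i t).1
      · simpa [h] using measurableSet_lt measurable_const (measurable_pi_apply i)
      · simpa [h] using measurableSet_le (measurable_pi_apply i) measurable_const
    · by_cases h : (q i t).2
      · simpa [h] using measurableSet_le measurable_const (measurable_pi_apply i)
      · simpa [h] using measurableSet_lt (measurable_pi_apply i) measurable_const
  have : Fintype (∀ i, T i → Prop × Prop) := Fintype.ofFinite _
  set n := Fintype.card (∀ i, T i → Prop × Prop)
  refine ⟨⌈4 * n / δ⌉₊, fun N hN => ?_⟩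
  obtain ⟨l, hl, hlK, h⟩ := exists_list_count_cells μ c hcm measurableSet_Icc hμ N
  refine ⟨l, hl, hlK, fun a => ?_⟩
  have hN' : 4 * n / δ ≤ N := (Nat.le_ceil _).trans (by exact_mod_cast hN)
  rw [div_le_iff₀ hδ] at hN'
  let bad : Set (∀ i, T i → Prop × Prop) := {q | ∃ i, a i ∉ T i ∧ q i = c a i}
  have hbad : ∀ x y, c x = c y → c x ∉ bad → x ∈ Set.Iic a → y ∈ Set.Iic a := by
    intro x y hxy hx hxa i
    by_contra! hlt
    have hxi := (hc x y i).1 (congrFun hxy i)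
    have haT : a i ∉ T i := fun hm => absurd ((hxi _ hm).1.2 hlt) (not_lt.2 (hxa i))
    refine hx ⟨i, haT, (hc x a i).2 fun t ht => ⟨⟨fun h => h.trans_le (hxa i), fun h => ?_⟩,
      ⟨fun h => h.trans (hxa i), fun h => ?_⟩⟩⟩
    · exact (hxi t ht).1.2 (h.trans hlt)
    · exact ((hxi t ht).1.2 (h.trans_lt hlt)).le
  have hbm : μ.real (c ⁻¹' bad) ≤ δ / 2 := by
    have hsub : c ⁻¹' bad ⊆ ⋃ i ∈ ({i | a i ∉ T i} : Finset (Fin d)), {x | c x i = c a i} := by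
      rintro x ⟨i, hi, hx⟩
      exact Set.mem_biUnion (by simpa using hi) hx
    calc μ.real (c ⁻¹' bad) ≤ ∑ i ∈ ({i | a i ∉ T i} : Finset (Fin d)), μ.real {x | c x i = c a i} :=
          (measureReal_mono hsub (measure_ne_top _ _)).trans (measureReal_biUnion_finset_le _ _)
      _ ≤ ∑ i ∈ ({i | a i ∉ T i} : Finset (Fin d)), δ / (2 * (d + 1)) := by
          refine sum_le_sum fun i hi => ?_
          refine ENNReal.toReal_le_of_le_ofReal hδ'.le ?_
          refine le_trans ?_ (hT i (a i) (by simpa using hi))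
          refine le_trans (le_of_eq ?_) (Measure.le_map_apply (measurable_pi_apply i).aemeasurable _)
          congr 1
          ext x
          exact hc x a i
      _ ≤ d * (δ / (2 * (d + 1))) := by
          rw [sum_const, nsmul_eq_mul]
          gcongr
          exact (card_le_univ _).trans (by simp)
      _ ≤ (d + 1) * (δ / (2 * (d + 1))) := by gcongr; linarith
      _ = δ / 2 := by field_simp
  rw [boxErr_eq, hl]
  refine (h (Set.Iic a) bad measurableSet_Iic hbad).trans ?_
  have := mul_le_mul_of_nonneg_left hbm (Nat.cast_nonneg (α := ℝ) N)
  linarith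

end Discretization

section Concatenation

open Finset

theorem log_two_pow_add {K i : ℕ} (hi : i < 2 ^ K) : Nat.log 2 (2 ^ K - 1 + i + 1) = K := by
  have := Nat.two_pow_pos K
  rw [Nat.log_eq_iff (Or.inr ⟨by norm_num, by omega⟩), pow_succ]
  omega

/-- Concatenation of blocks of lengths `1, 2, 4, …`. -/
def blockSeq {X : Type*} (l : ℕ → List X) (x₀ : X) (n : ℕ) : X :=
  (l (Nat.log 2 (n + 1))).getD (n + 1 - 2 ^ Nat.log 2 (n + 1)) x₀

theorem blockSeq_add {X : Type*} {l : ℕ → List X} (hl : ∀ k, (l k).length = 2 ^ k) (x₀ : X)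
    {K i : ℕ} (hi : i < 2 ^ K) :
    blockSeq l x₀ (2 ^ K - 1 + i) = (l K)[i]'(by rwa [hl]) := by
  have := Nat.two_pow_pos K
  rw [blockSeq, log_two_pow_add hi, show 2 ^ K - 1 + i + 1 - 2 ^ K = i by omega,
    List.getD_eq_getElem]

theorem blockSeq_mem {X : Type*} {l : ℕ → List X} {x₀ : X} {S : Set X} (hx₀ : x₀ ∈ S)
    (hS : ∀ k, ∀ x ∈ l k, x ∈ S) (n : ℕ) : blockSeq l x₀ n ∈ S := by
  rw [blockSeq]
  by_cases h : n + 1 - 2 ^ Nat.log 2 (n + 1) < (l (Nat.log 2 (n + 1))).length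
  · rw [List.getD_eq_getElem _ _ h]
    exact hS _ _ (List.getElem_mem h)
  · rwa [List.getD_eq_default _ _ (not_lt.1 h)]

theorem sum_blockSeq_add {X : Type*} {l : ℕ → List X} (hl : ∀ k, (l k).length = 2 ^ k) (x₀ : X)
    (g : X → ℝ) (K m : ℕ) (hm : m ≤ 2 ^ K) :
    ∑ i ∈ range m, g (blockSeq l x₀ (2 ^ K - 1 + i)) = (((l K).take m).map g).sum := by
  induction m with
  | zero => simp
  | succ m ih =>
    have h : m < (l K).length := by rw [hl]; omega
    rw [sum_range_succ, ih (by omega), blockSeq_add hl x₀ (by omega), List.take_add_one,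
      List.getElem?_eq_getElem h, List.map_append, List.sum_append]
    simp

theorem sum_blockSeq {X : Type*} {l : ℕ → List X} (hl : ∀ k, (l k).length = 2 ^ k) (x₀ : X)
    (g : X → ℝ) (K m : ℕ) (hm : m ≤ 2 ^ K) :
    ∑ n ∈ range (2 ^ K - 1 + m), g (blockSeq l x₀ n) =
      ∑ j ∈ range K, ((l j).map g).sum + (((l K).take m).map g).sum := by
  have hfull : ∀ K, ∑ n ∈ range (2 ^ K - 1), g (blockSeq l x₀ n) =
      ∑ j ∈ range K, ((l j).map g).sum := by
    intro K
    induction K with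
    | zero => simp
    | succ K ih =>
      have := Nat.two_pow_pos K
      rw [show 2 ^ (K + 1) - 1 = 2 ^ K - 1 + 2 ^ K by rw [pow_succ]; omega, sum_range_add, ih,
        sum_blockSeq_add hl x₀ g K _ le_rfl, sum_range_succ, List.take_of_length_le (hl K).le]
  rw [sum_range_add, hfull, sum_blockSeq_add hl x₀ g K m hm]

theorem exists_sequence_boxErr_le {d : ℕ} {B : ℕ → ℝ} (hB : SplitBound d B) (hB0 : ∀ k, 0 < B k)
    (hBm : Monotone B) (hB3 : ∀ k, B (k + 1) ≤ 3 / 2 * B k) (μ : Measure (Fin d → ℝ))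
    [IsProbabilityMeasure μ] (hμ : μ (Set.Icc 0 1) = 1) :
    ∃ x : ℕ → Fin d → ℝ, (∀ n, x n ∈ Set.Icc (0 : Fin d → ℝ) 1) ∧ ∀ N a,
      |∑ n ∈ range N, (boxInd a (x n) - μ.real (Set.Iic a))| ≤
        16 * (Nat.log 2 (N + 1) + 1) * B (Nat.log 2 (N + 1)) := by
  set F : (Fin d → ℝ) → ℝ := fun a => μ.real (Set.Iic a)
  have hblock : ∀ k, ∃ l : List (Fin d → ℝ), l.length = 2 ^ k ∧ (∀ x ∈ l, x ∈ Set.Icc 0 1) ∧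
      (∀ a, |boxErr F l a| ≤ 8 * B k) ∧
      ∀ m a, |boxErr F (l.take m) a| ≤ 8 * B k * (k + 1) := by
    intro k
    obtain ⟨N₀, hN₀⟩ := exists_list_boxErr_le μ hμ (δ := B k / 2 ^ k) (div_pos (hB0 k) (by positivity))
    obtain ⟨l₀, hl₀, hl₀K, h₀⟩ := hN₀ (2 ^ (k + N₀))
      (Nat.lt_two_pow_self.le.trans (Nat.pow_le_pow_right (by norm_num) (by omega)))
    obtain ⟨l₁, hl₁s, hl₁, h₁⟩ := exists_subperm_boxErr_le hB (fun k => (hB0 k).le) hB3 F k N₀ l₀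
      hl₀ (fun a => by simpa using h₀ a)
    rw [div_mul_cancel₀ _ (by positivity)] at h₁
    have hb := hB0 k
    have h₁' : ∀ a, |boxErr F l₁ a| ≤ 2 * (4 * B k) := fun a => (h₁ a).trans (by linarith)
    obtain ⟨l, hp, hl⟩ := exists_perm_boxErr_take_le hB F (b := 4 * B k) (by positivity) k
      (fun j hj => (hBm hj).trans (by linarith)) l₁ hl₁ h₁'
    refine ⟨l, hp.length_eq.trans hl₁, fun x hx => hl₀K x (hl₁s x (hp.subset hx)), fun a => ?_,
      fun m a => (hl m a).trans_eq (by ring)⟩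
    rw [hp.boxErr_eq]
    exact (h₁' a).trans_eq (by ring)
  choose l hl hlK herr hpre using hblock
  refine ⟨blockSeq l 0, blockSeq_mem (by simp) hlK, fun N a => ?_⟩
  set K := Nat.log 2 (N + 1)
  have h1 : 2 ^ K ≤ N + 1 := Nat.pow_log_le_self 2 (by omega)
  have h2 : N + 1 < 2 ^ (K + 1) := Nat.lt_pow_succ_log_self (by norm_num) _
  have h3 := Nat.two_pow_pos K
  obtain ⟨m, hm⟩ : ∃ m, N = 2 ^ K - 1 + m := ⟨N + 1 - 2 ^ K, by omega⟩
  have hmK : m ≤ 2 ^ K := by rw [pow_succ] at h2; omega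
  have hs := sum_blockSeq hl 0 (fun x => boxInd a x - F a) K m hmK
  rw [← hm] at hs
  rw [hs]
  calc _ ≤ |∑ j ∈ range K, boxErr F (l j) a| + |boxErr F ((l K).take m) a| := abs_add_le _ _
    _ ≤ ∑ j ∈ range K, 8 * B K + 8 * B K * (K + 1) := by
        refine add_le_add ((abs_sum_le_sum_abs _ _).trans (sum_le_sum fun j hj => ?_)) (hpre K m a)
        have := hBm (mem_range.1 hj).le
        exact (herr j a).trans (by linarith)
    _ ≤ _ := by
        rw [sum_const, card_range, nsmul_eq_mul]
        linarith [hB0 K]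

end Concatenation

section Bounds

theorem pow_mul_sqrt_succ_le {e : ℕ} {t : ℝ} (ht : 3 * (e + 1) ≤ t) :
    (t + 1) ^ e * √(t + 1) ≤ 3 / 2 * (t ^ e * √t) := by
  have he : (0 : ℝ) ≤ e := Nat.cast_nonneg e
  have ht0 : 0 < t := by linarith
  have h1 : √(t + 1) ≤ (1 + 1 / t) * √t := by
    rw [Real.sqrt_le_left (by positivity), mul_pow, Real.sq_sqrt ht0.le]
    have : (1 + 1 / t) ^ 2 * t = t + 2 + 1 / t := by field_simp; ring
    have : 0 < 1 / t := by positivity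
    linarith
  have h2 : (1 + 1 / t) ^ (e + 1) ≤ 3 / 2 := by
    have h := one_add_mul_le_pow (a := -(1 / (t + 1))) (by
      have : 1 / (t + 1) ≤ 1 := by rw [div_le_one (by linarith)]; linarith
      linarith) (e + 1)
    have h3 : (2 : ℝ) / 3 ≤ 1 + ((e + 1 : ℕ) : ℝ) * -(1 / (t + 1)) := by
      push_cast
      have : ((e : ℝ) + 1) * (1 / (t + 1)) ≤ 1 / 3 := by
        rw [mul_one_div, div_le_iff₀ (by linarith)]; linarith
      linarith
    have h4 : 1 + 1 / t = (1 + -(1 / (t + 1)))⁻¹ := by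
      have : t ≠ 0 := ht0.ne'
      have : t + 1 ≠ 0 := by linarith
      have h5 : 1 + -(1 / (t + 1)) = t / (t + 1) := by field_simp; ring
      rw [h5, inv_div]; field_simp
    rw [h4, inv_pow, inv_le_comm₀ (by linarith) (by norm_num)]
    linarith
  calc (t + 1) ^ e * √(t + 1) ≤ (t * (1 + 1 / t)) ^ e * ((1 + 1 / t) * √t) := by
        rw [mul_add, mul_one_div_cancel ht0.ne', mul_one]; gcongr
    _ = (1 + 1 / t) ^ (e + 1) * (t ^ e * √t) := by rw [mul_pow]; ring
    _ ≤ _ := by gcongr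

/-- Logarithmic bound for the splitting of `2 ^ k` points in dimension `e + 1`. -/
noncomputable def signBound (e k : ℕ) : ℝ :=
  272 * √(2 * (e + 6)) * ((k + 3 * (e + 1)) ^ e * √(k + 3 * (e + 1)))

theorem signBound_pos (e k : ℕ) : 0 < signBound e k := by
  unfold signBound; positivity

theorem monotone_signBound (e : ℕ) : Monotone (signBound e) := by
  intro j k h
  unfold signBound
  gcongr

theorem signBound_succ_le (e k : ℕ) : signBound e (k + 1) ≤ 3 / 2 * signBound e k := by
  have h := pow_mul_sqrt_succ_le (e := e) (t := k + 3 * (e + 1)) (by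
    have : (0 : ℝ) ≤ k := Nat.cast_nonneg k
    linarith)
  have h2 : ((k + 1 : ℕ) : ℝ) + 3 * (e + 1) = k + 3 * (e + 1) + 1 := by push_cast; ring
  rw [signBound, h2, signBound]
  calc _ ≤ 272 * √(2 * (e + 6)) * (3 / 2 * ((k + 3 * (e + 1)) ^ e * √(k + 3 * (e + 1) : ℝ))) := by
        gcongr
    _ = _ := by ring

theorem splitBound_signBound (e : ℕ) : SplitBound (e + 1) (signBound e) := by
  intro k y
  obtain ⟨ε, hε, h⟩ := exists_signs_boxInd_le e k y
  refine ⟨ε, hε, fun a => (h a).trans ?_⟩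
  unfold signBound
  have : (k : ℝ) + 1 ≤ k + 3 * (e + 1) := by
    have : (0 : ℝ) ≤ e := Nat.cast_nonneg e
    linarith
  gcongr

theorem log_two_succ_add_le (N : ℕ) (hN : 2 ≤ N) {s : ℝ} (hs : 0 ≤ s) :
    (Nat.log 2 (N + 1) : ℝ) + s ≤ (2 + s) / Real.log 2 * Real.log N := by
  have hl2 : 0 < Real.log 2 := Real.log_pos one_lt_two
  have hN' : (2 : ℝ) ≤ N := by exact_mod_cast hN
  have h1 : Real.log 2 ≤ Real.log N := Real.log_le_log two_pos hN'
  have h2 : (Nat.log 2 (N + 1) : ℝ) * Real.log 2 ≤ 2 * Real.log N := by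
    rw [← Real.log_pow, show (2 : ℝ) * Real.log N = (2 : ℕ) * Real.log N by norm_num,
      ← Real.log_pow]
    refine Real.log_le_log (by positivity) ?_
    have h3 : (2 : ℝ) ^ Nat.log 2 (N + 1) ≤ N + 1 := by
      exact_mod_cast Nat.pow_log_le_self 2 (Nat.succ_ne_zero N)
    nlinarith
  rw [div_mul_eq_mul_div, le_div_iff₀ hl2]
  nlinarith

end Bounds

/-- Infinite-sequence version of the main theorem: for every `d ≥ 1` there is a
constant `c_d > 0` such that for every Borel probability measure `μ` on `[0,1]^d`
there is an infinite sequence `(x_n)_{n ≥ 1}` in `[0,1]^d` whose first `N` terms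
satisfy `D_N*(x_1, …, x_N; μ) ≤ c_d (log N)^(d + 1/2) / N` for every `N ≥ 2`. -/
theorem exists_sequence_star_discrepancy_le (d : ℕ) (hd : 1 ≤ d) :
    ∃ c : ℝ, 0 < c ∧
      ∀ μ : Measure (Fin d → ℝ), IsProbabilityMeasure μ →
        μ (Set.Icc 0 1) = 1 →
        ∃ x : ℕ → (Fin d → ℝ),
          (∀ n, x n ∈ Set.Icc (0 : Fin d → ℝ) 1) ∧
          ∀ N : ℕ, 2 ≤ N →
            ∀ a : Fin d → ℝ, a ∈ Set.Icc (0 : Fin d → ℝ) 1 →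
              |(1 / N : ℝ) * ∑ n ∈ Finset.range N, (Set.Icc (0 : Fin d → ℝ) a).indicator
                    (fun _ => (1 : ℝ)) (x n)
                  - (μ (Set.Icc 0 a)).toReal|
                ≤ c * Real.log N ^ ((d : ℝ) + 1 / 2) / N := by
  obtain ⟨e, rfl⟩ : ∃ e, d = e + 1 := ⟨d - 1, by omega⟩
  set D : ℝ := (2 + 3 * (e + 1)) / Real.log 2
  have hl2 : 0 < Real.log 2 := Real.log_pos one_lt_two
  have hD : 0 < D := by positivity
  refine ⟨16 * (272 * √(2 * (e + 6))) * D ^ (((e + 1 : ℕ) : ℝ) + 1 / 2), by positivity,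
    fun μ _ hμ => ?_⟩
  obtain ⟨x, hx, h⟩ := exists_sequence_boxErr_le (splitBound_signBound e) (signBound_pos e)
    (monotone_signBound e) (signBound_succ_le e) μ hμ
  refine ⟨x, hx, fun N hN a _ => ?_⟩
  have hN0 : (0 : ℝ) < N := by positivity
  have hμa : (μ (Set.Icc 0 a)).toReal = μ.real (Set.Iic a) := by
    rw [measureReal_def]
    congr 1
    refine measure_congr ?_
    have hae : ∀ᵐ y ∂μ, y ∈ Set.Icc (0 : Fin (e + 1) → ℝ) 1 :=
      (prob_compl_eq_zero_iff measurableSet_Icc).2 hμ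
    filter_upwards [hae] with y hy
    exact propext ⟨fun h => h.2, fun h => ⟨hy.1, h⟩⟩
  have hind : ∀ n, (Set.Icc 0 a).indicator (fun _ => (1 : ℝ)) (x n) = boxInd a (x n) := by
    intro n
    have : x n ∈ Set.Icc 0 a ↔ x n ∈ Set.Iic a := ⟨fun h => h.2, fun h => ⟨(hx n).1, h⟩⟩
    by_cases h : x n ∈ Set.Iic a
    · rw [boxInd, Set.indicator_of_mem h, Set.indicator_of_mem (this.2 h)]
    · rw [boxInd, Set.indicator_of_notMem h, Set.indicator_of_notMem (this.not.2 h)]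
  have hb := h N a
  rw [Finset.sum_sub_distrib, Finset.sum_const, Finset.card_range, nsmul_eq_mul] at hb
  rw [hμa, Finset.sum_congr rfl fun n _ => hind n,
    show (1 / N : ℝ) * ∑ n ∈ Finset.range N, boxInd a (x n) - μ.real (Set.Iic a) =
      (∑ n ∈ Finset.range N, boxInd a (x n) - N * μ.real (Set.Iic a)) / N by field_simp,
    abs_div, abs_of_pos hN0]
  refine div_le_div_of_nonneg_right (hb.trans ?_) hN0.le
  have he : (0 : ℝ) ≤ e := Nat.cast_nonneg e
  have hlog : 0 ≤ Real.log N := Real.log_natCast_nonneg N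
  set K := Nat.log 2 (N + 1)
  set t : ℝ := K + 3 * (e + 1)
  have ht : 0 < t := by positivity
  have htD : t ≤ D * Real.log N := log_two_succ_add_le N hN (by positivity)
  have hpow : t ^ (((e + 1 : ℕ) : ℝ) + 1 / 2) = t * t ^ e * √t := by
    rw [Real.rpow_add ht, Real.rpow_natCast, pow_succ', Real.sqrt_eq_rpow]
  calc 16 * ((K : ℝ) + 1) * signBound e K ≤ 16 * t * signBound e K := by
        have := (signBound_pos e K).le
        gcongr
        simp only [t]; linarith
    _ = 16 * (272 * √(2 * (e + 6))) * t ^ (((e + 1 : ℕ) : ℝ) + 1 / 2) := by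
        rw [hpow, signBound]; ring
    _ ≤ 16 * (272 * √(2 * (e + 6))) * (D * Real.log N) ^ (((e + 1 : ℕ) : ℝ) + 1 / 2) := by
        gcongr
    _ = _ := by rw [Real.mul_rpow hD.le hlog]; ring
end
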